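/- arXiv:2207.01877 — 5 statements merged into one kernel-verified Lean document; each statement's English description precedes it below -/
import Mathlib

section
/- Let q ≥ 3 be an odd prime power and m ≥ 2 with q^m ≥ 25. Define δ3 = (q^m−1)/2 − q^{m−1} − q + 1 if q^m ≡ 1 (mod 4); δ3 = (q−1)(q^m − 2q^{m−2} − 1)/(2(q+1)) − (q−1)^2 if q^m ≡ 3 (mod 4) and m ≥ 5; and δ3 = (q−1)(q^3 − 2q − 1)/(2(q+1)) − (q+1) if q ≡ 3 (mod 4) and m = 3. Let δ1 and δ2 denote the largest and second largest odd coset leaders modulo q^m + 1. Then δ3 is the third largest odd coset leader modulo q^m + 1: δ3 is odd, δ3 is a coset leader modulo q^m + 1, δ3 < δ2 < δ1, and every odd coset leader modulo q^m + 1 other than δ1 and δ2 is at most δ3. Moreover |C_{δ3}^{(q, q^m+1)}| = 2m. -/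
/-- `i` is the smallest element of its `q`-cyclotomic coset modulo `N`,
i.e. `i < N` and `i ≤ i·q^j mod N` for all `j`. -/
def IsCosetLeader (q N i : ℕ) : Prop :=
  i < N ∧ ∀ j : ℕ, i ≤ (i * q ^ j) % N

/-- The `q`-cyclotomic coset of `i` modulo `N`. -/
def cycCoset (q N i : ℕ) : Set ℕ := {a | ∃ j : ℕ, a = (i * q ^ j) % N}

theorem IsCosetLeader.le_of_dvd {q N i : ℕ} (hi : IsCosetLeader q N i) (j : ℕ) {z : ℤ}
    (hz : 0 ≤ z) (hd : (N : ℤ) ∣ i * q ^ j - z) : (i : ℤ) ≤ z := by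
  have h1 : (i : ℤ) ≤ (i * q ^ j : ℤ) % N := by exact_mod_cast hi.2 j
  rw [Int.emod_eq_emod_iff_emod_sub_eq_zero.2 (Int.emod_eq_zero_of_dvd hd), Int.emod_def] at h1
  have h2 : 0 ≤ (N : ℤ) * (z / N) := mul_nonneg (by positivity) (Int.ediv_nonneg hz (by positivity))
  linarith

theorem dvd_mul_odd_pow_sub {q : ℕ} (hq : Odd q) (h : ℤ) (j : ℕ) :
    2 * h ∣ h * (q : ℤ) ^ j - h := by
  obtain ⟨k, hk⟩ : Odd ((q : ℤ) ^ j) := by exact_mod_cast hq.pow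
  exact ⟨k, by rw [hk]; ring⟩

/-- A coset leader `i = h - s` modulo `2 * h = q ^ m + 1` forces every element congruent to
`± s * q ^ j` to avoid the open interval `(s, 2 * h - s)`. -/
theorem IsCosetLeader.gap {q m i : ℕ} {h s y : ℤ} (hq : Odd q) (hN : (q : ℤ) ^ m + 1 = 2 * h)
    (hi : IsCosetLeader q (q ^ m + 1) i) (his : (i : ℤ) = h - s) (j : ℕ)
    (hy : 2 * h ∣ s * q ^ j - y ∨ 2 * h ∣ s * q ^ j + y) (hsy : s < y) : 2 * h - s ≤ y := by
  have hcast : ((q ^ m + 1 : ℕ) : ℤ) = 2 * h := by rw [← hN]; push_cast; ring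
  have key : ∀ (l : ℕ) (z : ℤ), 0 ≤ z → 2 * h ∣ (i : ℤ) * q ^ l - z → (i : ℤ) ≤ z :=
    fun l z hz hd => hi.le_of_dvd l hz (by rwa [hcast])
  have flip : ∀ (l : ℕ) (z : ℤ), 2 * h ∣ (i : ℤ) * q ^ l - z →
      2 * h ∣ (i : ℤ) * q ^ (l + m) - (-z) := by
    rintro l z ⟨k, hk⟩
    refine ⟨i * q ^ l - k, ?_⟩
    rw [pow_add, show (q : ℤ) ^ m = 2 * h - 1 by linarith]
    linear_combination -hk
  obtain ⟨r, hr⟩ := dvd_mul_odd_pow_sub hq h j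
  have both : ∃ l₁ l₂ : ℕ, 2 * h ∣ (i : ℤ) * q ^ l₁ - (h - y) ∧
      2 * h ∣ (i : ℤ) * q ^ l₂ - (y - h) := by
    rcases hy with ⟨k, hk⟩ | ⟨k, hk⟩
    · have h1 : 2 * h ∣ (i : ℤ) * q ^ j - (h - y) :=
        ⟨r - k, by rw [his]; linear_combination hr - hk⟩
      exact ⟨j, j + m, h1, by simpa using flip j _ h1⟩
    · have h1 : 2 * h ∣ (i : ℤ) * q ^ j - (y - h) :=
        ⟨r - k + 1, by rw [his]; linear_combination hr - hk⟩
      exact ⟨j + m, j, by simpa using flip j _ h1, h1⟩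
  obtain ⟨l₁, l₂, h1, h2⟩ := both
  rcases le_total y h with hle | hle
  · have := key l₁ _ (by linarith) h1
    linarith
  · have := key l₂ _ (by linarith) h2
    linarith

theorem IsCosetLeader.two_mul_le {q m i : ℕ} (hi : IsCosetLeader q (q ^ m + 1) i) :
    (2 * i : ℤ) ≤ (q : ℤ) ^ m + 1 := by
  have hlt : (i : ℤ) < (q : ℤ) ^ m + 1 := by exact_mod_cast hi.1
  have := hi.le_of_dvd m (z := (q : ℤ) ^ m + 1 - i) (by linarith)
    ⟨i - 1, by push_cast; ring⟩
  linarith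

theorem pow_expansion_step {q m : ℕ} {h s : ℤ} (hN : (q : ℤ) ^ m + 1 = 2 * h)
    (hm : 0 < m) (hs : 0 < s)
    (hb : ∀ d, 0 < d → d < m → ∃ y : ℤ, |y| < s ∧ 2 * h ∣ s * q ^ d - y) (d : ℕ) :
    (∃ y : ℤ, |y| ≤ s ∧ 2 * h ∣ s * q ^ d - y ∧ (y = s → 2 * m ∣ d)) ∧
    ∃ y : ℤ, |y| ≤ s ∧ 2 * h ∣ s * q ^ (d + m) - y ∧ (y = s → 2 * m ∣ d + m) := by
  have flip : ∀ (l : ℕ) (z : ℤ), 2 * h ∣ s * q ^ l - z → 2 * h ∣ s * q ^ (l + m) - (-z) := by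
    rintro l z ⟨k, hk⟩
    refine ⟨s * q ^ l - k, ?_⟩
    rw [pow_add, show (q : ℤ) ^ m = 2 * h - 1 by linarith]
    linear_combination -hk
  induction d using Nat.strong_induction_on with
  | _ d ih =>
    by_cases hdm : d < m
    · rcases Nat.eq_zero_or_pos d with rfl | hd
      · refine ⟨⟨s, (abs_of_pos hs).le, by simp, by simp⟩, -s, by simp [abs_of_pos hs],
          flip 0 s (by simp), fun hh => by linarith⟩
      · obtain ⟨y, hy, hy'⟩ := hb d hd hdm
        exact ⟨⟨y, hy.le, hy', fun hh => by rw [hh, abs_of_pos hs] at hy; exact absurd hy (lt_irrefl _)⟩,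
          -y, by rw [abs_neg]; exact hy.le, flip d y hy', fun hh => by
            rw [← abs_neg, hh, abs_of_pos hs] at hy; exact absurd hy (lt_irrefl _)⟩
    · obtain ⟨e, rfl⟩ := Nat.exists_eq_add_of_le' (not_lt.1 hdm)
      obtain ⟨⟨y, h1, h2, h3⟩, h4⟩ := ih e (by omega)
      refine ⟨h4, y, h1, by simpa using flip _ _ (flip e y h2), fun hh => ?_⟩
      have := h3 hh
      rw [add_assoc, ← two_mul]
      exact dvd_add this dvd_rfl

/-- If all `s * q ^ d` with `0 < d < m` have representatives modulo `2 * h = q ^ m + 1` of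
absolute value less than `s`, then `h - s` is a coset leader with a full coset. -/
theorem isCosetLeader_of_bound {q m i : ℕ} {h s : ℤ} (hq : Odd q)
    (hN : (q : ℤ) ^ m + 1 = 2 * h) (his : (i : ℤ) = h - s) (hm : 0 < m) (hs : 0 < s) (hsh : s < h)
    (hb : ∀ d, 0 < d → d < m → ∃ y : ℤ, |y| < s ∧ 2 * h ∣ s * q ^ d - y) :
    IsCosetLeader q (q ^ m + 1) i ∧ (cycCoset q (q ^ m + 1) i).ncard = 2 * m := by
  have hcast : ((q ^ m + 1 : ℕ) : ℤ) = 2 * h := by rw [← hN]; push_cast; ring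
  have hmod : ∀ d : ℕ, (i : ℤ) ≤ ((i * q ^ d % (q ^ m + 1) : ℕ) : ℤ) ∧
      (i * q ^ d % (q ^ m + 1) = i → 2 * m ∣ d) := by
    intro d
    obtain ⟨y, h1, ⟨k, hk⟩, h3⟩ := (pow_expansion_step hN hm hs hb d).1
    obtain ⟨r, hr⟩ := dvd_mul_odd_pow_sub hq h d
    obtain ⟨h4, h5⟩ := abs_le.1 h1
    have hval : ((i * q ^ d % (q ^ m + 1) : ℕ) : ℤ) = h - y := by
      rw [Int.natCast_mod, hcast]
      push_cast
      rw [show (i : ℤ) * q ^ d = (h - y) + 2 * h * (r - k) by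
        rw [his]; linear_combination hr - hk, Int.add_mul_emod_self_left]
      exact Int.emod_eq_of_lt (by linarith) (by linarith)
    refine ⟨by rw [hval]; linarith, fun hh => h3 ?_⟩
    rw [hh] at hval
    linarith
  have hlt : i < q ^ m + 1 := by
    zify; linarith
  have hpow : ∀ d, 2 * h ∣ (i : ℤ) * q ^ (d + 2 * m) - i * q ^ d := by
    intro d
    refine ⟨i * q ^ d * (q ^ m - 1), ?_⟩
    rw [← hN]; ring
  have hcop : IsCoprime (2 * h) (q : ℤ) := by
    obtain ⟨k, rfl⟩ : ∃ k, m = k + 1 := ⟨m - 1, by omega⟩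
    exact ⟨1, -q ^ k, by rw [← hN]; ring⟩
  refine ⟨⟨hlt, fun j => by exact_mod_cast (hmod j).1⟩, ?_⟩
  have himage : cycCoset q (q ^ m + 1) i =
      ((Finset.range (2 * m)).image fun d => i * q ^ d % (q ^ m + 1) : Finset ℕ) := by
    ext a
    simp only [cycCoset, Set.mem_ofPred_eq, Finset.coe_image, Set.mem_image, Finset.mem_coe,
      Finset.mem_range]
    constructor
    · rintro ⟨j, rfl⟩
      induction j using Nat.strong_induction_on with
      | _ j ih =>
        by_cases hj : j < 2 * m
        · exact ⟨j, hj, rfl⟩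
        · obtain ⟨e, rfl⟩ := Nat.exists_eq_add_of_le' (not_lt.1 hj)
          obtain ⟨d, hd, hd'⟩ := ih e (by omega)
          refine ⟨d, hd, hd'.trans ?_⟩
          have := (Int.modEq_iff_dvd).2 (hpow e)
          rw [← hcast] at this
          exact_mod_cast this
    · rintro ⟨d, _, rfl⟩
      exact ⟨d, rfl⟩
  rw [himage, Set.ncard_coe_finset, Finset.card_image_of_injOn, Finset.card_range]
  have hinj : ∀ a b : ℕ, a < b → b < 2 * m →
      i * q ^ a % (q ^ m + 1) ≠ i * q ^ b % (q ^ m + 1) := by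
    intro a b hab hb2 heq
    obtain ⟨e, rfl⟩ := Nat.exists_eq_add_of_lt hab
    have h1 : (2 * h) ∣ (q : ℤ) ^ a * (i * q ^ (e + 1) - i) := by
      have h2 : ((i * q ^ a : ℕ) : ℤ) ≡ (i * q ^ (a + e + 1) : ℕ) [ZMOD ((q ^ m + 1 : ℕ) : ℤ)] :=
        Int.natCast_modEq_iff.2 heq
      have h3 := h2.dvd
      rw [hcast] at h3
      convert h3 using 1
      push_cast; ring
    have h2 := (hcop.pow_right (n := a)).dvd_of_dvd_mul_left h1
    have h3 : i * q ^ (e + 1) % (q ^ m + 1) = i := by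
      have h4 := (Int.modEq_iff_dvd).2 h2
      rw [← hcast] at h4
      have h5 : i ≡ i * q ^ (e + 1) [MOD q ^ m + 1] := by
        rw [← Int.natCast_modEq_iff]; exact_mod_cast h4
      exact Eq.trans h5.symm (Nat.mod_eq_of_lt hlt)
    have h4 := Nat.le_of_dvd (by omega) ((hmod (e + 1)).2 h3)
    omega
  intro a ha b hb' hab
  simp only [Finset.coe_range, Set.mem_Iio] at ha hb'
  rcases lt_trichotomy a b with hlt' | rfl | hlt'
  · exact absurd hab (hinj a b hlt' hb')
  · rfl
  · exact absurd hab.symm (hinj b a hlt' ha)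

/-- `q ^ m ≡ 1 (mod 4)`: the gap between `(q ^ m + 1) / 2` and a coset leader below
the second one. -/
theorem IsCosetLeader.gap_of_one_mod_four {q n i : ℕ} {h s : ℤ} (hq : Odd q) (hq3 : 3 ≤ q)
    (hN : (q : ℤ) ^ (n + 2) + 1 = 2 * h) (hh : Odd h)
    (hi : IsCosetLeader q (q ^ (n + 2) + 1) i) (his : (i : ℤ) = h - s) (hs : Even s) (hs0 : 0 < s)
    (hi0 : 0 < i) (hne : s ≠ (q : ℤ) ^ (n + 1) + 1) : (q : ℤ) ^ (n + 1) + q ≤ s := by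
  by_contra! hlt
  have hQ3 : (3 : ℤ) ≤ q := by exact_mod_cast hq3
  have hQ : Odd (q : ℤ) := by exact_mod_cast hq
  have hgap := fun j y => IsCosetLeader.gap (y := y) hq hN hi his j
  have hP : (0 : ℤ) < (q : ℤ) ^ n := by positivity
  have hP1 : (1 : ℤ) ≤ (q : ℤ) ^ n := hP
  have hsh : s < h := by have : (0 : ℤ) < i := by exact_mod_cast hi0
                         linarith
  have hodd : Odd ((q : ℤ) ^ (n + 1)) := hQ.pow
  set Q : ℤ := (q : ℤ) with hQdef
  set P : ℤ := Q ^ n with hPdef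
  have e1 : Q ^ (n + 1) = Q * P := by rw [hPdef]; ring
  have e2 : Q ^ (n + 2) = Q ^ 2 * P := by rw [hPdef]; ring
  rw [e1] at hlt hne hodd
  rw [e2] at hN
  rcases lt_or_ge s (Q * P) with hsP | hsP
  · have inv : ∀ j : ℕ, ∃ y : ℤ, 0 < y ∧ y ≤ s ∧
        ((2 * h ∣ s * Q ^ j - y ∧ 4 ∣ y - s) ∨ (2 * h ∣ s * Q ^ j + y ∧ 4 ∣ y + s + 2)) := by
      intro j
      induction j with
      | zero => exact ⟨s, hs0, le_rfl, Or.inl (by simp)⟩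
      | succ j ih =>
        obtain ⟨y, hy0, hys, hy⟩ := ih
        have hQy : Q * y < 2 * h := by nlinarith
        have hQy0 : 0 < Q * y := by positivity
        have hor : 2 * h ∣ s * Q ^ (j + 1) - Q * y ∨ 2 * h ∣ s * Q ^ (j + 1) + Q * y := by
          rcases hy with ⟨⟨k, hk⟩, _⟩ | ⟨⟨k, hk⟩, _⟩
          · exact Or.inl ⟨Q * k, by linear_combination Q * hk⟩
          · exact Or.inr ⟨Q * k, by linear_combination Q * hk⟩
        have hye : Even y := by
          obtain ⟨u, hu⟩ := hs
          rcases hy with ⟨_, ⟨k, hk⟩⟩ | ⟨_, ⟨k, hk⟩⟩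
          · exact ⟨2 * k + u, by linarith⟩
          · exact ⟨2 * k - u - 1, by linarith⟩
        have h4 : 4 ∣ Q * y - y := by
          obtain ⟨u, hu⟩ := hQ
          obtain ⟨v, hv⟩ := hye
          exact ⟨u * v, by rw [hu, hv]; ring⟩
        have hh2 : ∃ w, 2 * h = 4 * w + 2 := by
          obtain ⟨w, hw⟩ := hh
          exact ⟨w, by linarith⟩
        obtain ⟨w, hw⟩ := hh2
        obtain ⟨u, hu⟩ := hs
        obtain ⟨a, ha⟩ := h4
        by_cases hle : Q * y ≤ s
        · refine ⟨Q * y, hQy0, hle, ?_⟩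
          rcases hy with ⟨⟨k, hk⟩, ⟨l, hl⟩⟩ | ⟨⟨k, hk⟩, ⟨l, hl⟩⟩
          · exact Or.inl ⟨⟨Q * k, by linear_combination Q * hk⟩, ⟨a + l, by linarith⟩⟩
          · exact Or.inr ⟨⟨Q * k, by linear_combination Q * hk⟩, ⟨a + l, by linarith⟩⟩
        · have := hgap _ _ hor (not_le.1 hle)
          refine ⟨2 * h - Q * y, by linarith, by linarith, ?_⟩
          rcases hy with ⟨⟨k, hk⟩, ⟨l, hl⟩⟩ | ⟨⟨k, hk⟩, ⟨l, hl⟩⟩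
          · exact Or.inr ⟨⟨Q * k + 1, by linear_combination Q * hk⟩,
              ⟨w + 1 - a - l, by linarith⟩⟩
          · exact Or.inl ⟨⟨Q * k - 1, by linear_combination Q * hk⟩,
              ⟨w + 1 - a - l, by linarith⟩⟩
    obtain ⟨y, hy0, hys, hy⟩ := inv (n + 2)
    have hneg : s * Q ^ (n + 2) = 2 * h * s - s := by rw [e2]; linear_combination s * hN
    rw [hneg] at hy
    obtain ⟨u, hu⟩ := hs
    rcases hy with ⟨⟨k, hk⟩, _⟩ | ⟨⟨k, hk⟩, ⟨l, hl⟩⟩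
    · have hd : 2 * h ∣ s + y := ⟨s - k, by linear_combination -hk⟩
      have := Int.le_of_dvd (by linarith) hd
      linarith
    · have hd : 2 * h ∣ s - y := ⟨s - k, by linear_combination -hk⟩
      have := Int.eq_zero_of_dvd_of_nonneg_of_lt (by linarith) (by linarith) hd
      omega
  · obtain ⟨r, hr⟩ : ∃ r, s = Q * P + r := ⟨s - Q * P, by ring⟩
    have hr3 : 3 ≤ r := by
      obtain ⟨u, hu⟩ := hs
      obtain ⟨v, hv⟩ := hodd
      have : r ≠ 1 := fun h1 => hne (by rw [hr, h1])
      omega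
    have hrq : r ≤ Q - 2 := by
      obtain ⟨u, hu⟩ := hs
      obtain ⟨v, hv⟩ := hodd
      obtain ⟨w, hw⟩ := hQ
      omega
    have hQPr : Q * P * r ≤ Q * P * (Q - 2) := by gcongr
    have hy : 2 * h ∣ s * Q ^ (n + 1) - (Q * P * r - P) :=
      ⟨P, by rw [e1, hr, ← hN]; ring⟩
    have h1 := hgap (n + 1) _ (Or.inl hy) (by nlinarith)
    nlinarith

/-- The coset leader `(q ^ m + 1) / 2 - (q ^ (m - 1) + q)` when `q ^ m ≡ 1 (mod 4)`. -/
theorem pow_add_self_bound {q n : ℕ} {h : ℤ} (hq3 : 3 ≤ q)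
    (hN : (q : ℤ) ^ (n + 2) + 1 = 2 * h) (d : ℕ) (hd0 : 0 < d) (hd : d < n + 2) :
    ∃ y : ℤ, |y| < (q : ℤ) ^ (n + 1) + q ∧
      2 * h ∣ ((q : ℤ) ^ (n + 1) + q) * q ^ d - y := by
  have hQ3 : (3 : ℤ) ≤ q := by exact_mod_cast hq3
  obtain ⟨e, rfl⟩ : ∃ e, d = e + 1 := ⟨d - 1, by omega⟩
  have hle : (q : ℤ) ^ e ≤ q ^ n := pow_le_pow_right₀ (by linarith) (by omega)
  have hP : (0 : ℤ) < (q : ℤ) ^ e := by positivity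
  have e1 : (q : ℤ) ^ (n + 1) = q * q ^ n := by ring
  rcases Nat.lt_or_ge e n with hen | hen
  · have hle' : (q : ℤ) ^ (e + 1) ≤ q ^ n := pow_le_pow_right₀ (by linarith) (by omega)
    rw [pow_succ] at hle'
    refine ⟨q ^ (e + 2) - q ^ e, ?_, q ^ e, by rw [← hN]; ring⟩
    have e2 : (q : ℤ) ^ (e + 2) = q * (q ^ e * q) := by ring
    have e3 : (q : ℤ) ^ e ≤ q * (q ^ e * q) := by
      nlinarith [mul_nonneg hP.le (show (0 : ℤ) ≤ (q : ℤ) ^ 2 - 1 by nlinarith)]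
    rw [e1, e2, abs_lt]
    constructor <;> nlinarith
  · obtain rfl : e = n := by omega
    refine ⟨-(q ^ e + 1), ?_, q ^ e + 1, by rw [← hN]; ring⟩
    rw [e1, abs_neg, abs_of_pos (by linarith)]
    nlinarith

section three_mod_four

variable {q m i : ℕ} {h s c : ℤ}

theorem IsCosetLeader.alternating_le (hq : Odd q) (hq3 : 3 ≤ q) (hN : (q : ℤ) ^ m + 1 = 2 * h)
    (hi : IsCosetLeader q (q ^ m + 1) i) (his : (i : ℤ) = h - s)
    (hc : ((q : ℤ) + 1) * c = 2 * h) (hs0 : 0 < s) : c ≤ s := by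
  have hQ3 : (3 : ℤ) ≤ q := by exact_mod_cast hq3
  by_contra! hlt
  have := hi.gap hq hN his 1 (y := q * s) (Or.inl ⟨0, by ring⟩) (by nlinarith)
  nlinarith

theorem IsCosetLeader.le_sq_mul_sub_alternating (hq : Odd q) (hq3 : 3 ≤ q)
    (hN : (q : ℤ) ^ m + 1 = 2 * h) (hm : Odd m)
    (hi : IsCosetLeader q (q ^ m + 1) i) (his : (i : ℤ) = h - s)
    (hc : ((q : ℤ) + 1) * c = 2 * h) (hcs : c < s) :
    ((q : ℤ) - 1) * c ≤ q ^ 2 * (s - c) := by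
  have hQ3 : (3 : ℤ) ≤ q := by exact_mod_cast hq3
  by_contra! hlt
  have inv : ∀ k : ℕ, ∃ a : ℤ, 0 < a ∧ a ≤ s - c ∧
      (2 * h ∣ s * q ^ (2 * k) - (c + a) ∨ 2 * h ∣ s * q ^ (2 * k) + (c + a)) := by
    intro k
    induction k with
    | zero => exact ⟨s - c, by linarith, le_rfl, Or.inl (by simp)⟩
    | succ k ih =>
      obtain ⟨a, ha0, has, ha⟩ := ih
      have hqa : (q : ℤ) ^ 2 * a ≤ q ^ 2 * (s - c) := by gcongr
      have hor : 2 * h ∣ s * q ^ (2 * (k + 1)) - (q * c - q ^ 2 * a) ∨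
          2 * h ∣ s * q ^ (2 * (k + 1)) + (q * c - q ^ 2 * a) := by
        rcases ha with ⟨l, hl⟩ | ⟨l, hl⟩
        · exact Or.inr ⟨q ^ 2 * l + q, by linear_combination (q : ℤ) ^ 2 * hl + q * hc⟩
        · exact Or.inl ⟨q ^ 2 * l - q, by linear_combination (q : ℤ) ^ 2 * hl - q * hc⟩
      by_cases hle : q * c - q ^ 2 * a ≤ s
      · exact ⟨q * c - q ^ 2 * a - c, by linarith, by linarith, by simpa using hor⟩
      · have := hi.gap hq hN his _ hor (not_le.1 hle)
        refine ⟨q ^ 2 * a, by positivity, by linarith, ?_⟩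
        rcases hor with ⟨l, hl⟩ | ⟨l, hl⟩
        · exact Or.inr ⟨l + 1, by linear_combination hl + hc⟩
        · exact Or.inl ⟨l - 1, by linear_combination hl - hc⟩
  obtain ⟨r, rfl⟩ := hm
  obtain ⟨a, ha0, has, ha⟩ := inv (r + 1)
  have hq2 : (q : ℤ) * (s - c) < c := by nlinarith
  have hneg : s * (q : ℤ) ^ (2 * (r + 1)) = 2 * h * (s * q - 1) + (c - q * (s - c)) := by
    linear_combination s * q * hN - hc
  rw [hneg] at ha
  have hpos : 0 < (q : ℤ) * (s - c) := by nlinarith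
  rcases ha with ⟨l, hl⟩ | ⟨l, hl⟩
  · have hd : 2 * h ∣ q * (s - c) + a := ⟨s * q - 1 - l, by linear_combination -hl⟩
    have := Int.le_of_dvd (by linarith) hd
    nlinarith
  · have hd : 2 * h ∣ 2 * c - q * (s - c) + a := ⟨l - (s * q - 1), by linear_combination hl⟩
    have := Int.le_of_dvd (by linarith) hd
    nlinarith

end three_mod_four

theorem exists_odd_mul_eq_pow_add_one {q : ℕ} (hq : Odd q) (k : ℕ) :
    ∃ F : ℤ, Odd F ∧ ((q : ℤ) + 1) * F = q ^ (2 * k + 1) + 1 := by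
  have hQ : Odd (q : ℤ) := by exact_mod_cast hq
  induction k with
  | zero => exact ⟨1, odd_one, by ring⟩
  | succ k ih =>
    obtain ⟨F, hF, h⟩ := ih
    exact ⟨q ^ 2 * F - (q - 1), ((hQ.pow).mul hF).sub_even (hQ.sub_odd odd_one),
      by linear_combination (q : ℤ) ^ 2 * h⟩

theorem IsCosetLeader.eq_zero_of_three_mod_four {q p i : ℕ} {h s F t : ℤ} (hq : Odd q)
    (hq3 : 3 ≤ q) (hN : (q : ℤ) ^ (p + 4) + 1 = 2 * h) (hp : 1 ≤ p)
    (hi : IsCosetLeader q (q ^ (p + 4) + 1) i) (his : (i : ℤ) = h - s)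
    (hF : ((q : ℤ) + 1) * F = q ^ p + 1) (hs : s = q ^ (p + 3) + q - q ^ 2 * F + t)
    (ht0 : 0 ≤ t) (ht : t < ((q : ℤ) - 1) ^ 2) (hte : Even t) : t = 0 := by
  have hQ3 : (3 : ℤ) ≤ q := by exact_mod_cast hq3
  have hQ : Odd (q : ℤ) := by exact_mod_cast hq
  have hgap := fun j y => IsCosetLeader.gap (y := y) hq hN hi his j
  set Q : ℤ := (q : ℤ) with hQdef
  have hPQ : Q ≤ Q ^ p := le_self_pow₀ (by linarith) (by omega)
  set P : ℤ := Q ^ p with hPdef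
  have e2 : Q ^ (p + 2) = P * Q ^ 2 := by rw [hPdef]; ring
  have e3 : Q ^ (p + 3) = P * Q ^ 3 := by rw [hPdef]; ring
  have e4 : Q ^ (p + 4) = P * Q ^ 4 := by rw [hPdef]; ring
  rw [e3] at hs
  rw [e4] at hN
  have hF0 : 0 < F := by nlinarith
  have hX : Q ^ 2 * Q ≤ P * Q ^ 2 := by nlinarith
  have hX3 : 3 * Q ^ 2 ≤ Q ^ 2 * Q := by nlinarith
  have hQ2 : 3 * Q ≤ Q ^ 2 := by nlinarith
  have hXY : 3 * (P * Q ^ 2) ≤ P * Q ^ 3 := by nlinarith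
  have hQP : 3 * P ≤ Q * P := by nlinarith
  have hQPX : 3 * (Q * P) ≤ P * Q ^ 2 := by nlinarith
  have hFP : F ≤ P := by nlinarith
  have ht' : t < Q ^ 2 - 2 * Q + 1 := by linarith
  have hQF : Q * F = P + 1 - F := by linarith
  have hQ2F : Q ^ 2 * F = Q * P + Q - P - 1 + F := by linear_combination (Q - 1) * hF
  obtain ⟨t1, t0, htt, h0, h0'⟩ : ∃ t1 t0, t = t1 * Q + t0 ∧ 0 ≤ t0 ∧ t0 < Q :=
    ⟨t / Q, t % Q, by linarith [Int.emod_add_mul_ediv t Q], Int.emod_nonneg _ (by linarith),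
      Int.emod_lt_of_pos _ (by linarith)⟩
  have h1 : 0 ≤ t1 := by nlinarith
  have h1' : t1 ≤ Q - 2 := by nlinarith
  have hd1 : 2 * h ∣ s * Q ^ (p + 3) - (t0 * Q ^ (p + 3) - t1 - Q ^ (p + 2) - 1 + Q * F) :=
    ⟨t1 + P * Q ^ 2 + 1 - Q * F, by rw [e3, e2, hs, htt, ← hN]; ring⟩
  have hd2 : 2 * h ∣ s * Q ^ (p + 2) - ((t1 + 1) * Q ^ (p + 3) + t0 * Q ^ (p + 2) - Q * P + F) :=
    ⟨P * Q - F, by rw [e3, e2, hs, htt, ← hN]; ring⟩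
  have hg1 := hgap _ _ (Or.inl hd1)
  have hg2 := hgap _ _ (Or.inl hd2)
  rw [e2, e3] at hg1 hg2
  clear hd1 hd2
  have ht0' : t0 ≤ 1 := by
    by_contra! hc
    have hl : 2 * (P * Q ^ 3) ≤ t0 * (P * Q ^ 3) := by gcongr; linarith
    have hu : t0 * (P * Q ^ 3) ≤ (Q - 1) * (P * Q ^ 3) := by gcongr; linarith
    have hu' : (Q - 1) * (P * Q ^ 3) = P * Q ^ 4 - P * Q ^ 3 := by ring
    have := hg1 (by linarith)
    linarith
  have hl0 : 0 ≤ t0 * (P * Q ^ 2) := by positivity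
  have hu0 : t0 * (P * Q ^ 2) ≤ 1 * (P * Q ^ 2) := by gcongr
  have ht1 : t1 ≤ 0 := by
    by_contra! hc
    have hQ3 : t1 ≤ Q - 3 := by
      by_contra! hc'
      obtain rfl : t1 = Q - 2 := by linarith
      have ht00 : t0 ≠ 0 := by
        rintro rfl
        obtain ⟨u, hu⟩ := hte
        obtain ⟨v, hv⟩ := (hQ.sub_even even_two).mul hQ
        omega
      have : 1 ≤ t0 := by omega
      linarith
    have hl : 2 * (P * Q ^ 3) ≤ (t1 + 1) * (P * Q ^ 3) := by gcongr; linarith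
    have hu : (t1 + 1) * (P * Q ^ 3) ≤ (Q - 2) * (P * Q ^ 3) := by gcongr; linarith
    have hu' : (Q - 2) * (P * Q ^ 3) = P * Q ^ 4 - 2 * (P * Q ^ 3) := by ring
    have := hg2 (by linarith)
    linarith
  obtain rfl : t1 = 0 := le_antisymm ht1 h1
  obtain ⟨u, hu⟩ := hte
  omega

set_option maxHeartbeats 800000 in
theorem three_mod_four_bound {q r : ℕ} {h s c F : ℤ} (hq3 : 3 ≤ q)
    (hN : (q : ℤ) ^ (2 * r + 1 + 4) + 1 = 2 * h) (hc : ((q : ℤ) + 1) * c = 2 * h)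
    (hF : ((q : ℤ) + 1) * F = q ^ (2 * r + 1) + 1) (hs : s = c + (q - 1) * q ^ 2 * F) (d : ℕ)
    (hd0 : 0 < d) (hd : d < 2 * r + 1 + 4) : ∃ y : ℤ, |y| < s ∧ 2 * h ∣ s * q ^ d - y := by
  have hQ3 : (3 : ℤ) ≤ q := by exact_mod_cast hq3
  set Q : ℤ := (q : ℤ) with hQdef
  have hPQ : Q ≤ Q ^ (2 * r + 1) := le_self_pow₀ (by linarith) (by omega)
  have hcF : c = Q ^ 4 * F - (Q - 1) * (Q ^ 2 + 1) := by
    apply mul_left_cancel₀ (show Q + 1 ≠ 0 by linarith)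
    linear_combination hc - hN - Q ^ 4 * hF
  have hbound : ∀ y : ℤ, |(Q + 1) * y| < (Q + 1) * s → |y| < s := by
    intro y hy
    rw [abs_mul, abs_of_pos (show (0 : ℤ) < Q + 1 by linarith)] at hy
    exact lt_of_mul_lt_mul_left hy (by linarith)
  have hbase : ∃ w, s * Q ^ 2 - ((Q - 1) ^ 2 * (Q ^ 2 + 1) - c) = 2 * h * w := by
    exact ⟨Q, by rw [hs, ← hc]; linear_combination -(Q - 1) * hcF⟩
  obtain ⟨w, hw⟩ := hbase
  have hflip : ∀ k, ∃ u, c * Q ^ k - (-1) ^ k * c = 2 * h * u := by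
    intro k
    induction k with
    | zero => exact ⟨0, by ring⟩
    | succ k ih =>
      obtain ⟨u, hu⟩ := ih
      exact ⟨Q * u + (-1) ^ k, by linear_combination Q * hu + (-1) ^ k * hc⟩
  have hrep : ∀ k, 2 * h ∣ s * Q ^ (k + 2) - ((Q - 1) ^ 2 * (Q ^ 2 + 1) * Q ^ k - (-1) ^ k * c) := by
    intro k
    obtain ⟨u, hu⟩ := hflip k
    exact ⟨w * Q ^ k - u, by linear_combination Q ^ k * hw - hu⟩
  set P : ℤ := Q ^ (2 * r + 1) with hPdef
  have e4 : Q ^ (2 * r + 1 + 4) = P * Q ^ 4 := by rw [hPdef]; ring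
  rw [e4] at hN
  have hP0 : 0 < P := by linarith
  have hQs : (Q + 1) * s = P * Q ^ 4 + 1 + (P * Q ^ 3 - P * Q ^ 2 + Q ^ 2 * Q - Q ^ 2) := by
    rw [hs]; linear_combination hc - hN + (Q - 1) * Q ^ 2 * hF
  have hQc : (Q + 1) * c = P * Q ^ 4 + 1 := by linarith
  have hX : Q ^ 2 * Q ≤ P * Q ^ 2 := by nlinarith
  have hX3 : 3 * Q ^ 2 ≤ Q ^ 2 * Q := by nlinarith
  have hQ2 : 3 * Q ≤ Q ^ 2 := by nlinarith
  have hXY : 3 * (P * Q ^ 2) ≤ P * Q ^ 3 := by nlinarith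
  have hYZ : 3 * (P * Q ^ 3) ≤ P * Q ^ 4 := by nlinarith
  have hQP : 3 * P ≤ P * Q := by nlinarith
  have hQPX : 3 * (P * Q) ≤ P * Q ^ 2 := by nlinarith
  have hQY : Q ^ 3 * Q ≤ P * Q ^ 3 := by nlinarith
  have hQ4 : 0 < Q ^ 3 * Q := by positivity
  obtain rfl | ⟨k, rfl⟩ : d = 1 ∨ ∃ k, d = k + 2 := by
    rcases Nat.lt_or_ge d 2 with h2 | h2
    · exact Or.inl (by omega)
    · exact Or.inr ⟨d - 2, by omega⟩
  · refine ⟨-c + (Q - 1) * Q ^ 3 * F, hbound _ ?_, 1, by rw [hs]; linear_combination hc⟩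
    rw [show (Q + 1) * (-c + (Q - 1) * Q ^ 3 * F) =
      Q ^ 3 * Q - Q ^ 2 * Q - P * Q ^ 3 - 1 by
        linear_combination (Q - 1) * Q ^ 3 * hF - hQc, hQs, abs_lt]
    constructor <;> linarith
  · have hr := hrep k
    rcases Nat.lt_or_ge k (2 * r + 1) with hk | hk
    · have hk0 : 0 < Q ^ k := by positivity
      have hQ1 : 0 < Q - 1 := by linarith
      have hQ41 : 0 < Q ^ 4 - 1 := by
        have := one_lt_pow₀ (show 1 < Q by linarith) (show 4 ≠ 0 by norm_num)
        linarith
      have hA : 0 ≤ (Q - 1) * (Q ^ 4 - 1) * Q ^ k := by positivity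
      rcases Nat.even_or_odd k with hke | hko
      · have hkP : Q ^ k * Q ≤ P := by
          rw [← pow_succ]; exact pow_le_pow_right₀ (by linarith) (by omega)
        rw [hke.neg_one_pow, one_mul] at hr
        refine ⟨_, hbound _ ?_, hr⟩
        have hA' : (Q - 1) * (Q ^ 4 - 1) * Q ^ k ≤ Q ^ 4 * (Q ^ k * Q) := by
          linarith [mul_pos (show 0 < Q ^ 4 + Q - 1 by linarith) hk0]
        have hA'' : Q ^ 4 * (Q ^ k * Q) ≤ Q ^ 4 * P := by gcongr
        rw [show (Q + 1) * ((Q - 1) ^ 2 * (Q ^ 2 + 1) * Q ^ k - c) =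
          (Q - 1) * (Q ^ 4 - 1) * Q ^ k - (P * Q ^ 4 + 1) by linear_combination -hQc, hQs, abs_lt]
        constructor <;> linarith
      · have hkP : Q ^ k * Q ^ 2 ≤ P := by
          rw [← pow_add]
          refine pow_le_pow_right₀ (by linarith) ?_
          obtain ⟨l, hl⟩ := hko
          omega
        rw [hko.neg_one_pow] at hr
        refine ⟨_, hbound _ ?_, hr⟩
        have hA' : (Q - 1) * (Q ^ 4 - 1) * Q ^ k ≤ (Q - 1) * Q ^ 2 * (Q ^ k * Q ^ 2) := by
          linarith [mul_pos hQ1 hk0]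
        have hA'' : (Q - 1) * Q ^ 2 * (Q ^ k * Q ^ 2) ≤ (Q - 1) * Q ^ 2 * P := by gcongr
        rw [show (Q + 1) * ((Q - 1) ^ 2 * (Q ^ 2 + 1) * Q ^ k - -1 * c) =
          (Q - 1) * (Q ^ 4 - 1) * Q ^ k + (P * Q ^ 4 + 1) by linear_combination hQc, hQs, abs_lt]
        constructor <;> linarith
    · obtain rfl | rfl : k = 2 * r + 1 ∨ k = 2 * r + 2 := by omega
      · rw [(odd_two_mul_add_one r).neg_one_pow, ← hPdef] at hr
        refine ⟨(Q - 1) ^ 2 * (Q ^ 2 + 1) * P - -1 * c - 2 * h, hbound _ ?_, ?_⟩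
        · rw [← hN, show (Q + 1) * ((Q - 1) ^ 2 * (Q ^ 2 + 1) * P - -1 * c - (P * Q ^ 4 + 1)) =
            -(P * Q ^ 4) - P * Q + P - Q by
            linear_combination hQc, hQs, abs_lt]
          constructor <;> linarith
        · obtain ⟨u, hu⟩ := hr
          exact ⟨u + 1, by linear_combination hu⟩
      · have hev : Even (2 * r + 2) := ⟨r + 1, by ring⟩
        rw [hev.neg_one_pow, show Q ^ (2 * r + 2) = P * Q by rw [hPdef]; ring] at hr
        refine ⟨-c - Q + 2 + Q * P * (2 * Q ^ 2 - 2 * Q + 1), hbound _ ?_, ?_⟩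
        · rw [show (Q + 1) * (-c - Q + 2 + Q * P * (2 * Q ^ 2 - 2 * Q + 1)) =
            P * Q ^ 4 - P * Q ^ 2 + P * Q + 1 + Q - Q ^ 2 by
            linear_combination -hQc, hQs, abs_lt]
          constructor <;> linarith
        · obtain ⟨u, hu⟩ := hr
          exact ⟨u + Q - 2, by linear_combination hu + (Q - 2) * hN⟩

theorem IsCosetLeader.eq_zero_of_three_mod_four_cube {q i : ℕ} {h s t : ℤ} (hq : Odd q)
    (hq3 : 3 ≤ q) (hN : (q : ℤ) ^ 3 + 1 = 2 * h) (hi : IsCosetLeader q (q ^ 3 + 1) i)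
    (his : (i : ℤ) = h - s) (hs : s = q ^ 2 + t) (ht0 : 0 ≤ t) (ht : t < q + 1) (hte : Even t) :
    t = 0 := by
  by_contra hne
  have hQ3 : (3 : ℤ) ≤ q := by exact_mod_cast hq3
  have hQ : Odd (q : ℤ) := by exact_mod_cast hq
  obtain ⟨u, hu⟩ := hte
  obtain ⟨v, hv⟩ := hQ
  have ht2 : 2 ≤ t := by omega
  have htq : t ≤ q - 1 := by omega
  have hl : 2 * (q : ℤ) ^ 2 ≤ t * q ^ 2 := by gcongr
  have hr : t * (q : ℤ) ^ 2 ≤ (q - 1) * q ^ 2 := by gcongr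
  have hsq : 3 * (q : ℤ) ≤ q ^ 2 := by nlinarith
  have := hi.gap hq hN his 2 (y := t * q ^ 2 - q)
    (Or.inl ⟨q, by rw [hs, ← hN]; ring⟩) (by linarith)
  linarith

theorem three_mod_four_cube_bound {q : ℕ} {h s : ℤ} (hq3 : 3 ≤ q) (hN : (q : ℤ) ^ 3 + 1 = 2 * h)
    (hs : s = q ^ 2 + q + 1) (d : ℕ) (hd0 : 0 < d) (hd : d < 3) :
    ∃ y : ℤ, |y| < s ∧ 2 * h ∣ s * q ^ d - y := by
  have hQ3 : (3 : ℤ) ≤ q := by exact_mod_cast hq3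
  have hsq : 3 * (q : ℤ) ≤ q ^ 2 := by nlinarith
  obtain rfl | rfl : d = 1 ∨ d = 2 := by omega
  · refine ⟨q ^ 2 + q - 1, ?_, 1, by rw [hs, ← hN]; ring⟩
    rw [abs_lt]
    constructor <;> linarith
  · refine ⟨q ^ 2 - q - 1, ?_, q + 1, by rw [hs, ← hN]; ring⟩
    rw [abs_lt]
    constructor <;> linarith

theorem IsCosetLeader.eq_or_le_of_three_mod_four {q r i : ℕ} {h s c F : ℤ} (hq : Odd q)
    (hq3 : 3 ≤ q) (hN : (q : ℤ) ^ (2 * r + 3) + 1 = 2 * h)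
    (hi : IsCosetLeader q (q ^ (2 * r + 3) + 1) i) (his : (i : ℤ) = h - s)
    (hc : ((q : ℤ) + 1) * c = 2 * h) (hcF : c = q ^ 2 * F - (q - 1)) (hs0 : 0 < s) :
    s = c ∨ c + (q - 1) * F ≤ s := by
  have hQ3 : (3 : ℤ) ≤ q := by exact_mod_cast hq3
  rcases (hi.alternating_le hq hq3 hN his hc hs0).eq_or_lt with heq | hlt
  · exact Or.inl heq.symm
  · right
    have h1 := hi.le_sq_mul_sub_alternating hq hq3 hN ⟨r + 1, by ring⟩ his hc hlt
    by_contra! hlt'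
    have h2 : (q : ℤ) ^ 2 * (s - c) ≤ q ^ 2 * ((q - 1) * F - 1) :=
      mul_le_mul_of_nonneg_left (by linarith) (by positivity)
    nlinarith

theorem three_mod_four_fst_eq {q r w : ℕ} {c : ℤ} (hw : q = 2 * w + 1) (hc0 : 0 ≤ c)
    (hcN : ((q : ℤ) + 1) * c = q ^ (2 * r + 3) + 1) :
    (((q - 1) * (q ^ (2 * r + 3) + 1) / (2 * (q + 1)) : ℕ) : ℤ) = w * c := by
  obtain ⟨c', rfl⟩ := Int.eq_ofNat_of_zero_le hc0
  rw [show q - 1 = 2 * w by omega, Nat.div_eq_of_eq_mul_right (k := w * c') (by omega)]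
  · push_cast; ring
  · have : q ^ (2 * r + 3) + 1 = (q + 1) * c' := by exact_mod_cast hcN.symm
    rw [this]; ring

theorem three_mod_four_snd_eq {q r w : ℕ} {h c F : ℤ} (hw : q = 2 * w + 1) (hc0 : 0 ≤ c - 2 * F)
    (hF : ((q : ℤ) + 1) * F = q ^ (2 * r + 1) + 1) (hcN : ((q : ℤ) + 1) * c = q ^ (2 * r + 3) + 1)
    (hh : h = (w + 1) * c) :
    (((q - 1) * (q ^ (2 * r + 3) - 2 * q ^ (2 * r + 3 - 2) - 1) / (2 * (q + 1)) : ℕ) : ℤ)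
      = h - (c + (q - 1) * F) := by
  have hQw : (q : ℤ) = 2 * w + 1 := by exact_mod_cast hw
  obtain ⟨G, hG⟩ := Int.eq_ofNat_of_zero_le hc0
  have hqG : q ^ (2 * r + 3) = 2 * q ^ (2 * r + 1) + 1 + (q + 1) * G := by
    zify
    rw [← hG]
    linear_combination 2 * hF - hcN
  have hsub : q ^ (2 * r + 3) - 2 * q ^ (2 * r + 3 - 2) - 1 = (q + 1) * G := by
    rw [hqG, show 2 * r + 3 - 2 = 2 * r + 1 by omega]; omega
  rw [hsub, show q - 1 = 2 * w by omega,
    Nat.div_eq_of_eq_mul_right (k := w * G) (by omega) (by ring)]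
  push_cast
  rw [← hG, hh, hQw]
  ring

/-- If `h - c` and `h - (c + (q - 1) * F)` are the two largest odd candidates, a third
value is the next odd coset leader as soon as no leader lies strictly between. -/
theorem third_odd_coset_leader_of_three_mod_four {q r δ1 δ2 δ3 : ℕ} {h c F s' : ℤ} (hq : Odd q)
    (hq3 : 3 ≤ q) (hN : (q : ℤ) ^ (2 * r + 3) + 1 = 2 * h) (hheven : Even h)
    (hc : ((q : ℤ) + 1) * c = 2 * h) (hcF : c = q ^ 2 * F - (q - 1)) (hF0 : 1 ≤ F) (hc0 : 0 < c)
    (hs2odd : Odd (c + ((q : ℤ) - 1) * F)) (hd1 : (δ1 : ℤ) = h - c)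
    (hd2 : (δ2 : ℤ) = h - (c + (q - 1) * F)) (hd3 : (δ3 : ℤ) = h - s') (hpos : 0 < δ3)
    (hs' : Odd s') (hlt : c + (q - 1) * F < s')
    (hb : ∀ d, 0 < d → d < 2 * r + 3 → ∃ y : ℤ, |y| < s' ∧ 2 * h ∣ s' * q ^ d - y)
    (hgap : ∀ i : ℕ, IsCosetLeader q (q ^ (2 * r + 3) + 1) i → ∀ t : ℤ, 0 ≤ t → Even t →
      (i : ℤ) = h - (c + (q - 1) * F + t) → t < s' - (c + (q - 1) * F) → t = 0) :
    Odd δ3 ∧ IsCosetLeader q (q ^ (2 * r + 3) + 1) δ3 ∧ δ3 < δ2 ∧ δ2 < δ1 ∧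
    (∀ i : ℕ, Odd i → IsCosetLeader q (q ^ (2 * r + 3) + 1) i → i ≠ δ1 → i ≠ δ2 → i ≤ δ3) ∧
    (cycCoset q (q ^ (2 * r + 3) + 1) δ3).ncard = 2 * (2 * r + 3) := by
  have hQ3 : (3 : ℤ) ≤ q := by exact_mod_cast hq3
  have hF1 : 0 < ((q : ℤ) - 1) * F := by apply mul_pos <;> linarith
  have hlead := isCosetLeader_of_bound hq hN hd3 (by omega) (by linarith)
    (by zify at hpos; linarith) hb
  refine ⟨?_, hlead.1, by zify; linarith, by zify; linarith, ?_, hlead.2⟩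
  · have : Odd (δ3 : ℤ) := by rw [hd3]; exact hheven.sub_odd hs'
    exact_mod_cast this
  intro i hiodd hi hi1 hi2
  have hiodd' : Odd (i : ℤ) := by exact_mod_cast hiodd
  have hsodd : Odd (h - i) := hheven.sub_odd hiodd'
  have hile := hi.two_mul_le
  rw [hN] at hile
  have hs0 : 0 < h - (i : ℤ) := by
    obtain ⟨u, hu⟩ := hsodd
    omega
  rcases hi.eq_or_le_of_three_mod_four hq hq3 hN (s := h - i) (by ring) hc hcF hs0 with heq | hle
  · exact absurd (by zify; linarith) hi1
  · by_contra! hlt3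
    zify at hlt3
    have := hgap i hi (h - i - (c + (q - 1) * F)) (by linarith) (hsodd.sub_odd hs2odd)
      (by ring) (by linarith)
    exact hi2 (by zify; linarith)

theorem stmt15 (q m : ℕ) (hq : Odd q) (hq3 : 3 ≤ q) (hpp : IsPrimePow q) (hm : 2 ≤ m)
    (hqm : 25 ≤ q ^ m)
    (δ1 δ2 δ3 : ℕ)
    (hδ1a : q ^ m % 4 = 1 → δ1 = (q ^ m + 1) / 2)
    (hδ1b : q ^ m % 4 = 3 → δ1 = (q - 1) * (q ^ m + 1) / (2 * (q + 1)))
    (hδ2a : q ^ m % 4 = 1 → δ2 = (q ^ m - 1) / 2 - q ^ (m - 1))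
    (hδ2b : q ^ m % 4 = 3 →
      δ2 = (q - 1) * (q ^ m - 2 * q ^ (m - 2) - 1) / (2 * (q + 1)))
    (hδ3a : q ^ m % 4 = 1 → δ3 = (q ^ m - 1) / 2 - q ^ (m - 1) - q + 1)
    (hδ3b : q ^ m % 4 = 3 → 5 ≤ m →
      δ3 = (q - 1) * (q ^ m - 2 * q ^ (m - 2) - 1) / (2 * (q + 1)) - (q - 1) ^ 2)
    (hδ3c : q % 4 = 3 → m = 3 →
      δ3 = (q - 1) * (q ^ 3 - 2 * q - 1) / (2 * (q + 1)) - (q + 1)) :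
    Odd δ3 ∧
    IsCosetLeader q (q ^ m + 1) δ3 ∧
    δ3 < δ2 ∧ δ2 < δ1 ∧
    (∀ i : ℕ, Odd i → IsCosetLeader q (q ^ m + 1) i → i ≠ δ1 → i ≠ δ2 → i ≤ δ3) ∧
    (cycCoset q (q ^ m + 1) δ3).ncard = 2 * m := by
  have hodd : Odd (q ^ m) := hq.pow
  rcases (show q ^ m % 4 = 1 ∨ q ^ m % 4 = 3 by obtain ⟨k, hk⟩ := hodd; omega) with hmod | hmod
  · obtain ⟨n, rfl⟩ : ∃ n, m = n + 2 := ⟨m - 2, by omega⟩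
    have hP0 : 0 < q ^ n := by positivity
    have e1 : q ^ (n + 1) = q * q ^ n := by ring
    have e2 : q ^ (n + 2) = q * q ^ (n + 1) := by ring
    have hsize : (q = 3 ∧ 9 ≤ q ^ (n + 1)) ∨ (5 * q ^ (n + 1) ≤ q ^ (n + 2) ∧ q ≤ q ^ (n + 1)) := by
      rcases (show q = 3 ∨ 5 ≤ q by obtain ⟨k, hk⟩ := hq; omega) with rfl | h5
      · left
        omega
      · right
        rw [e2]
        exact ⟨by gcongr, by rw [e1]; exact Nat.le_mul_of_pos_right q hP0⟩
    have hZ : 3 * q ^ (n + 1) ≤ q ^ (n + 2) := by rw [e2]; gcongr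
    have hPodd : Odd (q ^ (n + 1)) := hq.pow
    obtain ⟨h, hh, hhodd⟩ : ∃ h, q ^ (n + 2) + 1 = 2 * h ∧ Odd h :=
      ⟨(q ^ (n + 2) + 1) / 2, by omega, Nat.odd_iff.2 (by omega)⟩
    obtain ⟨k, hk⟩ := hhodd
    obtain ⟨u, hu⟩ := hPodd
    obtain ⟨v, hv⟩ := id hq
    have hd1 : δ1 = h := by rw [hδ1a hmod]; omega
    have hd2 : δ2 + (q ^ (n + 1) + 1) = h := by
      rw [hδ2a hmod, Nat.add_sub_cancel (n := n + 1) (m := 1)]; omega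
    have hd3 : δ3 + (q ^ (n + 1) + q) = h ∧ 0 < δ3 := by
      rw [hδ3a hmod, Nat.add_sub_cancel (n := n + 1) (m := 1)]; omega
    have hN : (q : ℤ) ^ (n + 2) + 1 = 2 * (h : ℤ) := by exact_mod_cast hh
    have hlead := isCosetLeader_of_bound (i := δ3) (s := (q : ℤ) ^ (n + 1) + q) hq hN
      (by zify at hd3; linarith) (by omega) (by positivity) (by zify at hd3; linarith)
      (pow_add_self_bound hq3 hN)
    refine ⟨Nat.odd_iff.2 (by omega), hlead.1, by omega, by omega, fun i hi hlead_i hi1 hi2 => ?_,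
      hlead.2⟩
    have hile := hlead_i.two_mul_le
    rw [hN] at hile
    obtain ⟨w, hw⟩ := hi
    have := hlead_i.gap_of_one_mod_four (h := h) (s := h - i) hq hq3 hN ⟨k, by omega⟩ (by ring)
      ⟨k - w, by omega⟩ (by omega) (by omega) (by zify at hd2 hi2; intro hh; apply hi2; linarith)
    zify at hd3 ⊢
    linarith
  · have hmodd : Odd m := by
      by_contra hme
      obtain ⟨k, rfl⟩ := Nat.not_odd_iff_even.1 hme
      obtain ⟨u, hu⟩ := hq.pow (n := k)
      rw [pow_add, hu, show (2 * u + 1) * (2 * u + 1) = 4 * (u * u + u) + 1 by ring] at hmod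
      omega
    have hq4 : q % 4 = 3 := by
      have h1 : q % 4 = 1 ∨ q % 4 = 3 := by obtain ⟨k, hk⟩ := hq; omega
      rcases h1 with h1 | h1
      · rw [Nat.pow_mod, h1] at hmod; simp at hmod
      · exact h1
    obtain ⟨r, rfl⟩ : ∃ r, m = 2 * r + 3 := by
      obtain ⟨l, hl⟩ := hmodd
      exact ⟨l - 1, by omega⟩
    obtain ⟨w, hw⟩ := id hq
    obtain ⟨v, hv⟩ : ∃ v, w = 2 * v + 1 := ⟨w / 2, by omega⟩
    obtain ⟨F, hFodd, hF⟩ := exists_odd_mul_eq_pow_add_one hq r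
    have hQ : Odd (q : ℤ) := by exact_mod_cast hq
    have hQ3 : (3 : ℤ) ≤ q := by exact_mod_cast hq3
    have hQw : (q : ℤ) = 2 * w + 1 := by exact_mod_cast hw
    have hF0 : 1 ≤ F := by
      have : (0 : ℤ) < q ^ (2 * r + 1) := by positivity
      nlinarith
    obtain ⟨c, hcF⟩ : ∃ c, c = (q : ℤ) ^ 2 * F - (q - 1) := ⟨_, rfl⟩
    have hcodd : Odd c := by
      rw [hcF]; exact ((hQ.pow).mul hFodd).sub_even (hQ.sub_odd odd_one)
    have hcN : ((q : ℤ) + 1) * c = q ^ (2 * r + 3) + 1 := by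
      rw [hcF]; linear_combination (q : ℤ) ^ 2 * hF
    obtain ⟨h, hh⟩ : ∃ h : ℤ, h = (w + 1) * c := ⟨_, rfl⟩
    have hc : ((q : ℤ) + 1) * c = 2 * h := by rw [hh, hQw]; ring
    have hN : (q : ℤ) ^ (2 * r + 3) + 1 = 2 * h := by rw [← hcN, hc]
    have hheven : Even h := by
      rw [hh, hv]; push_cast; exact ⟨(v + 1) * c, by ring⟩
    have hF0' : (q ^ 2 - 2 : ℤ) ≤ (q ^ 2 - 2) * F := le_mul_of_one_le_right (by nlinarith) hF0
    have hcF2 : 2 * ((q : ℤ) - 1) < c - 2 * F := by rw [hcF]; nlinarith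
    have hd1 : (δ1 : ℤ) = h - c := by
      rw [hδ1b hmod, three_mod_four_fst_eq hw (by linarith) hcN, hh]; ring
    have hd2 := three_mod_four_snd_eq (h := h) hw (by linarith) hF hcN hh
    have hd2' : (δ2 : ℤ) = h - (c + (q - 1) * F) := by rw [hδ2b hmod, hd2]
    have hhG : h - (c + (q - 1) * F) = w * (c - 2 * F) := by rw [hh, hQw]; ring
    have hw1 : (1 : ℤ) ≤ w := by omega
    have hwG : w * (2 * ((q : ℤ) - 1)) < h - (c + (q - 1) * F) := by rw [hhG]; gcongr
    have hs2odd : Odd (c + ((q : ℤ) - 1) * F) :=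
      hcodd.add_even ((hQ.sub_odd odd_one).mul_right F)
    rcases Nat.eq_zero_or_pos r with rfl | hr
    · have hF1 : F = 1 := by
        have : ((q : ℤ) + 1) * (F - 1) = 0 := by linear_combination hF
        rcases mul_eq_zero.1 this with h0 | h0 <;> linarith
      have hs2 : c + ((q : ℤ) - 1) * F = q ^ 2 := by rw [hcF, hF1]; ring
      have hlt : (q : ℤ) + 1 < h - (c + (q - 1) * F) := by nlinarith
      have hd3 : (δ3 : ℤ) = h - (c + (q - 1) * F) - (q + 1) := by
        have h3 := hδ3c hq4 rfl
        simp only [mul_zero, zero_add, Nat.reduceSub, pow_one] at hd2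
        generalize (q - 1) * (q ^ 3 - 2 * q - 1) / (2 * (q + 1)) = D at h3 hd2
        omega
      refine third_odd_coset_leader_of_three_mod_four hq hq3 hN hheven hc hcF hF0 (by linarith)
        hs2odd hd1 hd2' (s' := q ^ 2 + q + 1) (by linarith) (by zify; linarith) ?_ (by linarith)
        (three_mod_four_cube_bound hq3 hN rfl) fun i hi t ht0 hte hit ht => ?_
      · exact ((hQ.pow).add_odd hQ).add_odd odd_one
      · exact hi.eq_zero_of_three_mod_four_cube hq hq3 hN hit (by rw [hs2]) ht0 (by linarith) hte
    · obtain ⟨p, rfl⟩ : ∃ p, r = p + 1 := ⟨r - 1, by omega⟩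
      obtain ⟨F', -, hF'⟩ := exists_odd_mul_eq_pow_add_one hq p
      have hFF' : F = q ^ 2 * F' - (q - 1) := by
        have : ((q : ℤ) + 1) * (F - (q ^ 2 * F' - (q - 1))) = 0 := by
          linear_combination hF - (q : ℤ) ^ 2 * hF'
        rcases mul_eq_zero.1 this with h0 | h0 <;> linarith
      have hs3 : c + ((q : ℤ) - 1) * F + (q - 1) ^ 2 = c + (q - 1) * q ^ 2 * F' := by
        rw [hFF']; ring
      have hs2 : c + ((q : ℤ) - 1) * F = q ^ (2 * p + 1 + 3) + q - q ^ 2 * F' := by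
        rw [hcF, hFF']; linear_combination (q : ℤ) ^ 3 * hF'
      have hlt : ((q : ℤ) - 1) ^ 2 < h - (c + (q - 1) * F) := by
        refine lt_of_eq_of_lt ?_ hwG
        rw [hQw]; ring
      have hd3 : (δ3 : ℤ) = h - (c + (q - 1) * F) - (q - 1) ^ 2 := by
        have h3 := hδ3b hmod (by omega)
        have hsq : (((q - 1) ^ 2 : ℕ) : ℤ) = ((q : ℤ) - 1) ^ 2 := by
          rw [Nat.cast_pow, Nat.cast_pred (by omega)]
        rw [← hd2] at hlt ⊢
        rw [← hsq] at hlt ⊢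
        rw [h3, Nat.cast_sub (by exact_mod_cast hlt.le)]
      have hsq0 : (0 : ℤ) < (q - 1) ^ 2 := pow_pos (by linarith) 2
      have hexp : 2 * (p + 1) + 3 = 2 * p + 1 + 4 := by ring
      have hN' : (q : ℤ) ^ (2 * p + 1 + 4) + 1 = 2 * h := by rw [← hN, hexp]
      refine third_odd_coset_leader_of_three_mod_four hq hq3 hN hheven hc hcF hF0 (by linarith)
        hs2odd hd1 hd2' (s' := c + (q - 1) * F + (q - 1) ^ 2) (by linarith) (by zify; linarith) ?_
        (by linarith) ?_ fun i hi t ht0 hte hit ht => ?_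
      · exact hs2odd.add_even ((hQ.sub_odd odd_one).pow_of_ne_zero two_ne_zero)
      · rw [hs3, hexp]
        exact three_mod_four_bound hq3 hN' hc hF' rfl
      · rw [hexp] at hi
        exact IsCosetLeader.eq_zero_of_three_mod_four hq hq3 hN' (by omega) hi hit
          hF' (by rw [hs2]) ht0 (by linarith) hte
end

section
/- Let q be an odd prime power, m ≥ 2, and n = (q^m+1)/2. Let δ1, δ2, δ3 be the first, second and third largest odd coset leaders modulo q^m + 1, and set κ = 1 if q^m ≡ 1 (mod 4) and κ = 2 if q^m ≡ 3 (mod 4). Then for i = 1, 2 and every integer δ with (δ_{i+1}+3)/2 ≤ δ ≤ (δ_i+1)/2, the negacyclic BCH code C_{(q,n,δ,0)} has length n, dimension 2m(i−1) + κ, and minimum distance d ≥ δ_i; and if q^m ≥ 25, the code C_{(q,n,(δ3+1)/2,0)} has length n, dimension 4m + κ, and minimum distance d ≥ δ3. -/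
open Polynomial

/-- Every nonzero codeword of the negacyclic code of length `n` over `F` with
generator polynomial `g` has Hamming weight at least `d` (i.e. the minimum
distance is at least `d`). -/
def MinDistLB {F : Type*} [Field F] (g : Polynomial F) (n d : ℕ) : Prop :=
  ∀ c : Polynomial F, c ≠ 0 → g ∣ c → c.natDegree < n → d ≤ c.support.card

/-- Every multiple `q ^ j * e` has a representative modulo `N` of absolute value at most `e`. -/
def OrbitBounded (q N e : ℤ) : Prop :=
  ∀ j : ℕ, ∃ z : ℤ, |z| ≤ e ∧ N ∣ q ^ j * e - z

lemma OrbitBounded.le_mul_of_even {q N e : ℤ} {m : ℕ} (h : OrbitBounded q N e)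
    (hN : N = q ^ m + 1) (hq : Odd q) (hq3 : 3 ≤ q) (he : 0 < e) (hev : Even e) :
    N ≤ q * e := by
  by_contra! hlt
  have h3 : 3 * e ≤ q * e := by nlinarith
  have key : ∀ j : ℕ, ∃ D x : ℤ, 0 ≤ x ∧ x ≤ e ∧
      ((Even D ∧ q ^ j * e - N * D = x) ∨ (Odd D ∧ q ^ j * e - N * D = -x)) := by
    intro j
    induction j with
    | zero => exact ⟨0, e, he.le, le_rfl, Or.inl ⟨by simp, by simp⟩⟩
    | succ j ih =>
      obtain ⟨D, x, hx0, hxe, hD⟩ := ih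
      obtain ⟨z, hz, D', hD'⟩ := h (j + 1)
      rw [abs_le] at hz
      have hqx0 : 0 ≤ q * x := by positivity
      have hqx : q * x ≤ q * e := by nlinarith
      rcases hD with ⟨hpar, hD⟩ | ⟨hpar, hD⟩
      · have hEq : q * x - z = N * (D' - q * D) := by
          rw [mul_sub, ← hD', ← hD]; ring
        have h1 : D' - q * D < 2 := by by_contra! hc; nlinarith
        have h2 : -1 < D' - q * D := by by_contra! hc; nlinarith
        have hqD : Even (q * D) := hpar.mul_left q
        obtain h0 | h0 : D' - q * D = 0 ∨ D' - q * D = 1 := by omega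
        · refine ⟨D', z, ?_, hz.2, Or.inl ⟨?_, by linarith⟩⟩
          · rw [h0] at hEq; linarith
          · rwa [show D' = q * D by linarith]
        · refine ⟨D', -z, ?_, by linarith, Or.inr ⟨?_, by linarith⟩⟩
          · rw [h0] at hEq; linarith
          · rw [show D' = q * D + 1 by linarith]; exact hqD.add_one
      · have hEq : q * x + z = N * (q * D - D') := by
          rw [mul_sub, ← hD', ← neg_eq_iff_eq_neg.mpr hD]; ring
        have h1 : q * D - D' < 2 := by by_contra! hc; nlinarith
        have h2 : -1 < q * D - D' := by by_contra! hc; nlinarith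
        have hqD : Odd (q * D) := hq.mul hpar
        obtain h0 | h0 : q * D - D' = 0 ∨ q * D - D' = 1 := by omega
        · refine ⟨D', -z, ?_, by linarith, Or.inr ⟨?_, by linarith⟩⟩
          · rw [h0] at hEq; linarith
          · rwa [show D' = q * D by linarith]
        · refine ⟨D', z, ?_, hz.2, Or.inl ⟨?_, by linarith⟩⟩
          · rw [h0] at hEq; linarith
          · rw [show D' = q * D - 1 by linarith]; exact hqD.sub_odd odd_one
  obtain ⟨D, x, hx0, hxe, ⟨hpar, hD⟩ | ⟨hpar, hD⟩⟩ := key m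
  · have : N * (e - D) = x + e := by rw [← hD, hN]; ring
    have h1 : e - D < 1 := by by_contra! hc; nlinarith
    have h2 : 0 < e - D := by by_contra! hc; nlinarith
    omega
  · have : N * (e - D) = e - x := by
      have : x = -(q ^ m * e - N * D) := by linarith
      rw [this, hN]; ring
    have h1 : e - D < 1 := by by_contra! hc; nlinarith
    have h2 : -1 < e - D := by by_contra! hc; nlinarith
    have : e = D := by omega
    exact (Int.not_even_iff_odd.mpr hpar) (this ▸ hev)

lemma OrbitBounded.le_succ_mul {q N e : ℤ} (h : OrbitBounded q N e)
    (hq3 : 3 ≤ q) (he : 0 < e) (heN : 2 * e < N) : N ≤ (q + 1) * e := by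
  by_contra! hlt
  obtain ⟨z, hz, t, ht⟩ := h 1
  rw [abs_le] at hz
  have h3 : 3 * e ≤ q * e := by nlinarith
  have h1 : t < 1 := by by_contra! hc; nlinarith
  have h2 : 0 < t := by by_contra! hc; nlinarith
  omega

lemma OrbitBounded.lt_of_odd {q N e : ℤ} {m : ℕ} (h : OrbitBounded q N e)
    (hN : N = q ^ m + 1) (hm : Odd m) (hq3 : 3 ≤ q) (he : 0 < e)
    (hgt : N < (q + 1) * e) : (q - 1) * N < q ^ 2 * ((q + 1) * e - N) := by
  by_contra! hle
  have hN0 : 0 < N := by rw [hN]; positivity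
  have hqe : q * e < N := by
    by_contra! hc
    nlinarith [mul_le_mul_of_nonneg_left hc (show 0 ≤ q * (q + 1) by positivity)]
  have h3 : 3 * e ≤ q * e := by nlinarith
  have key : ∀ j : ℕ, ∃ x : ℤ, 0 ≤ x ∧ x ≤ e ∧ (N ∣ q ^ j * e - x ∨ N ∣ q ^ j * e + x) ∧
      (Even j → N ≤ (q + 1) * x) ∧ (Odd j → (q + 1) * x ≤ N ∧ N - q * e ≤ x) := by
    intro j
    induction j with
    | zero =>
      exact ⟨e, he.le, le_rfl, Or.inl (by simp), fun _ => hgt.le, fun h => absurd h (by simp)⟩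
    | succ j ih =>
      obtain ⟨x, hx0, hxe, hxN, hev, hod⟩ := ih
      obtain ⟨z, hz, hzN⟩ := h (j + 1)
      have hdiv : N ∣ q * x - |z| ∨ N ∣ q * x + |z| := by
        have e1 : ∀ s : ℤ, q * s - z = (q ^ (j + 1) * e - z) - q * (q ^ j * e - s) := by
          intro s; ring
        have e2 : ∀ s : ℤ, q * s + z = q * (q ^ j * e + s) - (q ^ (j + 1) * e - z) := by
          intro s; ring
        rcases hxN with hxN | hxN
        · have : N ∣ q * x - z := by
            rw [e1]; exact dvd_sub hzN (hxN.mul_left q)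
          rcases abs_choice z with hc | hc <;> rw [hc]
          · exact Or.inl this
          · right; simpa [sub_eq_add_neg] using this
        · have : N ∣ q * x + z := by
            rw [e2]; exact dvd_sub (hxN.mul_left q) hzN
          rcases abs_choice z with hc | hc <;> rw [hc]
          · exact Or.inr this
          · left; simpa [sub_eq_add_neg] using this
      have hqx : q * x ≤ q * e := by nlinarith
      have hqx0 : 0 ≤ q * x := by positivity
      have hy0 := abs_nonneg z
      have hcase : |z| = q * x ∨ |z| = N - q * x := by
        rcases hdiv with ⟨t, ht⟩ | ⟨t, ht⟩
        · left
          have h1 : t < 1 := by by_contra! hc; nlinarith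
          have h2 : -1 < t := by by_contra! hc; nlinarith
          have : t = 0 := by omega
          rw [this] at ht; linarith
        · have h1 : t < 2 := by by_contra! hc; nlinarith
          have h2 : -1 < t := by by_contra! hc; nlinarith
          obtain h0 | h0 : t = 0 ∨ t = 1 := by omega
          · left; rw [h0] at ht; linarith
          · right; rw [h0] at ht; linarith
      refine ⟨|z|, hy0, hz, ?_, ?_, ?_⟩
      · rcases abs_choice z with hc | hc <;> rw [hc]
        · exact Or.inl hzN
        · right; simpa [sub_eq_add_neg] using hzN
      · intro hp
        obtain ⟨hx1, hx2⟩ := hod (by rw [Nat.even_add_one] at hp; exact Nat.not_even_iff_odd.mp hp)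
        rcases hcase with hc | hc <;> rw [hc]
        · nlinarith [mul_le_mul_of_nonneg_left hx2 (show 0 ≤ q * (q + 1) by positivity)]
        · nlinarith
      · intro hp
        have hx1 := hev (by rw [Nat.odd_add_one] at hp; exact Nat.not_odd_iff_even.mp hp)
        rcases hcase with hc | hc
        · exfalso
          have h5 : q * (q * x) < N := by nlinarith
          nlinarith
        · rw [hc]
          constructor
          · nlinarith
          · linarith
  obtain ⟨x, hx0, hxe, hxN, -, hod⟩ := key m
  obtain ⟨hx1, -⟩ := hod hm
  have hqm : q ^ m = N - 1 := by linarith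
  rw [hqm] at hxN
  rcases hxN with ⟨t, ht⟩ | ⟨t, ht⟩
  · have hh : N * (e - t) = e + x := by linear_combination ht
    have h1 : e - t < 1 := by by_contra! hc; nlinarith
    have h2 : 0 < e - t := by by_contra! hc; nlinarith
    omega
  · have hh : N * (e - t) = e - x := by linear_combination ht
    have h1 : e - t < 1 := by by_contra! hc; nlinarith
    have h2 : -1 < e - t := by by_contra! hc; nlinarith
    have h0 : e - t = 0 := by omega
    rw [h0] at hh
    have : x = e := by linarith
    rw [this] at hx1
    linarith

lemma exists_odd_cofactor (Q : ℤ) (hQ : Odd Q) (hQ3 : 3 ≤ Q) (s : ℕ) :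
    ∃ R : ℤ, Odd R ∧ Q ^ (2 * s + 1) + 1 = (Q + 1) * R ∧ 1 ≤ R ∧
      (1 ≤ s → Q ^ 2 - Q + 1 ≤ R) := by
  induction s with
  | zero => exact ⟨1, odd_one, by simp, le_rfl, by simp⟩
  | succ s ih =>
    obtain ⟨R, hR, hE, h1, -⟩ := ih
    refine ⟨Q ^ 2 * R - (Q - 1), (hQ.pow.mul hR).sub_even (hQ.sub_odd odd_one), ?_, ?_, ?_⟩
    · have : Q ^ (2 * (s + 1) + 1) = Q ^ 2 * Q ^ (2 * s + 1) := by ring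
      rw [this]; linear_combination Q ^ 2 * hE
    · nlinarith
    · intro _; nlinarith

lemma exists_divisor_of_short {q m : ℕ} (hq : Odd q) (hq3 : 3 ≤ q) {i j : ℕ}
    (hj0 : 0 < j) (hj : j < 2 * m) (h : i * q ^ j ≡ i [MOD (q ^ m + 1)]) :
    q ^ m + 1 ∣ 2 * i ∨ ∃ (k r : ℕ) (R : ℤ), m = k * r ∧ Odd r ∧ 3 ≤ r ∧ 0 < k ∧ Odd R ∧
      ((q : ℤ) ^ m + 1 = ((q : ℤ) ^ k + 1) * R) ∧
      ((q : ℤ) ^ k) ^ 2 - (q : ℤ) ^ k + 1 ≤ R ∧ R ∣ (i : ℤ) := by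
  set N := q ^ m + 1 with hNdef
  have hqm : (q : ZMod N) ^ m = -1 := by
    have : ((q ^ m + 1 : ℕ) : ZMod N) = 0 := by rw [← hNdef]; exact ZMod.natCast_self N
    push_cast at this
    exact eq_neg_of_add_eq_zero_left this
  let f : ZMod N → ZMod N := fun x => x * q
  have hf : ∀ a : ℕ, f^[a] (i : ZMod N) = i * (q : ZMod N) ^ a := by
    intro a
    induction a with
    | zero => simp
    | succ a ih => rw [Function.iterate_succ_apply', ih]; simp only [f]; ring
  have hper : ∀ a : ℕ, Function.IsPeriodicPt f a (i : ZMod N) ↔ (i : ZMod N) * (q : ZMod N) ^ a = i := by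
    intro a; rw [← hf]; rfl
  have p1 : Function.IsPeriodicPt f j (i : ZMod N) := by
    rw [hper]
    have := (ZMod.natCast_eq_natCast_iff _ _ _).mpr h
    push_cast at this; exact this
  have p2 : Function.IsPeriodicPt f (2 * m) (i : ZMod N) := by
    rw [hper, mul_comm 2 m, pow_mul, hqm]; ring
  have p3 := p1.gcd p2
  set p := j.gcd (2 * m) with hp
  have hpd : p ∣ 2 * m := Nat.gcd_dvd_right _ _
  have hplt : p < 2 * m := lt_of_le_of_lt (Nat.gcd_le_left _ hj0) hj
  have hp0 : 0 < p := Nat.gcd_pos_of_pos_left _ hj0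
  by_cases hpm : p ∣ m
  · left
    have p4 := p3.trans_dvd hpm
    rw [hper, hqm] at p4
    have : ((2 * i : ℕ) : ZMod N) = 0 := by
      push_cast
      linear_combination -p4
    exact (ZMod.natCast_eq_zero_iff _ _).mp this
  · right
    obtain ⟨r, hr⟩ := hpd
    have hrodd : Odd r := by
      by_contra hc
      rw [Nat.not_odd_iff_even] at hc
      obtain ⟨t, rfl⟩ := hc
      exact hpm ⟨t, by linarith⟩
    have hpe : Even p := by
      have : Even (p * r) := hr ▸ even_two_mul m
      rcases Nat.even_mul.mp this with h | h
      · exact h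
      · exact absurd h (Nat.not_even_iff_odd.mpr hrodd)
    obtain ⟨k, hk⟩ := hpe
    have hmk : m = k * r := by
      have : 2 * m = 2 * (k * r) := by rw [hr, hk]; ring
      omega
    have hr3 : 3 ≤ r := by
      obtain ⟨t, rfl⟩ := hrodd
      rcases Nat.eq_zero_or_pos t with rfl | ht
      · omega
      · omega
    have hk0 : 0 < k := by omega
    obtain ⟨s, hs⟩ := hrodd
    have hQ3 : (3 : ℤ) ≤ (q : ℤ) ^ k := by
      have : 3 ≤ q ^ k := hq3.trans (Nat.le_self_pow hk0.ne' q)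
      exact_mod_cast this
    obtain ⟨R, hRo, hRe, hR1, hRb⟩ := exists_odd_cofactor ((q : ℤ) ^ k)
      (by exact_mod_cast hq.pow) hQ3 s
    have hNR : (q : ℤ) ^ m + 1 = ((q : ℤ) ^ k + 1) * R := by
      rw [← hRe, ← hs, ← pow_mul, ← hmk]
    refine ⟨k, r, R, hmk, ⟨s, hs⟩, hr3, hk0, hRo, hNR, hRb (by omega), ?_⟩
    have p4 : (i : ZMod N) * (q : ZMod N) ^ k = -i := by
      have h5 := (hper _).mp (p3.mul_const s)
      have h6 : (i : ZMod N) * (q : ZMod N) ^ m = i * (q : ZMod N) ^ (p * s) * q ^ k := by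
        rw [mul_assoc, ← pow_add]
        congr 2
        rw [hmk, hs, hk]; ring
      rw [h5, hqm] at h6
      rw [← h6]; ring
    have hdvd : (N : ℤ) ∣ i * ((q : ℤ) ^ k + 1) := by
      have : ((i * ((q : ℤ) ^ k + 1) : ℤ) : ZMod N) = 0 := by
        push_cast
        linear_combination p4
      exact (ZMod.intCast_zmod_eq_zero_iff_dvd _ _).mp this
    have hN' : (N : ℤ) = R * ((q : ℤ) ^ k + 1) := by
      rw [hNdef]; push_cast; rw [hNR]; ring
    rw [hN'] at hdvd
    exact Int.dvd_of_mul_dvd_mul_right (by positivity) hdvd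

lemma OrbitBounded.of_lt {q e : ℤ} {m : ℕ} (hm : 0 < m)
    (h : ∀ j < m, ∃ z : ℤ, |z| ≤ e ∧ q ^ m + 1 ∣ q ^ j * e - z) :
    OrbitBounded q (q ^ m + 1) e := by
  intro j
  induction j using Nat.strong_induction_on with
  | _ j ih =>
    by_cases hj : j < m
    · exact h j hj
    · obtain ⟨z, hz, hd⟩ := ih (j - m) (by omega)
      refine ⟨-z, by rwa [abs_neg], ?_⟩
      have : q ^ j = q ^ m * q ^ (j - m) := by rw [← pow_add]; congr 1; omega
      rw [this, show q ^ m * q ^ (j - m) * e - -z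
        = (q ^ m + 1) * (q ^ (j - m) * e) - (q ^ (j - m) * e - z) by ring]
      exact dvd_sub (dvd_mul_right _ _) hd

lemma dvd_pow_mul_sub_self {q n : ℤ} (hq : Odd q) (j : ℕ) : 2 * n ∣ q ^ j * n - n := by
  have h : Even (q ^ j - 1) := hq.pow.sub_odd odd_one
  obtain ⟨t, ht⟩ := h
  exact ⟨t, by linear_combination n * ht⟩

lemma OrbitBounded.isCosetLeader {q N n e : ℕ} (h : OrbitBounded q N e) (hN : N = 2 * n)
    (hq : Odd q) (he : e < n) : IsCosetLeader q N (n - e) := by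
  refine ⟨by omega, fun j => ?_⟩
  obtain ⟨z, hz, hd⟩ := h j
  rw [abs_le] at hz
  have h1 : ((N : ℤ)) ∣ ((n - e : ℕ) : ℤ) * q ^ j - (n - z) := by
    have h2 := dvd_pow_mul_sub_self (q := (q : ℤ)) (n := n) (by exact_mod_cast hq) j
    rw [show (2 * (n : ℤ)) = N by rw [hN]; push_cast; ring] at h2
    have := dvd_sub h2 hd
    rw [Nat.cast_sub he.le, show ((n : ℤ) - e) * q ^ j - (n - z)
      = (q : ℤ) ^ j * n - n - ((q : ℤ) ^ j * e - z) by ring]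
    exact this
  have h3 : ((n - e : ℕ) : ℤ) * q ^ j % N = n - z := by
    rw [Int.emod_eq_emod_iff_emod_sub_eq_zero.mpr (Int.emod_eq_zero_of_dvd h1)]
    exact Int.emod_eq_of_lt (by omega) (by omega)
  have h4 : (((n - e) * q ^ j % N : ℕ) : ℤ) = n - z := by
    rw [← h3]; push_cast; rfl
  omega

lemma IsCosetLeader.orbitBounded {q m n i : ℕ} (h : IsCosetLeader q (q ^ m + 1) i)
    (hn : q ^ m + 1 = 2 * n) (hq : Odd q) (hi : 0 < i) :
    i ≤ n ∧ OrbitBounded q ((q : ℤ) ^ m + 1) (n - i) := by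
  have hN : ((q : ℤ) ^ m + 1) = 2 * n := by exact_mod_cast hn
  have key : ∀ j, i ≤ i * q ^ j % (q ^ m + 1) ∧ i * q ^ j % (q ^ m + 1) + i ≤ 2 * n := by
    intro j
    refine ⟨h.2 j, ?_⟩
    have h1 := h.2 (j + m)
    have hlt : i * q ^ j % (q ^ m + 1) < q ^ m + 1 := Nat.mod_lt _ (by omega)
    have hdvd : (q ^ m + 1) ∣ i * q ^ (j + m) % (q ^ m + 1) + i * q ^ j % (q ^ m + 1) := by
      rw [Nat.dvd_iff_mod_eq_zero, ← Nat.add_mod]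
      rw [show i * q ^ (j + m) + i * q ^ j = (q ^ m + 1) * (i * q ^ j) by ring]
      exact Nat.mul_mod_right _ _
    have hlt' : i * q ^ (j + m) % (q ^ m + 1) < q ^ m + 1 := Nat.mod_lt _ (by omega)
    obtain ⟨t, ht⟩ := hdvd
    have : t < 2 := by by_contra! hc; nlinarith
    have : 0 < t := by
      rcases Nat.eq_zero_or_pos t with rfl | h0
      · omega
      · exact h0
    have : t = 1 := by omega
    subst this
    omega
  have h0 := key 0
  have hmod : i * q ^ 0 % (q ^ m + 1) = i := by simpa using Nat.mod_eq_of_lt h.1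
  refine ⟨by omega, fun j => ?_⟩
  obtain ⟨k1, k2⟩ := key j
  refine ⟨n - (i * q ^ j % (q ^ m + 1) : ℕ), ?_, ?_⟩
  · rw [abs_le]; constructor <;> omega
  · have h2 := dvd_pow_mul_sub_self (q := (q : ℤ)) (n := n) (by exact_mod_cast hq) j
    rw [← hN] at h2
    have h3 : ((q : ℤ) ^ m + 1) ∣ (i * q ^ j : ℤ) - (i * q ^ j % (q ^ m + 1) : ℕ) := by
      have := Int.dvd_self_sub_emod (x := (i * q ^ j : ℤ)) (m := (q : ℤ) ^ m + 1)
      push_cast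
      exact this
    rw [show (q : ℤ) ^ j * (n - i) - (n - (i * q ^ j % (q ^ m + 1) : ℕ))
      = (q : ℤ) ^ j * n - n - ((i * q ^ j : ℤ) - (i * q ^ j % (q ^ m + 1) : ℕ)) by ring]
    exact dvd_sub h2 h3

lemma orbitBounded_pow_add_one {q : ℤ} (hq : 3 ≤ q) (t : ℕ) :
    OrbitBounded q (q ^ (t + 1) + 1) (q ^ t + 1) := by
  refine OrbitBounded.of_lt (by omega) fun j hj => ?_
  rcases j with _ | s
  · exact ⟨q ^ t + 1, by rw [abs_of_nonneg (by positivity)], by simp⟩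
  · refine ⟨q ^ (s + 1) - q ^ s, ?_, ⟨q ^ s, by ring⟩⟩
    have h1 : q ^ (s + 1) ≤ q ^ t := pow_le_pow_right₀ (by linarith) (by omega)
    have h2 : q ^ s ≤ q ^ (s + 1) := pow_le_pow_right₀ (by linarith) (by omega)
    have h3 : 0 < q ^ s := by positivity
    rw [abs_le]; constructor <;> linarith

lemma orbitBounded_pow_add_self {q : ℤ} (hq : 3 ≤ q) (t : ℕ) :
    OrbitBounded q (q ^ (t + 2) + 1) (q ^ (t + 1) + q) := by
  refine OrbitBounded.of_lt (by omega) fun j hj => ?_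
  rcases j with _ | s
  · exact ⟨q ^ (t + 1) + q, by rw [abs_of_nonneg (by positivity)], by simp⟩
  · have h3 : 0 < q ^ s := by positivity
    by_cases hs : s = t
    · subst hs
      refine ⟨- q ^ s - 1, ?_, ⟨q ^ s + 1, by ring⟩⟩
      have h2 : q ^ s ≤ q ^ (s + 1) := pow_le_pow_right₀ (by linarith) (by omega)
      rw [abs_le]; constructor <;> linarith
    · refine ⟨q ^ (s + 2) - q ^ s, ?_, ⟨q ^ s, by ring⟩⟩
      have h1 : q ^ (s + 2) ≤ q ^ (t + 1) := pow_le_pow_right₀ (by linarith) (by omega)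
      have h2 : q ^ s ≤ q ^ (s + 2) := pow_le_pow_right₀ (by linarith) (by omega)
      rw [abs_le]; constructor <;> linarith

lemma orbitBounded_sq {q : ℤ} (hq : 3 ≤ q) : OrbitBounded q (q ^ 3 + 1) (q ^ 2) := by
  refine OrbitBounded.of_lt (by omega) fun j hj => ?_
  interval_cases j
  · exact ⟨q ^ 2, by rw [abs_of_nonneg (by positivity)], by simp⟩
  · exact ⟨-1, by rw [abs_le]; constructor <;> nlinarith, ⟨1, by ring⟩⟩
  · exact ⟨-q, by rw [abs_le]; constructor <;> nlinarith, ⟨q, by ring⟩⟩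

lemma orbitBounded_sq_add {q : ℤ} (hq : 3 ≤ q) :
    OrbitBounded q (q ^ 3 + 1) (q ^ 2 + q + 1) := by
  refine OrbitBounded.of_lt (by omega) fun j hj => ?_
  interval_cases j
  · exact ⟨q ^ 2 + q + 1, by rw [abs_of_nonneg (by positivity)], by simp⟩
  · exact ⟨q ^ 2 + q - 1, by rw [abs_le]; constructor <;> nlinarith, ⟨1, by ring⟩⟩
  · exact ⟨q ^ 2 - q - 1, by rw [abs_le]; constructor <;> nlinarith, ⟨q + 1, by ring⟩⟩

lemma abs_le_of_succ_mul {q z e b : ℤ} (hq : 0 ≤ q) (he : (q + 1) * e = b)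
    (h1 : (q + 1) * z ≤ b) (h2 : -b ≤ (q + 1) * z) : |z| ≤ e := by
  rw [abs_le]
  constructor <;> nlinarith

lemma orbitBounded_of_add_one {q e : ℤ} {t : ℕ} (hq : 3 ≤ q) (ht : Even t)
    (he : (q + 1) * e = q ^ (t + 5) + 1 + (q - 1) * (q ^ (t + 3) + 1)) :
    OrbitBounded q (q ^ (t + 5) + 1) e := by
  have hq0 : 0 ≤ q := by linarith
  have hY0 : 0 < q ^ t := by positivity
  have key : ∀ s : ℕ, ∃ z : ℤ, q ^ (t + 5) + 1 ∣ q ^ (s + 2) * e - z ∧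
      (q + 1) * z = -(-1) ^ s * (q ^ (t + 5) + 1) + (q - 1) * (q ^ (s + 2) - q ^ s) := by
    intro s
    induction s with
    | zero =>
      refine ⟨q ^ 2 * e - q * (q ^ (t + 5) + 1), ⟨q, by ring⟩, ?_⟩
      linear_combination q ^ 2 * he
    | succ s ih =>
      obtain ⟨z, ⟨c, hc⟩, hz⟩ := ih
      refine ⟨q * z + (-1) ^ s * (q ^ (t + 5) + 1), ⟨q * c - (-1) ^ s, ?_⟩, ?_⟩
      · linear_combination q * hc
      · linear_combination q * hz
  refine OrbitBounded.of_lt (by omega) fun j hj => ?_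
  rcases j with _ | _ | s
  · refine ⟨e, abs_le_of_succ_mul hq0 he he.le ?_, by simp⟩
    rw [he]
    have : 0 ≤ (q - 1) * (q ^ (t + 3) + 1) := mul_nonneg (by linarith) (by positivity)
    have : 0 ≤ q ^ (t + 5) := by positivity
    linarith
  · refine ⟨q * e - (q ^ (t + 5) + 1), abs_le_of_succ_mul hq0 he ?_ ?_, ⟨1, by ring⟩⟩
    · have : (q + 1) * (q * e - (q ^ (t + 5) + 1)) = q * ((q + 1) * e) - (q + 1) * (q ^ (t + 5) + 1) := by ring
      rw [this, he]
      ring_nf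
      nlinarith [mul_pos hY0 (show 0 < q ^ 3 by positivity), mul_pos hY0 (show 0 < q ^ 4 by positivity), mul_pos hY0 (show 0 < q ^ 5 by positivity)]
    · have : (q + 1) * (q * e - (q ^ (t + 5) + 1)) = q * ((q + 1) * e) - (q + 1) * (q ^ (t + 5) + 1) := by ring
      rw [this, he]
      ring_nf
      nlinarith [mul_pos hY0 (show 0 < q ^ 3 by positivity), mul_pos hY0 (show 0 < q ^ 4 by positivity), mul_pos hY0 (show 0 < q ^ 5 by positivity)]
  · obtain ⟨z, hd, hz⟩ := key s
    refine ⟨z, abs_le_of_succ_mul hq0 he ?_ ?_, hd⟩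
    all_goals
      rw [hz]
      have hX0 : 0 < q ^ s := by positivity
      have hc0 : 0 ≤ (q - 1) * (q ^ 2 - 1) := mul_nonneg (by linarith) (by nlinarith)
      have hc1 : (q - 1) * (q ^ 2 - 1) ≤ q ^ 3 := by nlinarith
      have hc2 : (q - 1) * (q ^ 2 - 1) ≤ (q - 1) * q ^ 2 := by nlinarith
      have hcX : 0 ≤ (q - 1) * (q ^ 2 - 1) * q ^ s := mul_nonneg hc0 hX0.le
      have hb : 0 ≤ (q - 1) * (q ^ (t + 3) + 1) := mul_nonneg (by linarith) (by positivity)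
      have hN0 : 0 ≤ q ^ (t + 5) := by positivity
      have hfac : (q - 1) * (q ^ (s + 2) - q ^ s) = (q - 1) * (q ^ 2 - 1) * q ^ s := by ring
      rw [hfac]
      rcases Nat.even_or_odd s with hs | hs
      · have hX : q ^ s ≤ q ^ (t + 2) := pow_le_pow_right₀ (by linarith) (by omega)
        have hm := mul_le_mul hc1 hX hX0.le (by positivity)
        have hp : q ^ 3 * q ^ (t + 2) = q ^ (t + 5) := by ring
        rw [hs.neg_one_pow]
        linarith
      · have hX : q ^ s ≤ q ^ (t + 1) := by
          refine pow_le_pow_right₀ (by linarith) ?_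
          have : s ≠ t + 2 := by rintro rfl; exact Nat.not_even_iff_odd.mpr hs (by simp [ht, Nat.even_add])
          omega
        have hm := mul_le_mul hc2 hX hX0.le (mul_nonneg (by linarith) (by positivity))
        have hp : (q - 1) * q ^ 2 * q ^ (t + 1) = (q - 1) * q ^ (t + 3) := by ring
        have hp2 : (q - 1) * (q ^ (t + 3) + 1) = (q - 1) * q ^ (t + 3) + (q - 1) := by ring
        rw [hs.neg_one_pow]
        linarith

lemma orbitBounded_of_add_sq {q e : ℤ} {t : ℕ} (hq : 3 ≤ q) (ht : Even t)
    (he : (q + 1) * e = q ^ (t + 5) + 1 + (q - 1) * (q ^ (t + 3) + q ^ 2)) :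
    OrbitBounded q (q ^ (t + 5) + 1) e := by
  have hq0 : 0 ≤ q := by linarith
  have hY0 : 0 < q ^ t := by positivity
  have key : ∀ s : ℕ, ∃ z : ℤ, q ^ (t + 5) + 1 ∣ q ^ (s + 2) * e - z ∧
      (q + 1) * z = -(-1) ^ s * (q ^ (t + 5) + 1) + (q - 1) * (q ^ (s + 4) - q ^ s) := by
    intro s
    induction s with
    | zero =>
      refine ⟨q ^ 2 * e - q * (q ^ (t + 5) + 1), ⟨q, by ring⟩, ?_⟩
      linear_combination q ^ 2 * he
    | succ s ih =>
      obtain ⟨z, ⟨c, hc⟩, hz⟩ := ih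
      refine ⟨q * z + (-1) ^ s * (q ^ (t + 5) + 1), ⟨q * c - (-1) ^ s, ?_⟩, ?_⟩
      · linear_combination q * hc
      · linear_combination q * hz
  refine OrbitBounded.of_lt (by omega) fun j hj => ?_
  rcases j with _ | _ | s
  · refine ⟨e, abs_le_of_succ_mul hq0 he he.le ?_, by simp⟩
    rw [he]
    have : 0 ≤ (q - 1) * (q ^ (t + 3) + q ^ 2) := mul_nonneg (by linarith) (by positivity)
    have : 0 ≤ q ^ (t + 5) := by positivity
    linarith
  · refine ⟨q * e - (q ^ (t + 5) + 1), abs_le_of_succ_mul hq0 he ?_ ?_, ⟨1, by ring⟩⟩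
    · have : (q + 1) * (q * e - (q ^ (t + 5) + 1)) = q * ((q + 1) * e) - (q + 1) * (q ^ (t + 5) + 1) := by ring
      rw [this, he]
      ring_nf
      have e1 : 0 ≤ q ^ 4 * (q ^ t - 1) := mul_nonneg (by positivity) (by linarith)
      have e2 : 0 ≤ (q - 1) * (q ^ 3 * q ^ t) := mul_nonneg (by linarith) (by positivity)
      have e3 : 0 ≤ (q - 1) * q ^ 2 := mul_nonneg (by linarith) (by positivity)
      have e4 : 0 ≤ (q - 1) * q ^ 3 := mul_nonneg (by linarith) (by positivity)
      have e5 : 0 ≤ (q - 1) * (q ^ 4 * q ^ t) := mul_nonneg (by linarith) (by positivity)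
      have e6 : 0 ≤ q ^ 3 := by positivity
      have e7 : 0 ≤ q ^ 4 * q ^ t := by positivity
      linarith
    · have : (q + 1) * (q * e - (q ^ (t + 5) + 1)) = q * ((q + 1) * e) - (q + 1) * (q ^ (t + 5) + 1) := by ring
      rw [this, he]
      ring_nf
      have e1 : 0 ≤ q ^ 4 * (q ^ t - 1) := mul_nonneg (by positivity) (by linarith)
      have e2 : 0 ≤ (q - 1) * (q ^ 3 * q ^ t) := mul_nonneg (by linarith) (by positivity)
      have e3 : 0 ≤ (q - 1) * q ^ 2 := mul_nonneg (by linarith) (by positivity)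
      have e4 : 0 ≤ (q - 1) * q ^ 3 := mul_nonneg (by linarith) (by positivity)
      have e5 : 0 ≤ (q - 1) * (q ^ 4 * q ^ t) := mul_nonneg (by linarith) (by positivity)
      have e6 : 0 ≤ q ^ 3 := by positivity
      have e7 : 0 ≤ q ^ 4 * q ^ t := by positivity
      linarith
  · obtain ⟨z, hd, hz⟩ := key s
    have hX0 : 0 < q ^ s := by positivity
    have hc0 : 0 ≤ (q - 1) * (q ^ 4 - 1) := mul_nonneg (by linarith) (by nlinarith [sq_nonneg (q ^ 2 - 1)])
    have hc1 : (q - 1) * (q ^ 4 - 1) ≤ q ^ 5 := by nlinarith [pow_pos (show 0 < q by linarith) 4]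
    have hc2 : (q - 1) * (q ^ 4 - 1) ≤ (q - 1) * q ^ 4 := by nlinarith
    have hcX : 0 ≤ (q - 1) * (q ^ 4 - 1) * q ^ s := mul_nonneg hc0 hX0.le
    have hq2 : q ≤ q ^ 2 := by nlinarith
    have hb : 0 ≤ (q - 1) * (q ^ (t + 3) + q ^ 2) := mul_nonneg (by linarith) (by positivity)
    have hN0 : 0 ≤ q ^ (t + 5) := by positivity
    have hfac : (q - 1) * (q ^ (s + 4) - q ^ s) = (q - 1) * (q ^ 4 - 1) * q ^ s := by ring
    have hp2 : (q - 1) * (q ^ (t + 3) + q ^ 2) = (q - 1) * q ^ (t + 3) + (q - 1) * q ^ 2 := by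
      ring
    have hq1 : 0 ≤ (q - 1) * q ^ 2 := mul_nonneg (by linarith) (by positivity)
    obtain hst | rfl | rfl : s ≤ t ∨ s = t + 1 ∨ s = t + 2 := by omega
    · rw [hfac] at hz
      refine ⟨z, abs_le_of_succ_mul hq0 he ?_ ?_, hd⟩
      all_goals
        rw [hz]
        rcases Nat.even_or_odd s with hs | hs
        · have hX : q ^ s ≤ q ^ t := pow_le_pow_right₀ (by linarith) hst
          have hm := mul_le_mul hc1 hX hX0.le (by positivity)
          have hp : q ^ 5 * q ^ t = q ^ (t + 5) := by ring
          rw [hs.neg_one_pow]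
          linarith
        · have hX : q ^ (s + 1) ≤ q ^ t := by
            refine pow_le_pow_right₀ (by linarith) ?_
            have : s ≠ t := by rintro rfl; exact Nat.not_even_iff_odd.mpr hs ht
            omega
          have hm := mul_le_mul hc2 le_rfl hX0.le (mul_nonneg (by linarith) (by positivity))
          have hp : (q - 1) * q ^ 4 * q ^ s = (q - 1) * q ^ 3 * q ^ (s + 1) := by ring
          have hm2 := mul_le_mul_of_nonneg_left hX
            (show 0 ≤ (q - 1) * q ^ 3 from mul_nonneg (by linarith) (by positivity))
          have hp3 : (q - 1) * q ^ 3 * q ^ t = (q - 1) * q ^ (t + 3) := by ring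
          rw [hs.neg_one_pow]
          linarith
    · have hz' : (q + 1) * (z - (q ^ (t + 5) + 1))
          = -(q ^ (t + 5) + 1) - (q - 1) * (1 + q ^ (t + 1)) := by
        rw [(ht.add_one).neg_one_pow] at hz
        linear_combination hz
      have hpos : 0 ≤ (q - 1) * (1 + q ^ (t + 1)) := mul_nonneg (by linarith) (by positivity)
      have hle : (q - 1) * (1 + q ^ (t + 1)) ≤ (q - 1) * (q ^ (t + 3) + q ^ 2) := by
        refine mul_le_mul_of_nonneg_left ?_ (by linarith)
        have : q ^ (t + 1) ≤ q ^ (t + 3) := pow_le_pow_right₀ (by linarith) (by omega)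
        nlinarith
      refine ⟨z - (q ^ (t + 5) + 1), abs_le_of_succ_mul hq0 he ?_ ?_, ?_⟩
      · rw [hz']; linarith
      · rw [hz']; linarith
      · rw [← sub_add]; exact dvd_add hd dvd_rfl
    · have hz' : (q + 1) * (z - (q - 2) * (q ^ (t + 5) + 1))
          = (q ^ (t + 5) + 1) - (q - 1) * (q + q ^ (t + 2)) := by
        rw [(show Even (t + 2) from ht.add even_two).neg_one_pow] at hz
        linear_combination hz
      have hpos : 0 ≤ (q - 1) * (q + q ^ (t + 2)) := mul_nonneg (by linarith) (by positivity)
      have hle : (q - 1) * (q + q ^ (t + 2)) ≤ (q - 1) * (q ^ (t + 3) + q ^ 2) := by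
        refine mul_le_mul_of_nonneg_left ?_ (by linarith)
        have : q ^ (t + 2) ≤ q ^ (t + 3) := pow_le_pow_right₀ (by linarith) (by omega)
        nlinarith
      refine ⟨z - (q - 2) * (q ^ (t + 5) + 1), abs_le_of_succ_mul hq0 he ?_ ?_, ?_⟩
      · rw [hz']; linarith
      · rw [hz']; linarith
      · rw [← sub_add]; exact dvd_add hd (dvd_mul_left _ _)

lemma OrbitBounded.exists_isCosetLeader {q m n : ℕ} {e : ℤ}
    (h : OrbitBounded q ((q : ℤ) ^ m + 1) e) (hn : q ^ m + 1 = 2 * n) (hq : Odd q)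
    (he0 : 0 ≤ e) (hen : e < n) :
    ∃ a : ℕ, IsCosetLeader q (q ^ m + 1) a ∧ (a : ℤ) = n - e := by
  lift e to ℕ using he0
  refine ⟨n - e, OrbitBounded.isCosetLeader (by exact_mod_cast h) hn hq (by omega), ?_⟩
  have : e < n := by omega
  push_cast [this.le]
  rfl

lemma Odd.dvd_of_dvd_two_mul {R x : ℤ} (hR : Odd R) (h : R ∣ 2 * x) : R ∣ x := by
  have : IsCoprime R 2 := by
    obtain ⟨k, rfl⟩ := hR
    exact ⟨1, -k, by ring⟩
  exact this.dvd_of_dvd_mul_left h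

lemma exists_two_leaders_gt_of_odd {q m n i : ℕ} (hq : Odd q) (hq3 : 3 ≤ q)
    (hn : q ^ m + 1 = 2 * n) (hnodd : Odd n) (hi : IsCosetLeader q (q ^ m + 1) i)
    (hiodd : Odd i) (hin : i ≠ n) {j : ℕ} (hj0 : 0 < j) (hj : j < 2 * m)
    (hs : i * q ^ j ≡ i [MOD (q ^ m + 1)]) :
    ∃ a b : ℕ, Odd a ∧ IsCosetLeader q (q ^ m + 1) a ∧ Odd b ∧ IsCosetLeader q (q ^ m + 1) b ∧
      a ≠ b ∧ i < a ∧ i < b ∧ a ≠ n ∧ b ≠ n := by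
  obtain ⟨hle, hb⟩ := hi.orbitBounded hn hq hiodd.pos
  have hN : ((q : ℤ) ^ m + 1) = 2 * n := by exact_mod_cast hn
  have hqo : Odd (q : ℤ) := by exact_mod_cast hq
  have hq3' : (3 : ℤ) ≤ q := by exact_mod_cast hq3
  rcases exists_divisor_of_short hq hq3 hj0 hj hs with hd | ⟨k, r, R, hm, hr, hr3, hk, hR, hNR, hRge, hRi⟩
  · have := Nat.le_of_dvd (by have := hiodd.pos; omega) hd
    omega
  have hm3 : 3 ≤ m := by rw [hm]; nlinarith
  obtain ⟨t, rfl⟩ : ∃ t, m = t + 2 := ⟨m - 2, by omega⟩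
  have hRn : R ∣ (n : ℤ) := hR.dvd_of_dvd_two_mul ⟨_, by rw [← hN, hNR, mul_comm]⟩
  have hRe : R ∣ (n : ℤ) - i := dvd_sub hRn hRi
  have he0 : 0 < (n : ℤ) - i := by omega
  have heven : Even ((n : ℤ) - i) := by
    have h1 : Odd (n : ℤ) := by exact_mod_cast hnodd
    have h2 : Odd (i : ℤ) := by exact_mod_cast hiodd
    exact h1.sub_odd h2
  have hlow := hb.le_mul_of_even rfl hqo hq3' he0 heven
  have hq2 : (q : ℤ) ^ 2 - q + 1 ≤ R := by
    have : (q : ℤ) ≤ (q : ℤ) ^ k := by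
      have := Nat.le_self_pow hk.ne' q
      exact_mod_cast this
    nlinarith
  have hbig : (q : ℤ) ^ (t + 1) + q < n - i := by
    have hne : (q : ℤ) * (n - i) ≠ (q : ℤ) ^ (t + 2) + 1 := by
      intro h
      have h1 : (q : ℤ) ∣ 1 := ⟨n - i - (q : ℤ) ^ (t + 1), by linear_combination -h⟩
      have := Int.le_of_dvd one_pos h1
      omega
    obtain ⟨c, hc⟩ : R ∣ (q : ℤ) * (n - i) - ((q : ℤ) ^ (t + 2) + 1) :=
      dvd_sub (hRe.mul_left _) ⟨_, by rw [hNR, mul_comm]⟩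
    have hc2 : Even c := by
      have : Even (R * c) := by
        rw [← hc, hN]
        exact (heven.mul_left _).sub (even_two_mul _)
      exact (Int.even_mul.mp this).resolve_left (Int.not_even_iff_odd.mpr hR)
    have hR0 : 0 < R := by nlinarith
    have hc0 : 0 < c := by
      have : 0 < R * c := by rw [← hc]; omega
      exact pos_of_mul_pos_right this hR0.le
    have hc2' : 2 ≤ c := by obtain ⟨d, rfl⟩ := hc2; omega
    have h5 : 2 * R ≤ q * (n - i) - ((q : ℤ) ^ (t + 2) + 1) := by rw [hc]; nlinarith
    have h6 : (q : ℤ) * (q ^ (t + 1) + q) < q * (n - i) := by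
      have : (q : ℤ) * (q ^ (t + 1) + q) = q ^ (t + 2) + q ^ 2 := by ring
      rw [this]; nlinarith
    exact lt_of_mul_lt_mul_left h6 (by linarith)
  have hp0 : 0 < (q : ℤ) ^ (t + 1) := by positivity
  obtain ⟨a, ha, hae⟩ := (orbitBounded_pow_add_one hq3' (t + 1)).exists_isCosetLeader hn hq
    (by linarith) (by linarith)
  obtain ⟨b, hb, hbe⟩ := (orbitBounded_pow_add_self hq3' t).exists_isCosetLeader hn hq
    (by linarith) (by linarith)
  have hno : Odd (n : ℤ) := by exact_mod_cast hnodd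
  have hao : Odd (a : ℤ) := by rw [hae]; exact hno.sub_even (hqo.pow.add_odd odd_one)
  have hbo : Odd (b : ℤ) := by rw [hbe]; exact hno.sub_even (hqo.pow.add_odd hqo)
  exact ⟨a, b, by exact_mod_cast hao, ha, by exact_mod_cast hbo, hb, by omega, by omega,
    by omega, by omega, by omega⟩

set_option maxHeartbeats 1600000 in
lemma exists_two_leaders_gt_of_even {q m n i R₁ : ℕ} (hq : Odd q) (hq3 : 3 ≤ q)
    (hn : q ^ m + 1 = 2 * n) (hneven : Even n) (hmodd : Odd m)
    (hR₁ : (q + 1) * R₁ = q ^ m + 1) (hR₁odd : Odd R₁)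
    (hi : IsCosetLeader q (q ^ m + 1) i)
    (hiodd : Odd i) (hin : i + R₁ ≠ n) {j : ℕ} (hj0 : 0 < j) (hj : j < 2 * m)
    (hs : i * q ^ j ≡ i [MOD (q ^ m + 1)]) :
    ∃ a b : ℕ, Odd a ∧ IsCosetLeader q (q ^ m + 1) a ∧ Odd b ∧ IsCosetLeader q (q ^ m + 1) b ∧
      a ≠ b ∧ i < a ∧ i < b ∧ a + R₁ ≠ n ∧ b + R₁ ≠ n := by
  obtain ⟨hle, hb⟩ := hi.orbitBounded hn hq hiodd.pos
  have hipos := hiodd.pos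
  have hN : ((q : ℤ) ^ m + 1) = 2 * n := by exact_mod_cast hn
  have hR₁' : ((q : ℤ) + 1) * R₁ = (q : ℤ) ^ m + 1 := by exact_mod_cast hR₁
  have hqo : Odd (q : ℤ) := by exact_mod_cast hq
  have hq3' : (3 : ℤ) ≤ q := by exact_mod_cast hq3
  have hno : Even (n : ℤ) := by exact_mod_cast hneven
  have hio : Odd (i : ℤ) := by exact_mod_cast hiodd
  have hR₁o : Odd (R₁ : ℤ) := by exact_mod_cast hR₁odd
  rcases exists_divisor_of_short hq hq3 hj0 hj hs with hd | ⟨k, r, R, hm, hr, hr3, hk, hR, hNR, hRge, hRi⟩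
  · have := Nat.le_of_dvd (by omega) hd
    have : i = n := by omega
    rw [this] at hiodd
    exact absurd hneven (Nat.not_even_iff_odd.mpr hiodd)
  have hm3 : 3 ≤ m := by rw [hm]; nlinarith
  have hRn : R ∣ (n : ℤ) := hR.dvd_of_dvd_two_mul ⟨_, by rw [← hN, hNR, mul_comm]⟩
  have hRe : R ∣ (n : ℤ) - i := dvd_sub hRn hRi
  have heo : Odd ((n : ℤ) - i) := hno.sub_odd hio
  have he0 : 0 < (n : ℤ) - i := by
    have : (n : ℤ) - i ≠ 0 := by
      intro h; rw [h] at heo; exact absurd heo (by decide)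
    omega
  have hgt : (q : ℤ) ^ m + 1 < (q + 1) * (n - i) := by
    refine lt_of_le_of_ne (hb.le_succ_mul hq3' he0 (by rw [hN]; omega)) ?_
    rw [← hR₁']
    intro h
    have := mul_left_cancel₀ (by linarith) h
    omega
  have hexc := hb.lt_of_odd rfl hmodd hq3' he0 hgt
  have hkodd : Odd k := (Nat.odd_mul.mp (hm ▸ hmodd)).1
  have hone : k = 1 → (3 : ℤ) * R₁ ≤ n - i := by
    rintro rfl
    have hRR : R = R₁ := by
      rw [pow_one, ← hR₁'] at hNR
      exact (mul_left_cancel₀ (by linarith) hNR).symm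
    rw [hRR] at hRe
    obtain ⟨c, hc⟩ := hRe
    have hco : Odd c := by rw [hc] at heo; exact (Int.odd_mul.mp heo).2
    have hR0 : (0 : ℤ) < R₁ := by have := hR₁odd.pos; omega
    have hc0 : 0 < c := by
      rw [hc] at he0; exact pos_of_mul_pos_right he0 hR0.le
    have hc1 : c ≠ 1 := by rintro rfl; omega
    have : 3 ≤ c := by obtain ⟨d, rfl⟩ := hco; omega
    rw [hc]; nlinarith
  obtain ⟨A, B, hA, hB, hAo, hBo, hRA, hRB, hAB, hAe, hBe⟩ : ∃ A B : ℤ,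
      OrbitBounded q ((q : ℤ) ^ m + 1) A ∧ OrbitBounded q ((q : ℤ) ^ m + 1) B ∧
      Odd A ∧ Odd B ∧ R₁ < A ∧ R₁ < B ∧ A ≠ B ∧ A < n - i ∧ B < n - i := by
    by_cases hm5 : m = 3
    · rw [hm5] at hR₁' ⊢
      have hk1 : k = 1 := by rw [hm5] at hm; nlinarith
      have h3 := hone hk1
      have hRv : (R₁ : ℤ) = q ^ 2 - q + 1 :=
        mul_left_cancel₀ (show (q : ℤ) + 1 ≠ 0 by linarith) (by rw [hR₁']; ring)
      refine ⟨q ^ 2, q ^ 2 + q + 1, orbitBounded_sq hq3', orbitBounded_sq_add hq3', hqo.pow,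
        (hqo.pow.add_odd hqo).add_one, ?_, ?_, ?_, ?_, ?_⟩
      · linarith
      · linarith
      · intro h; linarith
      · nlinarith
      · nlinarith
    · obtain ⟨t, rfl⟩ : ∃ t, m = t + 5 := by
        refine ⟨m - 5, ?_⟩
        obtain ⟨d, hd⟩ := hmodd
        omega
      have hte : Even t := by
        by_contra h
        rw [Nat.not_even_iff_odd] at h
        exact absurd (h.add_odd (by decide : Odd 5)) (Nat.not_even_iff_odd.mpr hmodd)
      obtain ⟨d, hd⟩ := hte
      obtain ⟨S, hSo, hS, hS1, -⟩ := exists_odd_cofactor (q : ℤ) hqo hq3' (d + 1)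
      obtain ⟨T, hTo, hT, hT1, -⟩ := exists_odd_cofactor (q : ℤ) hqo hq3' d
      rw [show 2 * (d + 1) + 1 = t + 3 by omega] at hS
      rw [show 2 * d + 1 = t + 1 by omega] at hT
      have hAeq : ((q : ℤ) + 1) * (R₁ + (q - 1) * S)
          = (q : ℤ) ^ (t + 5) + 1 + (q - 1) * (q ^ (t + 3) + 1) := by
        linear_combination hR₁' - (q - 1 : ℤ) * hS
      have hBeq : ((q : ℤ) + 1) * (R₁ + (q - 1) * (q ^ 2 * T))
          = (q : ℤ) ^ (t + 5) + 1 + (q - 1) * (q ^ (t + 3) + q ^ 2) := by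
        linear_combination hR₁' - (q - 1 : ℤ) * q ^ 2 * hT
      have hpS : 0 < ((q : ℤ) - 1) * S := mul_pos (by linarith) (by linarith)
      have hpT : 0 < ((q : ℤ) - 1) * (q ^ 2 * T) :=
        mul_pos (by linarith) (mul_pos (by positivity) (by linarith))
      have hqe : Even ((q : ℤ) - 1) := hqo.sub_odd odd_one
      have hAB : (R₁ : ℤ) + (q - 1) * S < R₁ + (q - 1) * (q ^ 2 * T) := by
        refine lt_of_mul_lt_mul_left (a := (q : ℤ) + 1) ?_ (by linarith)
        rw [hAeq, hBeq]
        have h2 : (1 : ℤ) < q ^ 2 := by nlinarith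
        have := mul_lt_mul_of_pos_left (add_lt_add_right h2 ((q : ℤ) ^ (t + 3)))
          (show (0 : ℤ) < q - 1 by linarith)
        linarith
      have hBe : (R₁ : ℤ) + (q - 1) * (q ^ 2 * T) < n - i := by
        have hlt3 : (q : ℤ) ^ 3 * q ^ 2 ≤ q ^ (t + 5) := by
          rw [← pow_add]; exact pow_le_pow_right₀ (by linarith) (by omega)
        by_cases hk1 : k = 1
        · refine lt_of_lt_of_le ?_ (hone hk1)
          refine lt_of_mul_lt_mul_left (a := (q : ℤ) + 1) ?_ (by linarith)
          rw [hBeq, show ((q : ℤ) + 1) * (3 * R₁) = 3 * (((q : ℤ) + 1) * R₁) by ring, hR₁']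
          have e1 : (q : ℤ) * q ^ (t + 3) ≤ q ^ (t + 5) := by
            rw [← pow_succ']; exact pow_le_pow_right₀ (by linarith) (by omega)
          have e2 : (q : ℤ) * q ^ 2 ≤ q ^ (t + 5) := by
            rw [← pow_succ']; exact pow_le_pow_right₀ (by linarith) (by omega)
          have e3 : (0 : ℤ) < q ^ (t + 3) := by positivity
          nlinarith
        · have hk3 : 3 ≤ k := by obtain ⟨d, hd⟩ := hkodd; omega
          have hQ : (q : ℤ) ^ 3 ≤ q ^ k := pow_le_pow_right₀ (by linarith) hk3
          have hR6 : ((q : ℤ) ^ 3) ^ 2 - q ^ 3 + 1 ≤ R := by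
            have : 1 ≤ (q : ℤ) ^ 3 := one_le_pow₀ (by linarith)
            nlinarith
          have hdvd : R ∣ (q : ℤ) ^ 2 * ((q + 1) * (n - i) - ((q : ℤ) ^ (t + 5) + 1))
              - (q - 1) * ((q : ℤ) ^ (t + 5) + 1) := by
            have hRN : R ∣ (q : ℤ) ^ (t + 5) + 1 := ⟨_, by rw [hNR, mul_comm]⟩
            exact dvd_sub ((dvd_sub (hRe.mul_left _) hRN).mul_left _) (hRN.mul_left _)
          have hge := Int.le_of_dvd (by linarith) hdvd
          refine lt_of_mul_lt_mul_left (a := (q : ℤ) ^ 2 * ((q : ℤ) + 1)) ?_ (by positivity)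
          rw [mul_assoc, hBeq]
          have h4 : ((q : ℤ) - 1) * (q ^ 4 - 1) < (q ^ 3) ^ 2 - q ^ 3 + 1 := by
            have : (3 : ℤ) * q ^ 5 ≤ q * q ^ 5 := by
              exact mul_le_mul_of_nonneg_right hq3' (by positivity)
            have h9 : (q : ℤ) ^ 3 * 3 ^ 2 ≤ q ^ 3 * q ^ 2 := by gcongr
            have h8 : (q : ℤ) * 3 ^ 3 ≤ q * q ^ 3 := by gcongr
            have e : ((q : ℤ) - 1) * (q ^ 4 - 1) = q * q ^ 4 - q ^ 4 - q + 1 := by ring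
            have e2 : ((q : ℤ) ^ 3) ^ 2 = q * q ^ 5 := by ring
            have e3 : (q : ℤ) * q ^ 4 = q ^ 5 := by ring
            have e4 : (q : ℤ) ^ 3 * q ^ 2 = q ^ 5 := by ring
            rw [e, e2, e3]
            have : (0 : ℤ) < q ^ 4 := by positivity
            have : (0 : ℤ) < q ^ 3 := by positivity
            linarith
          have e5 : (q : ℤ) ^ 2 * ((q : ℤ) ^ (t + 5) + 1 + (q - 1) * (q ^ (t + 3) + q ^ 2))
              = (q : ℤ) ^ 2 * ((q : ℤ) ^ (t + 5) + 1) + (q - 1) * ((q : ℤ) ^ (t + 5) + 1)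
                + (q - 1) * (q ^ 4 - 1) := by ring
          have e6 : (q : ℤ) ^ 2 * (q + 1) * (n - i) = q ^ 2 * ((q + 1) * (n - i)) := by ring
          rw [e5, e6]
          rw [mul_sub] at hge
          linarith
      refine ⟨_, _, orbitBounded_of_add_one hq3' ⟨d, hd⟩ hAeq,
        orbitBounded_of_add_sq hq3' ⟨d, hd⟩ hBeq, hR₁o.add_even (hqe.mul_right _),
        hR₁o.add_even (hqe.mul_right _), by linarith, by linarith, hAB.ne, by linarith, hBe⟩
  obtain ⟨a, ha, hae⟩ := hA.exists_isCosetLeader hn hq (by linarith) (by linarith)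
  obtain ⟨b, hb, hbe⟩ := hB.exists_isCosetLeader hn hq (by linarith) (by linarith)
  have hao : Odd (a : ℤ) := by rw [hae]; exact hno.sub_odd hAo
  have hbo : Odd (b : ℤ) := by rw [hbe]; exact hno.sub_odd hBo
  exact ⟨a, b, by exact_mod_cast hao, ha, by exact_mod_cast hbo, hb, by omega, by omega,
    by omega, by omega, by omega⟩

/-- The `q`-cyclotomic coset of `i` modulo `q ^ m + 1`. -/
def cyclotomicCoset (q m i : ℕ) : Finset ℕ :=
  (Finset.range (2 * m)).image fun j => i * q ^ j % (q ^ m + 1)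

lemma pow_two_mul_modEq_one (q m : ℕ) : q ^ (2 * m) ≡ 1 [MOD (q ^ m + 1)] := by
  rw [← ZMod.natCast_eq_natCast_iff]
  have h : ((q ^ m + 1 : ℕ) : ZMod (q ^ m + 1)) = 0 := ZMod.natCast_self _
  push_cast at h ⊢
  rw [two_mul, pow_add, eq_neg_of_add_eq_zero_left h]
  ring

lemma mul_pow_mod_modEq (q m i j : ℕ) : i * q ^ j ≡ i * q ^ (j % (2 * m)) [MOD (q ^ m + 1)] := by
  refine Nat.ModEq.mul_left i ?_
  have h := ((pow_two_mul_modEq_one q m).pow (j / (2 * m))).mul_right (q ^ (j % (2 * m)))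
  rwa [← pow_mul, ← pow_add, Nat.div_add_mod, one_pow, one_mul] at h

lemma mem_cyclotomicCoset {q m i s : ℕ} (hm : 0 < m) :
    s ∈ cyclotomicCoset q m i ↔ s < q ^ m + 1 ∧ ∃ j, s ≡ i * q ^ j [MOD (q ^ m + 1)] := by
  simp only [cyclotomicCoset, Finset.mem_image, Finset.mem_range]
  constructor
  · rintro ⟨j, -, rfl⟩
    exact ⟨Nat.mod_lt _ (by omega), j, Nat.mod_modEq _ _⟩
  · rintro ⟨hs, j, hj⟩
    refine ⟨j % (2 * m), Nat.mod_lt _ (by omega), ?_⟩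
    have := hj.trans (mul_pow_mod_modEq q m i j)
    rw [← Nat.mod_eq_of_lt hs]
    exact this.symm

lemma coprime_pow_add_one {q m : ℕ} (hm : 0 < m) : Nat.Coprime q (q ^ m + 1) := by
  obtain ⟨k, rfl⟩ : ∃ k, m = k + 1 := ⟨m - 1, by omega⟩
  rw [pow_succ]
  simp

lemma card_cyclotomicCoset {q m i : ℕ} (hm : 0 < m)
    (h : ∀ j, 0 < j → j < 2 * m → ¬ i * q ^ j ≡ i [MOD (q ^ m + 1)]) :
    (cyclotomicCoset q m i).card = 2 * m := by
  rw [cyclotomicCoset, Finset.card_image_of_injOn, Finset.card_range]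
  have key : ∀ a b, a < b → b < 2 * m → i * q ^ a % (q ^ m + 1) ≠ i * q ^ b % (q ^ m + 1) := by
    intro a b hab hb he
    refine h (b - a) (by omega) (by omega) ?_
    have h1 : i * q ^ (b - a) * q ^ a ≡ i * q ^ a [MOD (q ^ m + 1)] := by
      rw [mul_assoc, ← pow_add, Nat.sub_add_cancel hab.le]
      exact he.symm
    exact h1.cancel_right_of_coprime
      (by rw [Nat.gcd_comm]; exact (coprime_pow_add_one hm).pow_left a)
  intro a ha b hb he
  simp only [Finset.coe_range, Set.mem_Iio] at ha hb
  rcases lt_trichotomy a b with hab | hab | hab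
  · exact absurd he (key a b hab hb)
  · exact hab
  · exact absurd he.symm (key b a hab ha)

lemma modEq_mul_pow_symm {q m i s j : ℕ} (hm : 0 < m) (h : s ≡ i * q ^ j [MOD (q ^ m + 1)]) :
    ∃ j', i ≡ s * q ^ j' [MOD (q ^ m + 1)] := by
  refine ⟨(2 * m - 1) * j, ?_⟩
  have h1 := h.mul_right (q ^ ((2 * m - 1) * j))
  rw [mul_assoc, ← pow_add] at h1
  have h2 : j + (2 * m - 1) * j = (2 * m) * j := by
    obtain ⟨k, rfl⟩ : ∃ k, m = k + 1 := ⟨m - 1, by omega⟩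
    rw [show 2 * (k + 1) - 1 = 2 * k + 1 by omega]; ring
  rw [h2] at h1
  have h3 := mul_pow_mod_modEq q m i (2 * m * j)
  rw [Nat.mul_mod_right, pow_zero, mul_one] at h3
  exact (h1.trans h3).symm

lemma IsCosetLeader.le_of_modEq {q N i s j : ℕ} (h : IsCosetLeader q N i)
    (hs : s ≡ i * q ^ j [MOD N]) : i ≤ s :=
  (h.2 j).trans (by rw [← hs]; exact Nat.mod_le _ _)

lemma disjoint_cyclotomicCoset {q m a b : ℕ} (hm : 0 < m) (ha : IsCosetLeader q (q ^ m + 1) a)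
    (hb : IsCosetLeader q (q ^ m + 1) b) (hab : a ≠ b) :
    Disjoint (cyclotomicCoset q m a) (cyclotomicCoset q m b) := by
  rw [Finset.disjoint_left]
  intro s hsa hsb
  obtain ⟨-, j, hj⟩ := (mem_cyclotomicCoset hm).mp hsa
  obtain ⟨-, k, hk⟩ := (mem_cyclotomicCoset hm).mp hsb
  obtain ⟨j', hj'⟩ := modEq_mul_pow_symm hm hj
  obtain ⟨k', hk'⟩ := modEq_mul_pow_symm hm hk
  have h1 := hj'.trans (hk.mul_right (q ^ j'))
  have h2 := hk'.trans (hj.mul_right (q ^ k'))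
  rw [mul_assoc, ← pow_add] at h1 h2
  exact hab (le_antisymm (ha.le_of_modEq h2) (hb.le_of_modEq h1))

lemma odd_of_modEq_mul_pow {q m s i j : ℕ} (hq : Odd q) (hi : Odd i)
    (h : s ≡ i * q ^ j [MOD (q ^ m + 1)]) : Odd s := by
  have h2 : 2 ∣ q ^ m + 1 := (hq.pow.add_odd odd_one).two_dvd
  have h3 := h.of_dvd h2
  rw [Nat.odd_iff] at *
  rw [h3]
  exact Nat.odd_iff.mp ((Nat.odd_iff.mpr hi).mul (Nat.odd_iff.mpr hq).pow)

lemma exists_isCosetLeader {q m s : ℕ} (hq : Odd q) (hm : 0 < m) (hs : Odd s) :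
    ∃ i j, Odd i ∧ IsCosetLeader q (q ^ m + 1) i ∧ s ≡ i * q ^ j [MOD (q ^ m + 1)] := by
  classical
  have hex : ∃ t, t < q ^ m + 1 ∧ ∃ j, t ≡ s * q ^ j [MOD (q ^ m + 1)] :=
    ⟨s % (q ^ m + 1), Nat.mod_lt _ (by omega), 0, by simpa using Nat.mod_modEq _ _⟩
  obtain ⟨hlt, j, hj⟩ := Nat.find_spec hex
  obtain ⟨j', hj'⟩ := modEq_mul_pow_symm hm hj
  refine ⟨Nat.find hex, j', odd_of_modEq_mul_pow hq hs hj, ⟨hlt, fun k => ?_⟩, hj'⟩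
  refine Nat.find_min' hex ⟨Nat.mod_lt _ (by omega), j + k, ?_⟩
  have := hj.mul_right (q ^ k)
  rw [mul_assoc, ← pow_add] at this
  exact (Nat.mod_modEq _ _).trans this

/-- The odd numbers below `q ^ m + 1` outside the cosets of `1, 3, ..., 2 * k - 1` are those in the
cosets of the remaining odd coset leaders. -/
lemma sub_card_eq_sum_card_cyclotomicCoset {q m n k : ℕ} (hq : Odd q) (hm : 0 < m) (hn : q ^ m + 1 = 2 * n)
    {D : Finset ℕ} (hD : ∀ l ∈ D, Odd l ∧ IsCosetLeader q (q ^ m + 1) l ∧ 2 * k ≤ l)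
    (hD' : ∀ l, Odd l → IsCosetLeader q (q ^ m + 1) l → l ∉ D → l < 2 * k)
    {S : Finset ℕ} (hS : ∀ s, s ∈ S ↔ s < q ^ m + 1 ∧
      ∃ i < k, ∃ j, s ≡ (1 + 2 * i) * q ^ j [MOD (q ^ m + 1)]) :
    n - S.card = ∑ l ∈ D, (cyclotomicCoset q m l).card := by
  have hunion : S ∪ D.biUnion (cyclotomicCoset q m) = {s ∈ Finset.range (2 * n) | Odd s} := by
    ext s
    simp only [Finset.mem_union, hS, Finset.mem_biUnion, mem_cyclotomicCoset hm,
      Finset.mem_filter, Finset.mem_range, ← hn]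
    constructor
    · rintro (⟨hs, i, -, j, hj⟩ | ⟨l, hl, hs, j, hj⟩)
      · exact ⟨hs, odd_of_modEq_mul_pow hq ⟨i, by ring⟩ hj⟩
      · exact ⟨hs, odd_of_modEq_mul_pow hq (hD l hl).1 hj⟩
    · rintro ⟨hs, hso⟩
      obtain ⟨l, j, hlo, hl, hj⟩ := exists_isCosetLeader (m := m) hq hm hso
      by_cases hlD : l ∈ D
      · exact Or.inr ⟨l, hlD, hs, j, hj⟩
      · have := hD' l hlo hl hlD
        obtain ⟨i, rfl⟩ := hlo
        exact Or.inl ⟨hs, i, by omega, j, by rwa [add_comm 1]⟩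
  have hdisj : Disjoint S (D.biUnion (cyclotomicCoset q m)) := by
    rw [Finset.disjoint_left]
    intro s hsS hsD
    obtain ⟨hs, i, hi, j, hj⟩ := (hS s).mp hsS
    simp only [Finset.mem_biUnion, mem_cyclotomicCoset hm] at hsD
    obtain ⟨l, hl, -, j', hj'⟩ := hsD
    obtain ⟨a, ha⟩ := modEq_mul_pow_symm hm hj
    have h1 := ha.trans (hj'.mul_right (q ^ a))
    rw [mul_assoc, ← pow_add] at h1
    have := (hD l hl).2.1.le_of_modEq h1
    have := (hD l hl).2.2
    omega
  have hodd : ({s ∈ Finset.range (2 * n) | Odd s} : Finset ℕ).card = n := by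
    have : ({s ∈ Finset.range (2 * n) | Odd s} : Finset ℕ)
        = (Finset.range n).image fun i => 2 * i + 1 := by
      ext s
      simp only [Finset.mem_filter, Finset.mem_range, Finset.mem_image]
      constructor
      · rintro ⟨h, i, rfl⟩; exact ⟨i, by omega, rfl⟩
      · rintro ⟨i, h, rfl⟩; exact ⟨by omega, i, rfl⟩
    rw [this, Finset.card_image_of_injective _ (fun a b h => by simpa using h), Finset.card_range]
  have h1 := Finset.card_union_of_disjoint hdisj
  rw [hunion, hodd, Finset.card_biUnion] at h1
  · omega
  · intro a ha b hb hab
    exact disjoint_cyclotomicCoset hm (hD a ha).2.1 (hD b hb).2.1 hab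

lemma isConjRoot_iff_exists_pow_card {F E : Type*} [Field F] [Fintype F] [Field E] [Finite E]
    [Algebra F E] {x y : E} :
    IsConjRoot F x y ↔ ∃ j : ℕ, y = x ^ Fintype.card F ^ j := by
  have key (j : ℕ) (z : E) : (FiniteField.frobeniusAlgEquivOfAlgebraic F E ^ j) z
      = z ^ Fintype.card F ^ j := by
    rw [AlgEquiv.coe_pow, FiniteField.coe_frobeniusAlgEquivOfAlgebraic_iterate]
  rw [show IsConjRoot F x y ↔ IsConjRoot F y x from ⟨.symm, .symm⟩,
    isConjRoot_iff_exists_algEquiv]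
  constructor
  · rintro ⟨σ, rfl⟩
    obtain ⟨j, rfl⟩ := (FiniteField.bijective_frobeniusAlgEquivOfAlgebraic_pow F E).2 σ
    exact ⟨j, key j x⟩
  · rintro ⟨j, rfl⟩
    exact ⟨_, key j x⟩

lemma aeval_pow_eq_zero_iff {F E : Type*} [Field F] [Fintype F] [Field E] [Finite E]
    [Algebra F E] {β : E} {N : ℕ} (hN : N ≠ 0) (hβ : IsPrimitiveRoot β N) {ι : Type*}
    {I : Finset ι} {u : ι → ℕ} {g : F[X]} (hg : ∀ p, g ∣ p ↔ ∀ i ∈ I, minpoly F (β ^ u i) ∣ p) (s : ℕ) :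
    aeval (β ^ s) g = 0 ↔ ∃ i ∈ I, ∃ j, s ≡ u i * Fintype.card F ^ j [MOD N] := by
  have key (i : ι) : aeval (β ^ s) (minpoly F (β ^ u i)) = 0 ↔
      ∃ j, s ≡ u i * Fintype.card F ^ j [MOD N] := by
    have h1 : aeval (β ^ s) (minpoly F (β ^ u i)) = 0 ↔ IsConjRoot F (β ^ u i) (β ^ s) := by
      rw [isConjRoot_iff_aeval_eq_zero (Algebra.IsIntegral.isIntegral _)]
    rw [h1, isConjRoot_iff_exists_pow_card]
    refine exists_congr fun j => ?_
    rw [← pow_mul, (hβ.isOfFinOrder hN).pow_eq_pow_iff_modEq, ← hβ.eq_orderOf]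
  simp_rw [← key]
  constructor
  · intro h
    have hd : g ∣ ∏ i ∈ I, minpoly F (β ^ u i) := (hg _).mpr fun i hi => Finset.dvd_prod_of_mem _ hi
    obtain ⟨r, hr⟩ := hd
    have h2 : aeval (β ^ s) (∏ i ∈ I, minpoly F (β ^ u i)) = 0 := by
      rw [hr, map_mul, h, zero_mul]
    rw [map_prod, Finset.prod_eq_zero_iff] at h2
    exact h2
  · rintro ⟨i, hi, h⟩
    obtain ⟨r, hr⟩ := (hg g).mp dvd_rfl i hi
    rw [hr, map_mul, h, zero_mul]

lemma natDegree_eq_card_exponents {F E : Type*} [Field F] [Field E]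
    [Algebra F E] {β : E} {N : ℕ} (hβ : IsPrimitiveRoot β N) (hN : (N : F) ≠ 0)
    {g : F[X]} (hg : g ∣ X ^ N - 1) {S : Finset ℕ}
    (hS : ∀ s, s ∈ S ↔ s < N ∧ aeval (β ^ s) g = 0) : g.natDegree = S.card := by
  classical
  have hN0 : 0 < N := by
    rcases Nat.eq_zero_or_pos N with rfl | h
    · simp at hN
    · exact h
  have hp : (X ^ N - 1 : F[X]) ≠ 0 := by
    simpa using X_pow_sub_C_ne_zero hN0 (1 : F)
  have hsep : g.Separable := ((X_pow_sub_one_separable_iff (F := F)).mpr hN).of_dvd hg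
  have hsplit : (g.map (algebraMap F E)).Splits := by
    refine (X_pow_sub_one_splits hβ).of_dvd (by simpa using X_pow_sub_C_ne_zero hN0 (1 : E)) ?_
    simpa using Polynomial.map_dvd (algebraMap F E) hg
  have hg0 : g ≠ 0 := ne_zero_of_dvd_ne_zero hp hg
  rw [← card_rootSet_eq_natDegree hsep hsplit, ← Set.toFinset_card]
  have himg : (g.rootSet E).toFinset = S.image fun s => β ^ s := by
    ext x
    rw [Set.mem_toFinset, mem_rootSet_of_ne hg0, Finset.mem_image]
    constructor
    · intro hx
      obtain ⟨r, hr⟩ := hg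
      have h1 : aeval x (X ^ N - 1 : F[X]) = 0 := by rw [hr, map_mul, hx, zero_mul]
      have h2 : x ^ N = 1 := by simpa [sub_eq_zero] using h1
      have : NeZero N := ⟨hN0.ne'⟩
      obtain ⟨s, hs, rfl⟩ := hβ.eq_pow_of_pow_eq_one h2
      exact ⟨s, (hS s).mpr ⟨hs, hx⟩, rfl⟩
    · rintro ⟨s, hs, rfl⟩
      exact ((hS s).mp hs).2
  rw [himg, Finset.card_image_of_injOn]
  intro a ha b hb hab
  exact hβ.pow_inj ((hS a).mp ha).1 ((hS b).mp hb).1 hab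

/-- The BCH bound. -/
lemma lt_card_support_of_aeval_eq_zero {F E : Type*} [Field F] [Field E] [Algebra F E] {α γ : E}
    {n d : ℕ} (hα : α ≠ 0) (hγ : IsPrimitiveRoot γ n) {c : F[X]} (hc : c ≠ 0)
    (hdeg : c.natDegree < n) (h : ∀ i < d, aeval (α * γ ^ i) c = 0) : d < c.support.card := by
  by_contra! hle
  let e := c.support.equivFin
  have hlt (k : ℕ) (hk : k ∈ c.support) : k < n := (le_natDegree_of_mem_supp k hk).trans_lt hdeg
  let f : Fin c.support.card → E := fun i => γ ^ ((e.symm i : ℕ))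
  let v : Fin c.support.card → E := fun i =>
    algebraMap F E (c.coeff (e.symm i : ℕ)) * α ^ ((e.symm i : ℕ))
  have hf : Function.Injective f := by
    intro a b hab
    have := hγ.pow_inj (hlt _ (e.symm a).2) (hlt _ (e.symm b).2) hab
    exact e.symm.injective (Subtype.ext this)
  have hv : v = 0 := by
    refine Matrix.eq_zero_of_forall_pow_sum_mul_pow_eq_zero hf fun i => ?_
    have h1 := h i (by omega)
    rw [aeval_eq_sum_range, ← Finset.sum_subset (s₁ := c.support)] at h1
    · rw [← Finset.sum_coe_sort, ← e.symm.sum_comp] at h1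
      rw [← h1]
      refine Finset.sum_congr rfl fun j _ => ?_
      simp only [v, f, Algebra.smul_def]
      rw [mul_pow, ← pow_mul, ← pow_mul, mul_comm (i : ℕ), mul_assoc]
    · intro k hk
      rw [Finset.mem_range]
      exact Nat.lt_succ_of_le (le_natDegree_of_mem_supp k hk)
    · intro k _ hk
      rw [notMem_support_iff.mp hk, zero_smul]
  obtain ⟨k, hk⟩ := support_nonempty.mpr hc
  have h2 := congrFun hv (e ⟨k, hk⟩)
  simp only [v, Equiv.symm_apply_apply, Pi.zero_apply, mul_eq_zero, map_eq_zero] at h2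
  rcases h2 with h2 | h2
  · exact mem_support_iff.mp hk h2
  · exact pow_ne_zero _ hα h2

lemma minDistLB_of_aeval_eq_zero {F E : Type*} [Field F] [Field E] [Algebra F E] {β : E}
    {n d : ℕ} (hn : 0 < n) (hβ : IsPrimitiveRoot β (2 * n)) {g : F[X]} (hd : Odd d)
    (hdn : d ≤ n)
    (h : ∀ s, Odd s → s < d → aeval (β ^ s) g = 0 ∧ aeval (β ^ (2 * n - s)) g = 0) :
    MinDistLB g n d := by
  intro c hc ⟨r, hr⟩ hdeg
  have hγ : IsPrimitiveRoot (β ^ 2) n := hβ.pow (by omega) rfl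
  obtain ⟨t, rfl⟩ := hd
  have h0 : β ≠ 0 := hβ.ne_zero (by omega)
  have key := lt_card_support_of_aeval_eq_zero (α := β ^ (2 * n + 1 - 2 * t)) (d := 2 * t)
    (pow_ne_zero _ h0) hγ hc hdeg fun i hi => ?_
  · omega
  rw [← pow_mul, ← pow_add, hr, map_mul]
  refine mul_eq_zero_of_left ?_ _
  by_cases hit : i < t
  · have := (h (2 * t - 1 - 2 * i) ⟨t - 1 - i, by omega⟩ (by omega)).2
    rwa [show 2 * n - (2 * t - 1 - 2 * i) = 2 * n + 1 - 2 * t + 2 * i by omega] at this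
  · have := (h (2 * i + 1 - 2 * t) ⟨i - t, by omega⟩ (by omega)).1
    rw [show 2 * n + 1 - 2 * t + 2 * i = 2 * n + (2 * i + 1 - 2 * t) by omega, pow_add,
      hβ.pow_eq_one, one_mul]
    exact this

/-- The dimension of a negacyclic BCH code whose generator has as roots all the odd powers of `β`
except those in the cosets led by the elements of `D`, and a lower bound for its distance. -/
lemma dimension_and_minDistLB {F E : Type*} [Field F] [Fintype F] [Field E] [Finite E]
    [Algebra F E] {m n k d : ℕ} (hq : Odd (Fintype.card F)) (hm : 0 < m)
    (hn : Fintype.card F ^ m + 1 = 2 * n) {β : E} (hβ : IsPrimitiveRoot β (2 * n))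
    {g : F[X]} (hg : ∀ p, g ∣ p ↔ ∀ i ∈ Finset.range k, minpoly F (β ^ (1 + 2 * i)) ∣ p)
    {D : Finset ℕ}
    (hD : ∀ l ∈ D, Odd l ∧ IsCosetLeader (Fintype.card F) (Fintype.card F ^ m + 1) l ∧
      2 * k ≤ l ∧ d ≤ l)
    (hD' : ∀ l, Odd l → IsCosetLeader (Fintype.card F) (Fintype.card F ^ m + 1) l → l ∉ D →
      l < 2 * k) (hd : Odd d) (hdn : d ≤ n) :
    n - g.natDegree = ∑ l ∈ D, (cyclotomicCoset (Fintype.card F) m l).card ∧ MinDistLB g n d := by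
  classical
  set q := Fintype.card F with hqdef
  have hn0 : 0 < n := hd.pos.trans_le hdn
  have hroot := aeval_pow_eq_zero_iff (by omega) hβ hg
  have hdvd : g ∣ X ^ (2 * n) - 1 := by
    refine (hg _).mpr fun i _ => minpoly.dvd _ _ ?_
    rw [map_sub, map_pow, aeval_X, map_one, pow_right_comm, hβ.pow_eq_one, one_pow, sub_self]
  have hN0 : ((2 * n : ℕ) : F) ≠ 0 := by
    rw [← hn]
    push_cast
    rw [hqdef, FiniteField.cast_card_eq_zero, zero_pow hm.ne', zero_add]
    exact one_ne_zero
  constructor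
  · rw [natDegree_eq_card_exponents hβ hN0 hdvd
      (S := {s ∈ Finset.range (2 * n) | aeval (β ^ s) g = 0}) (by simp)]
    refine sub_card_eq_sum_card_cyclotomicCoset hq hm hn (k := k) (fun l hl => ?_) hD' fun s => ?_
    · obtain ⟨h1, h2, h3, -⟩ := hD l hl
      exact ⟨h1, h2, h3⟩
    · rw [Finset.mem_filter, hroot, hn]
      simp [hqdef]
  · refine minDistLB_of_aeval_eq_zero hn0 hβ hd hdn fun s hso hsd => ?_
    obtain ⟨l, j, hlo, hl, hj⟩ := exists_isCosetLeader (m := m) hq hm hso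
    have hls := hl.le_of_modEq hj
    have hlD : l ∉ D := fun hlD => by have := (hD l hlD).2.2.2; omega
    have hlk := hD' l hlo hl hlD
    obtain ⟨i, hi⟩ := hlo
    have hli : l = 1 + 2 * i := by omega
    rw [hn, hli] at hj
    refine ⟨(hroot s).mpr ⟨i, Finset.mem_range.mpr (by omega), j, hj⟩,
      (hroot _).mpr ⟨i, Finset.mem_range.mpr (by omega), j + m, ?_⟩⟩
    refine Nat.ModEq.add_right_cancel' s ?_
    rw [Nat.sub_add_cancel (by omega)]
    refine Nat.ModEq.trans ?_ (hj.symm.add_left _)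
    rw [← hqdef, pow_add, show (1 + 2 * i) * (q ^ j * q ^ m) + (1 + 2 * i) * q ^ j
      = (q ^ m + 1) * ((1 + 2 * i) * q ^ j) by ring, hn]
    exact ((Nat.modEq_zero_iff_dvd.mpr dvd_rfl).trans
      (Nat.modEq_zero_iff_dvd.mpr (dvd_mul_right _ _)).symm)

lemma card_cyclotomicCoset_half {q m n : ℕ} (hq : Odd q) (hm : 0 < m)
    (hn : q ^ m + 1 = 2 * n) :
    IsCosetLeader q (q ^ m + 1) n ∧ (cyclotomicCoset q m n).card = 1 := by
  have hn0 : 0 < n := by omega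
  have key (j : ℕ) : n * q ^ j % (q ^ m + 1) = n := by
    obtain ⟨t, ht⟩ := hq.pow (n := j)
    rw [ht, hn, show n * (2 * t + 1) = n + 2 * n * t by ring, Nat.add_mul_mod_self_left]
    exact Nat.mod_eq_of_lt (by omega)
  refine ⟨⟨by omega, fun j => (key j).ge⟩, ?_⟩
  simp only [cyclotomicCoset, key]
  rw [Finset.image_const ⟨0, by simpa using hm⟩, Finset.card_singleton]

lemma card_cyclotomicCoset_of_succ_mul {q m n l R : ℕ} (hq : Odd q) (hq3 : 3 ≤ q) (hm : 0 < m)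
    (hn : q ^ m + 1 = 2 * n) (hR : (q + 1) * R = q ^ m + 1) (hl : l + R = n) :
    IsCosetLeader q (q ^ m + 1) l ∧ (cyclotomicCoset q m l).card = 2 := by
  obtain ⟨t, rfl⟩ := hq
  obtain ⟨s, rfl⟩ : ∃ s, t = s + 1 := ⟨t - 1, by omega⟩
  set q := 2 * (s + 1) + 1 with hqdef
  have hR0 : 0 < R := by
    rcases Nat.eq_zero_or_pos R with rfl | h
    · simp at hR
    · exact h
  have hN : q ^ m + 1 = 2 * (R * (s + 2)) := by rw [← hR, hqdef]; ring
  have hn' : n = R * (s + 2) := by omega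
  have hl' : l = R * (s + 1) := by
    have : R * (s + 2) = R * (s + 1) + R := by ring
    omega
  have hlt : n + R < q ^ m + 1 := by
    have : 0 < R * (s + 1) := by positivity
    omega
  have hlt' : l < q ^ m + 1 := by omega
  have h1 : l * q % (q ^ m + 1) = n + R := by
    rw [← Nat.mod_eq_of_lt hlt, show l * q = n + R + (q ^ m + 1) * s by
      rw [hN, hl', hn', hqdef]; ring, Nat.add_mul_mod_self_left]
  have h2 : (n + R) * q % (q ^ m + 1) = l := by
    rw [← Nat.mod_eq_of_lt hlt', show (n + R) * q = l + (q ^ m + 1) * (s + 2) by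
      rw [hN, hl', hn', hqdef]; ring, Nat.add_mul_mod_self_left]
  have key (j : ℕ) : l * q ^ j % (q ^ m + 1) = l ∨ l * q ^ j % (q ^ m + 1) = n + R := by
    induction j with
    | zero => left; simpa using Nat.mod_eq_of_lt hlt'
    | succ j ih =>
      rw [pow_succ, ← mul_assoc, Nat.mul_mod, Nat.mul_mod_mod]
      rcases ih with h | h <;> rw [h]
      · exact Or.inr h1
      · exact Or.inl h2
  refine ⟨⟨hlt', fun j => by rcases key j with h | h <;> omega⟩, ?_⟩
  have : cyclotomicCoset q m l = {l, n + R} := by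
    ext x
    simp only [cyclotomicCoset, Finset.mem_image, Finset.mem_range, Finset.mem_insert,
      Finset.mem_singleton]
    constructor
    · rintro ⟨j, -, rfl⟩; exact key j
    · rintro (rfl | rfl)
      · exact ⟨0, by omega, by simpa using Nat.mod_eq_of_lt hlt'⟩
      · exact ⟨1, by omega, by simpa using h1⟩
  rw [this, Finset.card_pair (by omega)]

/-- The size of the coset of the largest odd coset leader, and the fact that any other odd coset
leader with a short coset lies below two further odd coset leaders. -/
lemma largest_leader_spec {q m n δ κ : ℕ} (hq : Odd q) (hq3 : 3 ≤ q) (hm : 0 < m)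
    (hn : q ^ m + 1 = 2 * n) (hδo : Odd δ) (hδ : IsCosetLeader q (q ^ m + 1) δ)
    (hmax : ∀ i, Odd i → IsCosetLeader q (q ^ m + 1) i → i ≤ δ)
    (hκa : q ^ m % 4 = 1 → κ = 1) (hκb : q ^ m % 4 = 3 → κ = 2) :
    (cyclotomicCoset q m δ).card = κ ∧
    ∀ i, Odd i → IsCosetLeader q (q ^ m + 1) i → i ≠ δ → ∀ j, 0 < j → j < 2 * m →
      i * q ^ j ≡ i [MOD (q ^ m + 1)] →
      ∃ a b : ℕ, Odd a ∧ IsCosetLeader q (q ^ m + 1) a ∧ Odd b ∧ IsCosetLeader q (q ^ m + 1) b ∧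
        a ≠ b ∧ i < a ∧ i < b ∧ a ≠ δ ∧ b ≠ δ := by
  obtain ⟨hle, hb⟩ := hδ.orbitBounded hn hq hδo.pos
  rcases Nat.even_or_odd n with hne | hno
  · have hmo : Odd m := by
      by_contra h
      obtain ⟨s, rfl⟩ := Nat.not_odd_iff_even.mp h
      obtain ⟨t, ht⟩ := hq.pow (n := s)
      obtain ⟨u, rfl⟩ := hne
      have h1 : q ^ (s + s) + 1 = 4 * (t * t + t) + 2 := by rw [pow_add, ht]; ring
      omega
    have hq3' : (3 : ℤ) ≤ q := by exact_mod_cast hq3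
    obtain ⟨s, hs⟩ := hmo
    obtain ⟨R', hR'o, hR', hR'1, -⟩ := exists_odd_cofactor (q : ℤ) (by exact_mod_cast hq) hq3' s
    obtain ⟨R, rfl⟩ := Int.eq_ofNat_of_zero_le (show 0 ≤ R' by omega)
    have hRo : Odd R := by exact_mod_cast hR'o
    rw [← hs] at hR'
    have hR : (q + 1) * R = q ^ m + 1 := by exact_mod_cast hR'.symm
    have hRn : R < n := by
      have : 4 * R ≤ (q + 1) * R := Nat.mul_le_mul_right _ (by omega)
      have := hRo.pos
      omega
    have hlead : IsCosetLeader q (q ^ m + 1) (n - R) :=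
      (card_cyclotomicCoset_of_succ_mul hq hq3 hm hn hR (by omega)).1
    have h1 := hmax _ (Nat.Even.sub_odd hRn.le hne hRo) hlead
    have hN : ((q : ℤ) ^ m + 1) = 2 * n := by exact_mod_cast hn
    have hne' : δ ≠ n := by
      rintro rfl
      exact absurd hne (Nat.not_even_iff_odd.mpr hδo)
    have hδpos := hδo.pos
    have h2 := hb.le_succ_mul hq3' (by omega) (by rw [hN]; omega)
    rw [hR'] at h2
    have h3 := le_of_mul_le_mul_left h2 (by linarith)
    have hδR : δ + R = n := by omega
    refine ⟨?_, fun i hio hi hiδ j hj0 hj hs => ?_⟩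
    · rw [(card_cyclotomicCoset_of_succ_mul hq hq3 hm hn hR hδR).2, hκb]
      obtain ⟨u, hu⟩ := hne
      omega
    · obtain ⟨a, b, h1, h2, h3, h4, h5, h6, h7, h8, h9⟩ := exists_two_leaders_gt_of_even hq hq3 hn
        hne ⟨_, ‹_›⟩ hR hRo hi hio (by omega) hj0 hj hs
      exact ⟨a, b, h1, h2, h3, h4, h5, h6, h7, by omega, by omega⟩
  · obtain ⟨h1, h2⟩ := card_cyclotomicCoset_half hq hm hn
    obtain rfl : δ = n := le_antisymm hle (hmax _ hno h1)
    refine ⟨?_, fun i hio hi hiδ j hj0 hj hs =>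
      exists_two_leaders_gt_of_odd hq hq3 hn hno hi hio hiδ hj0 hj hs⟩
    rw [h2, hκa]
    obtain ⟨u, hu⟩ := hno
    omega

theorem stmt16 (q m : ℕ) (hq : Odd q) (hpp : IsPrimePow q) (hm : 2 ≤ m)
    (n : ℕ) (hn : n = (q ^ m + 1) / 2)
    (F E : Type) [Field F] [Fintype F] [DecidableEq F] [Field E] [Fintype E] [Algebra F E]
    (hF : Fintype.card F = q) (hE : Fintype.card E = q ^ (2 * m))
    (β : E) (hβ : IsPrimitiveRoot β (q ^ m + 1))
    (δ1 δ2 δ3 κ : ℕ)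
    (hδ1 : Odd δ1 ∧ IsCosetLeader q (q ^ m + 1) δ1 ∧
      ∀ i : ℕ, Odd i → IsCosetLeader q (q ^ m + 1) i → i ≤ δ1)
    (hδ2 : Odd δ2 ∧ IsCosetLeader q (q ^ m + 1) δ2 ∧ δ2 < δ1 ∧
      ∀ i : ℕ, Odd i → IsCosetLeader q (q ^ m + 1) i → i ≠ δ1 → i ≤ δ2)
    (hδ3 : Odd δ3 ∧ IsCosetLeader q (q ^ m + 1) δ3 ∧ δ3 < δ2 ∧
      ∀ i : ℕ, Odd i → IsCosetLeader q (q ^ m + 1) i → i ≠ δ1 → i ≠ δ2 → i ≤ δ3)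
    (hκa : q ^ m % 4 = 1 → κ = 1) (hκb : q ^ m % 4 = 3 → κ = 2)
    (g : ℕ → Polynomial F)
    (hg : ∀ δ : ℕ,
      g δ = Finset.lcm (Finset.range (δ - 1)) (fun i => minpoly F (β ^ (1 + 2 * i)))) :
    (∀ δ : ℕ, (δ2 + 3) / 2 ≤ δ → δ ≤ (δ1 + 1) / 2 →
      n - (g δ).natDegree = κ ∧ MinDistLB (g δ) n δ1) ∧
    (∀ δ : ℕ, (δ3 + 3) / 2 ≤ δ → δ ≤ (δ2 + 1) / 2 →
      n - (g δ).natDegree = 2 * m + κ ∧ MinDistLB (g δ) n δ2) ∧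
    (25 ≤ q ^ m →
      n - (g ((δ3 + 1) / 2)).natDegree = 4 * m + κ ∧
      MinDistLB (g ((δ3 + 1) / 2)) n δ3) := by
  have hm0 : 0 < m := by omega
  have hq3 : 3 ≤ q := by
    have := hpp.one_lt
    obtain ⟨t, rfl⟩ := hq
    omega
  have hn2 : q ^ m + 1 = 2 * n := by
    have := (hq.pow (n := m)).add_odd odd_one
    rw [hn, Nat.two_mul_div_two_of_even this]
  obtain ⟨ho1, hl1, hmax1⟩ := hδ1
  obtain ⟨ho2, hl2, hlt2, hmax2⟩ := hδ2
  obtain ⟨ho3, hl3, hlt3, hmax3⟩ := hδ3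
  obtain ⟨hle1, -⟩ := hl1.orbitBounded hn2 hq ho1.pos
  obtain ⟨hcard1, hshort⟩ := largest_leader_spec hq hq3 hm0 hn2 ho1 hl1 hmax1 hκa hκb
  have hcard2 : (cyclotomicCoset q m δ2).card = 2 * m := by
    refine card_cyclotomicCoset hm0 fun j hj0 hj hs => ?_
    obtain ⟨a, b, hao, ha, -, -, -, hlt, -, hne, -⟩ := hshort δ2 ho2 hl2 hlt2.ne j hj0 hj hs
    exact absurd (hmax2 a hao ha hne) (by omega)
  have hcard3 : (cyclotomicCoset q m δ3).card = 2 * m := by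
    refine card_cyclotomicCoset hm0 fun j hj0 hj hs => ?_
    obtain ⟨a, b, hao, ha, hbo, hb, hab, hlta, hltb, hnea, hneb⟩ :=
      hshort δ3 ho3 hl3 (by omega) j hj0 hj hs
    by_cases ha2 : a = δ2
    · exact absurd (hmax3 b hbo hb hneb (by omega)) (by omega)
    · exact absurd (hmax3 a hao ha hnea ha2) (by omega)
  have hg' (δ : ℕ) (p : F[X]) : g δ ∣ p ↔
      ∀ i ∈ Finset.range (δ - 1), minpoly F (β ^ (1 + 2 * i)) ∣ p := by
    rw [hg, Finset.lcm_dvd_iff]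
  subst hF
  rw [hn2] at hβ
  refine ⟨fun δ h1 h2 => ?_, fun δ h1 h2 => ?_, fun _ => ?_⟩
  · have := dimension_and_minDistLB (D := {δ1}) (d := δ1) hq hm0 hn2 hβ (hg' δ)
      (fun l hl => by
        obtain rfl := Finset.mem_singleton.mp hl
        exact ⟨ho1, hl1, by omega, le_rfl⟩)
      (fun l hlo hl hlD => by
        have := hmax2 l hlo hl (by simpa using hlD)
        obtain ⟨u, hu⟩ := ho2
        omega) ho1 hle1
    rwa [Finset.sum_singleton, hcard1] at this
  · have := dimension_and_minDistLB (D := {δ2, δ1}) (d := δ2) hq hm0 hn2 hβ (hg' δ)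
      (fun l hl => by
        rcases Finset.mem_insert.mp hl with rfl | hl
        · exact ⟨ho2, hl2, by omega, le_rfl⟩
        · obtain rfl := Finset.mem_singleton.mp hl
          exact ⟨ho1, hl1, by omega, by omega⟩)
      (fun l hlo hl hlD => by
        simp only [Finset.mem_insert, Finset.mem_singleton, not_or] at hlD
        have := hmax3 l hlo hl hlD.2 hlD.1
        obtain ⟨u, hu⟩ := ho3
        omega) ho2 (by omega)
    rwa [Finset.sum_pair hlt2.ne, hcard1, hcard2] at this
  · have := dimension_and_minDistLB (D := {δ3, δ2, δ1}) (d := δ3) hq hm0 hn2 hβ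
      (hg' ((δ3 + 1) / 2))
      (fun l hl => by
        simp only [Finset.mem_insert, Finset.mem_singleton] at hl
        rcases hl with rfl | rfl | rfl
        · exact ⟨ho3, hl3, by omega, le_rfl⟩
        · exact ⟨ho2, hl2, by omega, by omega⟩
        · exact ⟨ho1, hl1, by omega, by omega⟩)
      (fun l hlo hl hlD => by
        simp only [Finset.mem_insert, Finset.mem_singleton, not_or] at hlD
        have h1 := hmax3 l hlo hl hlD.2.2 hlD.2.1
        have h2 := hlD.1
        obtain ⟨u, hu⟩ := hlo
        obtain ⟨v, hv⟩ := ho3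
        omega) ho3 (by omega)
    rw [Finset.sum_insert (by simp; omega), Finset.sum_pair hlt2.ne, hcard1, hcard2,
      hcard3] at this
    rwa [show 4 * m + κ = 2 * m + (2 * m + κ) by ring]
end

section
/- Let q be an odd prime power, m ≥ 2, n = (q^m+1)/2, let β be a primitive (q^m+1)-th root of unity in GF(q^{2m}), and let g(x) be the minimal polynomial of β over GF(q). Then the negacyclic code of length n over GF(q) with generator polynomial g(x) has dimension n − 2m, and its minimum distance d satisfies: d = 5 if q = 3; d = 3 if m is odd and q > 3; and d = 4 if m is even and q > 3. -/
open Polynomial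

/-- The negacyclic code of length `n` over `F` with generator polynomial `g`
(the set of `c ∈ F[X]` with `deg c < n` and `g ∣ c`) has minimum Hamming
distance exactly `d`. -/
def IsMinDist {F : Type*} [Field F] (g : Polynomial F) (n d : ℕ) : Prop :=
  (∃ c : Polynomial F, c ≠ 0 ∧ g ∣ c ∧ c.natDegree < n ∧ c.support.card = d) ∧
  ∀ c : Polynomial F, c ≠ 0 → g ∣ c → c.natDegree < n → d ≤ c.support.card

section Frobenius

variable {F E : Type*} [Field F] [Fintype F] [Field E] [Algebra F E]

lemma aeval_pow_card_pow (c : F[X]) (x : E) (k : ℕ) :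
    aeval (x ^ Fintype.card F ^ k) c = aeval x c ^ Fintype.card F ^ k := by
  induction k generalizing x with
  | zero => simp
  | succ k ih =>
    rw [pow_succ, pow_mul, ← expand_aeval, FiniteField.expand_card, map_pow, ih, pow_mul]

lemma aeval_inv_eq_zero {c : F[X]} {x : E} {m : ℕ} (hx : x ^ (Fintype.card F ^ m + 1) = 1)
    (h : aeval x c = 0) : aeval x⁻¹ c = 0 := by
  have : x⁻¹ = x ^ Fintype.card F ^ m := by
    rw [pow_succ] at hx
    exact (eq_inv_of_mul_eq_one_left hx).symm
  rw [this, aeval_pow_card_pow, h, zero_pow (by positivity)]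

lemma pow_pow_eq_self {M : Type*} [Monoid M] {x : M} {r : ℕ} (h : x ^ r = x) (k : ℕ) :
    x ^ r ^ k = x := by
  induction k with
  | zero => simp
  | succ k ih => rw [pow_succ, pow_mul, ih, h]

lemma algebraMap_pow_card (a : F) : algebraMap F E a ^ Fintype.card F = algebraMap F E a := by
  rw [← map_pow, FiniteField.pow_card]

lemma add_pow_card (x y : E) :
    (x + y) ^ Fintype.card F = x ^ Fintype.card F + y ^ Fintype.card F := by
  obtain ⟨p, hp⟩ := CharP.exists F
  obtain ⟨k, hpp, hk⟩ := FiniteField.card F p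
  have := Fact.mk hpp
  have : CharP E p := charP_of_injective_algebraMap (algebraMap F E).injective p
  rw [hk, add_pow_char_pow]

lemma mem_range_algebraMap_of_pow_card_eq {s : E} (hs : s ^ Fintype.card F = s) :
    ∃ a : F, algebraMap F E a = s := by
  have h1 : (X ^ Fintype.card F - X : F[X]).natDegree = Fintype.card F :=
    FiniteField.X_pow_card_sub_X_natDegree_eq F Fintype.one_lt_card
  have hm : (X ^ Fintype.card F - X : F[X]).Monic :=
    monic_X_pow_sub (by rw [degree_X]; exact_mod_cast Fintype.one_lt_card)
  have h2 := prod_multiset_X_sub_C_of_monic_of_roots_card_eq hm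
    (by rw [h1, FiniteField.roots_X_pow_card_sub_X]; rfl)
  rw [FiniteField.roots_X_pow_card_sub_X] at h2
  have h3 := congrArg (aeval s) h2
  rw [map_sub, map_pow, aeval_X, hs, sub_self] at h3
  change aeval s (∏ a : F, (X - C a)) = 0 at h3
  rw [map_prod, Finset.prod_eq_zero_iff] at h3
  obtain ⟨a, -, ha⟩ := h3
  refine ⟨a, ?_⟩
  rw [map_sub, aeval_X, aeval_C, sub_eq_zero] at ha
  exact ha.symm

/-- An element whose trace `t + t⁻¹` is fixed by Frobenius is fixed by its square. -/
lemma pow_card_sq_eq_self {t : E} (ht : t ≠ 0)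
    (h : (t + t⁻¹) ^ Fintype.card F = t + t⁻¹) : t ^ Fintype.card F ^ 2 = t := by
  rw [add_pow_card, inv_pow] at h
  rw [sq, pow_mul]
  have hu : t ^ Fintype.card F ≠ 0 := pow_ne_zero _ ht
  generalize hU : t ^ Fintype.card F = u at *
  have : (u - t) * (u * t - 1) = 0 := by
    field_simp at h
    linear_combination h
  rcases mul_eq_zero.mp this with h1 | h1
  · rw [sub_eq_zero] at h1
    rw [h1, hU, h1]
  · have : u = t⁻¹ := eq_inv_of_mul_eq_one_left (sub_eq_zero.mp h1)
    rw [this, inv_pow, hU, this, inv_inv]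

lemma div_pow_card_sq_eq_self {a b c : F} (ha : a ≠ 0) (hb : b ≠ 0) {x y z : E}
    (hx : x ≠ 0) (hy : y ≠ 0) (hz : z ≠ 0)
    (h : algebraMap F E a * x + algebraMap F E b * y + algebraMap F E c * z = 0)
    (h' : algebraMap F E a * x⁻¹ + algebraMap F E b * y⁻¹ + algebraMap F E c * z⁻¹ = 0) :
    (x / y) ^ Fintype.card F ^ 2 = x / y := by
  apply pow_card_sq_eq_self (div_ne_zero hx hy)
  have ha' : algebraMap F E a ≠ 0 := by simpa using ha
  have hb' : algebraMap F E b ≠ 0 := by simpa using hb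
  have key : x / y + (x / y)⁻¹ = algebraMap F E ((c ^ 2 - a ^ 2 - b ^ 2) / (a * b)) := by
    have e1 : algebraMap F E a * x + algebraMap F E b * y = -(algebraMap F E c * z) := by
      linear_combination h
    have e2 : algebraMap F E a * x⁻¹ + algebraMap F E b * y⁻¹ = -(algebraMap F E c * z⁻¹) := by
      linear_combination h'
    have e4 : (algebraMap F E a * x + algebraMap F E b * y) *
        (algebraMap F E a * x⁻¹ + algebraMap F E b * y⁻¹) = algebraMap F E c ^ 2 := by
      rw [e1, e2]; field_simp
    simp only [map_div₀, map_sub, map_pow, map_mul]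
    rw [eq_div_iff (mul_ne_zero ha' hb'), ← e4]
    field_simp
    ring
  rw [key, algebraMap_pow_card]

lemma sq_eq_one_of_pow_eq_self {M : Type*} [Monoid M] {x : M} {r k : ℕ} (h : x ^ r = x)
    (h' : x ^ (r ^ k + 1) = 1) : x ^ 2 = 1 := by
  rwa [pow_succ, pow_pow_eq_self h, ← sq] at h'

end Frobenius

section LowerBound

variable {F E : Type*} [Field F] [Fintype F] [Field E] [Algebra F E]

lemma aeval_eq_sum_support {R A : Type*} [CommSemiring R] [Semiring A] [Algebra R A]
    (c : R[X]) (x : A) : aeval x c = ∑ i ∈ c.support, algebraMap R A (c.coeff i) * x ^ i := by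
  rw [aeval_def, eval₂_eq_sum, sum_def]

lemma IsPrimitiveRoot.eq_of_sq_pow_eq {M : Type*} [CommMonoid M] {β : M} {n i j : ℕ}
    (hβ : IsPrimitiveRoot β (2 * n)) (hi : i < n) (hj : j < n)
    (h : (β ^ i) ^ 2 = (β ^ j) ^ 2) : i = j := by
  rw [← pow_mul, ← pow_mul] at h
  have := hβ.pow_inj (by omega) (by omega) h
  omega

variable {β : E} {m n : ℕ} {c : F[X]}

lemma three_le_card_support (hβ : IsPrimitiveRoot β (Fintype.card F ^ m + 1))
    (hn : Fintype.card F ^ m + 1 = 2 * n) (hc : c ≠ 0) (h : aeval β c = 0)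
    (hd : c.natDegree < n) : 3 ≤ c.support.card := by
  have hβ0 : β ≠ 0 := hβ.ne_zero (by omega)
  have hlt : ∀ i ∈ c.support, i < n := fun i hi => (le_natDegree_of_mem_supp i hi).trans_lt hd
  have hne : ∀ i ∈ c.support, algebraMap F E (c.coeff i) ≠ 0 := fun i hi => by
    simpa using hi
  rw [aeval_eq_sum_support] at h
  by_contra! hlt3
  have h0 : c.support.card ≠ 0 := by simpa using hc
  obtain h1 | h2 : c.support.card = 1 ∨ c.support.card = 2 := by omega
  · obtain ⟨i, hs⟩ := Finset.card_eq_one.mp h1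
    have := hne i (by simp [hs])
    rw [hs, Finset.sum_singleton] at h
    exact mul_ne_zero this (pow_ne_zero _ hβ0) h
  · obtain ⟨i, j, hij, hs⟩ := Finset.card_eq_two.mp h2
    have hi := hne i (by simp [hs])
    have hj := hne j (by simp [hs])
    have hi' := hlt i (by simp [hs])
    have hj' := hlt j (by simp [hs])
    rw [hs, Finset.sum_pair hij] at h
    apply hij
    apply IsPrimitiveRoot.eq_of_sq_pow_eq (hn ▸ hβ) hi' hj'
    have e : β ^ i / β ^ j = algebraMap F E (-c.coeff j / c.coeff i) := by
      rw [map_div₀, map_neg]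
      field_simp
      linear_combination h
    have e2 : (β ^ i / β ^ j) ^ 2 = 1 := by
      apply sq_eq_one_of_pow_eq_self (r := Fintype.card F) (k := m)
      · rw [e, algebraMap_pow_card]
      · rw [div_pow, ← pow_mul, ← pow_mul, mul_comm i, mul_comm j, pow_mul, pow_mul, hβ.pow_eq_one]
        simp
    rw [div_pow, div_eq_one_iff_eq (by positivity)] at e2
    exact e2

lemma four_le_card_support (hm : Even m) (hβ : IsPrimitiveRoot β (Fintype.card F ^ m + 1))
    (hn : Fintype.card F ^ m + 1 = 2 * n) (hc : c ≠ 0) (h : aeval β c = 0)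
    (hd : c.natDegree < n) : 4 ≤ c.support.card := by
  have hβ0 : β ≠ 0 := hβ.ne_zero (by omega)
  have h3 := three_le_card_support hβ hn hc h hd
  have h' := aeval_inv_eq_zero hβ.pow_eq_one h
  by_contra! hlt
  obtain ⟨i, j, k, hij, hik, hjk, hs⟩ := Finset.card_eq_three.mp (by omega : c.support.card = 3)
  have hne : ∀ i ∈ c.support, c.coeff i ≠ 0 ∧ i < n := fun i hi =>
    ⟨by simpa using hi, (le_natDegree_of_mem_supp i hi).trans_lt hd⟩
  have hi := hne i (by simp [hs])
  have hj := hne j (by simp [hs])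
  rw [aeval_eq_sum_support, hs, Finset.sum_insert (by simp [hij, hik]), Finset.sum_pair hjk,
    ← add_assoc] at h h'
  simp only [inv_pow] at h'
  have e := div_pow_card_sq_eq_self hi.1 hj.1 (pow_ne_zero i hβ0) (pow_ne_zero j hβ0)
    (pow_ne_zero k hβ0) h h'
  obtain ⟨l, rfl⟩ := hm
  have e2 : (β ^ i / β ^ j) ^ 2 = 1 := by
    apply sq_eq_one_of_pow_eq_self (k := l) e
    rw [← pow_mul, two_mul, div_pow, ← pow_mul, ← pow_mul, mul_comm i, mul_comm j, pow_mul,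
      pow_mul, hβ.pow_eq_one]
    simp
  rw [div_pow, div_eq_one_iff_eq (by positivity)] at e2
  exact hij (IsPrimitiveRoot.eq_of_sq_pow_eq (hn ▸ hβ) hi.2 hj.2 e2)

lemma sq_eq_sq_of_three_sum_eq_zero (h3 : (3 : E) = 0) {u v w : E} (hu : u ≠ 0) (hv : v ≠ 0)
    (hw : w ≠ 0) (h : u + v + w = 0) (h' : u⁻¹ + v⁻¹ + w⁻¹ = 0) : u ^ 2 = v ^ 2 := by
  field_simp at h'
  have : (u - v) ^ 2 = 0 := by
    linear_combination (u + v) * h - h' - u * v * h3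
  rw [sub_eq_zero.mp (pow_eq_zero_iff two_ne_zero |>.mp this)]

lemma sq_eq_sq_of_four_sum_eq_zero {u v w z : E} (hu : u ≠ 0) (hv : v ≠ 0) (hw : w ≠ 0)
    (hz : z ≠ 0) (h : u + v + w + z = 0) (h' : u⁻¹ + v⁻¹ + w⁻¹ + z⁻¹ = 0) :
    u ^ 2 = v ^ 2 ∨ u ^ 2 = w ^ 2 ∨ u ^ 2 = z ^ 2 := by
  have : (u + v) * (u + w) * (u + z) = 0 := by
    field_simp at h'
    linear_combination u ^ 2 * h + h'
  simp only [mul_eq_zero, or_assoc] at this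
  rcases this with h | h | h <;> rw [eq_neg_of_add_eq_zero_left h] <;> simp

lemma five_le_card_support (hF : Fintype.card F = 3)
    (hβ : IsPrimitiveRoot β (Fintype.card F ^ m + 1))
    (hn : Fintype.card F ^ m + 1 = 2 * n) (hc : c ≠ 0) (h : aeval β c = 0)
    (hd : c.natDegree < n) : 5 ≤ c.support.card := by
  have hβ0 : β ≠ 0 := hβ.ne_zero (by omega)
  have h3 := three_le_card_support hβ hn hc h hd
  have h' := aeval_inv_eq_zero hβ.pow_eq_one h
  have h3F : (3 : F) = 0 := by exact_mod_cast hF ▸ Nat.cast_card_eq_zero F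
  have h3E : (3 : E) = 0 := by rw [← map_ofNat (algebraMap F E), h3F, map_zero]
  have hlt : ∀ i ∈ c.support, i < n := fun i hi => (le_natDegree_of_mem_supp i hi).trans_lt hd
  have hcoe : ∀ i ∈ c.support, algebraMap F E (c.coeff i) ^ 2 = 1 := fun i hi => by
    have := FiniteField.pow_card_sub_one_eq_one (c.coeff i) (by simpa using hi)
    rw [hF] at this
    rw [← map_pow, this, map_one]
  rw [aeval_eq_sum_support] at h h'
  set u : ℕ → E := fun i => algebraMap F E (c.coeff i) * β ^ i with hu
  have hu0 : ∀ i ∈ c.support, u i ≠ 0 := fun i hi =>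
    mul_ne_zero (by simpa using hi) (pow_ne_zero _ hβ0)
  have hinj : ∀ i ∈ c.support, ∀ j ∈ c.support, u i ^ 2 = u j ^ 2 → i = j := fun i hi j hj e => by
    simp only [hu, mul_pow, hcoe i hi, hcoe j hj, one_mul] at e
    exact IsPrimitiveRoot.eq_of_sq_pow_eq (hn ▸ hβ) (hlt i hi) (hlt j hj) e
  replace h' : ∑ i ∈ c.support, (u i)⁻¹ = 0 := by
    rw [← h']
    refine Finset.sum_congr rfl fun i hi => ?_
    rw [hu, mul_inv, inv_pow, inv_eq_of_mul_eq_one_left ((sq _).symm.trans (hcoe i hi))]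
  by_contra! hlt
  obtain h1 | h2 : c.support.card = 3 ∨ c.support.card = 3 + 1 := by omega
  · obtain ⟨i, j, k, hij, hik, hjk, hs⟩ := Finset.card_eq_three.mp h1
    rw [hs, Finset.sum_insert (by simp [hij, hik]), Finset.sum_pair hjk, ← add_assoc] at h h'
    rw [hs] at hu0 hinj
    exact hij (hinj i (by simp) j (by simp) (sq_eq_sq_of_three_sum_eq_zero h3E
      (hu0 i (by simp)) (hu0 j (by simp)) (hu0 k (by simp)) h h'))
  · obtain ⟨l, t, hl, hs, ht⟩ := Finset.card_eq_succ.mp h2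
    obtain ⟨i, j, k, hij, hik, hjk, rfl⟩ := Finset.card_eq_three.mp ht
    simp only [Finset.mem_insert, Finset.mem_singleton, not_or] at hl
    rw [← hs, Finset.sum_insert (by simpa using hl), Finset.sum_insert (by simp [hij, hik]),
      Finset.sum_pair hjk, ← add_assoc, ← add_assoc] at h h'
    rw [← hs] at hu0 hinj
    rcases sq_eq_sq_of_four_sum_eq_zero (hu0 l (by simp)) (hu0 i (by simp)) (hu0 j (by simp))
      (hu0 k (by simp)) h h' with e | e | e
    · exact hl.1 (hinj l (by simp) i (by simp) e)
    · exact hl.2.1 (hinj l (by simp) j (by simp) e)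
    · exact hl.2.2 (hinj l (by simp) k (by simp) e)

end LowerBound

section UpperBound

variable {F E : Type*} [Field F] [Fintype F] [Field E] [Algebra F E]

lemma monomial_add_monomial_inj {R : Type*} [Semiring R] {i j i' j' : ℕ} {a b a' b' : R}
    (hij : i < j) (hij' : i' < j') (ha : a ≠ 0) (hb : b ≠ 0) (ha' : a' ≠ 0) (hb' : b' ≠ 0)
    (h : monomial i a + monomial j b = monomial i' a' + monomial j' b') :
    i = i' ∧ j = j' ∧ a = a' ∧ b = b' := by
  have hc : ∀ k, (if i = k then a else 0) + (if j = k then b else 0) =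
      (if i' = k then a' else 0) + (if j' = k then b' else 0) := fun k => by
    simpa only [coeff_add, coeff_monomial] using congrArg (fun p => p.coeff k) h
  have h1 := hc i
  have h2 := hc j
  have h3 := hc i'
  have h4 := hc j'
  grind

/-- Pigeonhole on binomials: an additive map from polynomials to a group that is small compared
with the number of binomials of degree `< N` kills a nonzero polynomial with at most four terms. -/
lemma exists_card_support_le_four {V : Type*} [AddCommGroup V] [Finite V] (φ : F[X] →+ V) {N : ℕ}
    (h : 2 * Nat.card V < N * (N - 1) * (Fintype.card F - 1) ^ 2) :
    ∃ c : F[X], c ≠ 0 ∧ φ c = 0 ∧ c.natDegree < N ∧ c.support.card ≤ 4 := by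
  classical
  have := Fintype.ofFinite V
  let S : Finset ((Σ _ : ℕ, ℕ) × Fˣ × Fˣ) :=
    ((Finset.range N).sigma fun j => Finset.range j) ×ˢ Finset.univ
  have hS : (Finset.univ : Finset V).card < S.card := by
    have h1 := Finset.sum_range_id_mul_two N
    simp only [S, Finset.card_product, Finset.card_sigma, Finset.card_range, Finset.card_univ,
      Fintype.card_prod, Fintype.card_units, ← Nat.card_eq_fintype_card (α := V)]
    rw [← h1] at h
    nlinarith
  let p : (Σ _ : ℕ, ℕ) × Fˣ × Fˣ → F[X] := fun x =>
    monomial x.1.2 (x.2.1 : F) + monomial x.1.1 (x.2.2 : F)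
  obtain ⟨⟨⟨j, i⟩, a, b⟩, hx, ⟨⟨j', i'⟩, a', b'⟩, hy, hne, hxy⟩ :=
    Finset.exists_ne_map_eq_of_card_lt_of_maps_to hS (f := fun x => φ (p x))
      (fun _ _ => Finset.mem_coe.mpr (Finset.mem_univ _))
  simp only [S, Finset.mem_product, Finset.mem_sigma, Finset.mem_range, Finset.mem_univ,
    and_true] at hx hy
  set c := p ⟨⟨j, i⟩, a, b⟩ - p ⟨⟨j', i'⟩, a', b'⟩ with hc
  have hc0 : c ≠ 0 := by
    rw [hc, sub_ne_zero]
    intro e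
    obtain ⟨rfl, rfl, h3, h4⟩ :=
      monomial_add_monomial_inj hx.2 hy.2 a.ne_zero b.ne_zero a'.ne_zero b'.ne_zero e
    rw [Units.ext h3, Units.ext h4] at hne
    exact hne rfl
  have hsupp : c.support ⊆ {i, j, i', j'} := by
    intro k hk
    contrapose! hk
    simp only [Finset.mem_insert, Finset.mem_singleton, not_or] at hk
    simp [hc, p, coeff_monomial, Ne.symm hk.1, Ne.symm hk.2.1, Ne.symm hk.2.2.1,
      Ne.symm hk.2.2.2]
  refine ⟨c, hc0, by rw [hc, map_sub, sub_eq_zero]; exact hxy, ?_,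
    (Finset.card_le_card hsupp).trans Finset.card_le_four⟩
  have := hsupp (natDegree_mem_support_of_nonzero hc0)
  simp only [Finset.mem_insert, Finset.mem_singleton] at this
  omega

variable {β : E} {m n : ℕ}

lemma exists_codeword_card_support_le_four [Fintype E] (hF : 5 ≤ Fintype.card F) (hm : m ≠ 0)
    (hE : Fintype.card E = Fintype.card F ^ (2 * m)) (hn : Fintype.card F ^ m + 1 = 2 * n) :
    ∃ c : F[X], c ≠ 0 ∧ aeval β c = 0 ∧ c.natDegree < n ∧ c.support.card ≤ 4 := by
  refine exists_card_support_le_four (aeval β : F[X] →ₐ[F] E).toAddMonoidHom ?_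
  rw [Nat.card_eq_fintype_card, hE, mul_comm 2 m, pow_mul]
  have hQ : Fintype.card F ≤ Fintype.card F ^ m := Nat.le_self_pow hm _
  generalize Fintype.card F ^ m = Q at *
  have h16 : 16 ≤ (Fintype.card F - 1) ^ 2 := Nat.pow_le_pow_left (by omega : 4 ≤ _) 2
  obtain ⟨k, rfl⟩ : ∃ k, n = k + 1 := ⟨n - 1, by omega⟩
  obtain rfl : Q = 2 * k + 1 := by omega
  calc 2 * (2 * k + 1) ^ 2 < (k + 1) * k * 16 := by nlinarith
    _ ≤ _ := Nat.mul_le_mul_left _ h16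

lemma exists_codeword_card_support_le_five [Fintype E] (hF : Fintype.card F = 3) (hm : 3 ≤ m)
    (hE : Fintype.card E = Fintype.card F ^ (2 * m)) (hn : Fintype.card F ^ m + 1 = 2 * n)
    (hβ : β ≠ 0) :
    ∃ c : F[X], c ≠ 0 ∧ aeval β c = 0 ∧ c.natDegree < n ∧ c.support.card ≤ 5 := by
  have hβn : β ^ (n - 1) ≠ 0 := pow_ne_zero _ hβ
  let W : Submodule F E := F ∙ β ^ (n - 1)
  have hW : Nat.card W = 3 := by
    rw [← hF, ← Nat.card_eq_fintype_card]
    exact (Nat.card_congr (LinearEquiv.toSpanNonzeroSingleton F E _ hβn).toEquiv).symm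
  have hV := W.card_eq_card_quotient_mul_card
  rw [hW, Nat.card_eq_fintype_card, hE, mul_comm 2 m, pow_mul] at hV
  have hQ : 3 ^ 3 ≤ Fintype.card F ^ m := by
    rw [hF]
    exact Nat.pow_le_pow_right (by norm_num) hm
  generalize Fintype.card F ^ m = Q at *
  have hlt : 2 * Nat.card (E ⧸ W) < (n - 1) * (n - 1 - 1) * (Fintype.card F - 1) ^ 2 := by
    obtain ⟨k, rfl⟩ : ∃ k, n = k + 2 := ⟨n - 2, by omega⟩
    obtain rfl : Q = 2 * k + 3 := by omega
    simp only [hF, Nat.add_succ_sub_one, Nat.reduceSub, Nat.add_zero]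
    nlinarith
  obtain ⟨c, hc0, hc, hd, hs⟩ := exists_card_support_le_four
    (W.mkQ.toAddMonoidHom.comp (aeval β : F[X] →ₐ[F] E).toAddMonoidHom) hlt
  have hc' : aeval β c ∈ W := (Submodule.Quotient.mk_eq_zero W).mp hc
  obtain ⟨e, he⟩ := Submodule.mem_span_singleton.mp hc'
  have hne : c - monomial (n - 1) e ≠ 0 := by
    intro h0
    have := congrArg (fun p => p.coeff c.natDegree) h0
    simp only [coeff_sub, coeff_monomial, coeff_zero, if_neg hd.ne', sub_zero,
      coeff_natDegree, leadingCoeff_eq_zero] at this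
    exact hc0 this
  refine ⟨c - monomial (n - 1) e, hne, ?_, ?_, ?_⟩
  · rw [map_sub, aeval_monomial, ← he, Algebra.smul_def, sub_self]
  · have h1 := natDegree_sub_le c (monomial (n - 1) e)
    have h2 := natDegree_monomial_le e (m := n - 1)
    omega
  · rw [sub_eq_add_neg, ← map_neg]
    calc _ ≤ _ := Finset.card_le_card support_add
      _ ≤ _ := Finset.card_union_le _ _
      _ ≤ _ := Nat.add_le_add hs ((Finset.card_le_card (support_monomial_subset ..)).trans_eq
        (Finset.card_singleton _))

lemma exists_codeword_card_support_le_three (hF : 3 < Fintype.card F) (hm : Odd m)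
    (hβ : IsPrimitiveRoot β (Fintype.card F ^ m + 1)) (hn : Fintype.card F ^ m + 1 = 2 * n) :
    ∃ c : F[X], c ≠ 0 ∧ aeval β c = 0 ∧ c.natDegree < n ∧ c.support.card ≤ 3 := by
  obtain ⟨k, hk⟩ : Fintype.card F + 1 ∣ Fintype.card F ^ m + 1 := by
    simpa using Odd.nat_add_dvd_pow_add_pow (Fintype.card F) 1 hm
  have hk0 : 0 < k := Nat.pos_of_ne_zero (by rintro rfl; omega)
  have hkn : 2 * k < n := by nlinarith
  have hδ : (β ^ k) ^ Fintype.card F = (β ^ k)⁻¹ := by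
    apply eq_inv_of_mul_eq_one_left
    rw [← pow_succ, ← pow_mul, mul_comm, ← hk, hβ.pow_eq_one]
  have hδ0 : β ^ k ≠ 0 := pow_ne_zero _ (hβ.ne_zero (by omega))
  obtain ⟨s, hs⟩ : ∃ s : F, algebraMap F E s = β ^ k + (β ^ k)⁻¹ := by
    apply mem_range_algebraMap_of_pow_card_eq
    rw [add_pow_card, inv_pow, hδ, inv_inv, add_comm]
  set c : F[X] := monomial (2 * k) 1 - monomial k s + monomial 0 1 with hc
  have hsupp : c.support ⊆ {2 * k, k, 0} := by
    intro i hi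
    contrapose! hi
    simp only [Finset.mem_insert, Finset.mem_singleton, not_or] at hi
    simp [hc, coeff_monomial, Ne.symm hi.1, Ne.symm hi.2.1, coeff_one, hi.2.2]
  have hc0 : c ≠ 0 := by
    intro h0
    have := congrArg (fun p => p.coeff 0) h0
    simp [hc, coeff_monomial, hk0.ne'] at this
  refine ⟨c, hc0, ?_, ?_, (Finset.card_le_card hsupp).trans Finset.card_le_three⟩
  · simp only [hc, map_add, map_sub, aeval_monomial, hs, map_one, one_mul, pow_zero]
    field_simp
    ring
  · have := hsupp (natDegree_mem_support_of_nonzero hc0)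
    simp only [Finset.mem_insert, Finset.mem_singleton] at this
    omega

end UpperBound

lemma natDegree_minpoly_of_isPrimitiveRoot {F E : Type*} [Field F] [Fintype F] [Field E]
    [Fintype E] [Algebra F E] {m : ℕ} {β : E} (hm : m ≠ 0)
    (hE : Fintype.card E = Fintype.card F ^ (2 * m))
    (hβ : IsPrimitiveRoot β (Fintype.card F ^ m + 1)) : (minpoly F β).natDegree = 2 * m := by
  have hint : IsIntegral F β := IsIntegral.of_finite F β
  have hfr : Module.finrank F E = 2 * m :=
    Nat.pow_right_injective Fintype.one_lt_card (Module.card_eq_pow_finrank.symm.trans hE)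
  have hdvd := hfr ▸ minpoly.degree_dvd hint
  set d := (minpoly F β).natDegree with hd
  have hd0 : 0 < d := minpoly.natDegree_pos hint
  have hpow : β ^ Fintype.card F ^ d = β := by
    have := Fintype.ofFinite (IntermediateField.adjoin F {β})
    have h1 : Fintype.card (IntermediateField.adjoin F {β}) = Fintype.card F ^ d := by
      rw [Module.card_eq_pow_finrank (K := F), IntermediateField.adjoin.finrank hint]
    have h2 := FiniteField.pow_card (IntermediateField.AdjoinSimple.gen F β)
    rw [h1] at h2
    simpa using congrArg (algebraMap (IntermediateField.adjoin F {β}) E) h2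
  have hone : β ^ (Fintype.card F ^ d - 1) = 1 := by
    have hpos : 0 < Fintype.card F ^ d := by positivity
    rw [← Nat.sub_add_cancel hpos, pow_succ] at hpow
    exact mul_right_cancel₀ (hβ.ne_zero (by omega)) (hpow.trans (one_mul β).symm)
  have hle := Nat.le_of_dvd
    (Nat.sub_pos_of_lt (Nat.one_lt_pow hd0.ne' Fintype.one_lt_card)) (hβ.dvd_of_pow_eq_one _ hone)
  have hmd : m < d := by
    rw [← Nat.pow_lt_pow_iff_right (Fintype.one_lt_card (α := F))]
    omega
  obtain ⟨k, hk⟩ := hdvd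
  have : k = 1 := by
    have : k < 2 := by nlinarith
    have : k ≠ 0 := by rintro rfl; omega
    omega
  subst this
  omega

lemma isMinDist_minpoly {F E : Type*} [Field F] [Field E] [Algebra F E] {β : E} {n d : ℕ}
    (hex : ∃ c : F[X], c ≠ 0 ∧ aeval β c = 0 ∧ c.natDegree < n ∧ c.support.card ≤ d)
    (hle : ∀ c : F[X], c ≠ 0 → aeval β c = 0 → c.natDegree < n → d ≤ c.support.card) :
    IsMinDist (minpoly F β) n d := by
  simp only [IsMinDist, minpoly.dvd_iff]
  obtain ⟨c, hc, h, hd, hs⟩ := hex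
  exact ⟨⟨c, hc, h, hd, hs.antisymm (hle c hc h hd)⟩, hle⟩

theorem stmt17 (q m : ℕ) (hq : Odd q) (hpp : IsPrimePow q) (hm : 2 ≤ m)
    (n : ℕ) (hn : n = (q ^ m + 1) / 2)
    (F E : Type) [Field F] [Fintype F] [Field E] [Fintype E] [Algebra F E]
    (hF : Fintype.card F = q) (hE : Fintype.card E = q ^ (2 * m))
    (β : E) (hβ : IsPrimitiveRoot β (q ^ m + 1))
    (g : Polynomial F) (hg : g = minpoly F β) :
    g.natDegree = 2 * m ∧
    ((q = 3 → IsMinDist g n 5) ∧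
     (3 < q → Odd m → IsMinDist g n 3) ∧
     (3 < q → Even m → IsMinDist g n 4)) := by
  subst hg
  have hn2 : q ^ m + 1 = 2 * n := by
    obtain ⟨k, hk⟩ := hq.pow (n := m)
    omega
  subst hF
  have hdeg := natDegree_minpoly_of_isPrimitiveRoot (by omega) hE hβ
  refine ⟨hdeg, fun h3 => ?_, fun h3 hodd => ?_, fun h3 heven => ?_⟩
  · refine isMinDist_minpoly ?_ fun c => five_le_card_support h3 hβ hn2
    obtain rfl | hm3 : m = 2 ∨ 3 ≤ m := by omega
    · have hn5 : n = 5 := by rw [hn, h3]; norm_num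
      refine ⟨minpoly F β, minpoly.ne_zero (IsIntegral.of_finite F β), minpoly.aeval F β,
        by omega, ?_⟩
      have := card_supp_le_succ_natDegree (minpoly F β)
      omega
    · exact exists_codeword_card_support_le_five h3 hm3 hE hn2 (hβ.ne_zero (by omega))
  · exact isMinDist_minpoly (exists_codeword_card_support_le_three h3 hodd hβ hn2)
      fun c => three_le_card_support hβ hn2
  · have h5 : 5 ≤ Fintype.card F := by
      obtain ⟨k, hk⟩ := hq
      omega
    exact isMinDist_minpoly (exists_codeword_card_support_le_four h5 (by omega) hE hn2)
      fun c => four_le_card_support heven hβ hn2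
end

section
/- Let q be an odd prime power, m ≥ 2, n = (q^m−1)/2, let β be a primitive (q^m−1)-th root of unity in GF(q^m), and let g(x) be the minimal polynomial of β over GF(q). Then the negacyclic code of length n over GF(q) with generator polynomial g(x) has dimension n − m, and its minimum distance d satisfies: d = 3 if q = 3, and d = 2 if q > 3. -/
open Polynomial

theorem aeval_ne_zero_of_support_card_le_one {F E : Type*} [Field F] [Field E] [Algebra F E]
    {β : E} (hβ : β ≠ 0) {c : F[X]} (hc : c ≠ 0) (hcard : c.support.card ≤ 1) :
    aeval β c ≠ 0 := by
  have h1 : c.support.card = 1 := by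
    have : c.support.card ≠ 0 := by simpa using hc
    omega
  obtain ⟨k, x, hx, rfl⟩ := card_support_eq_one.mp h1
  simp [hx, hβ]

theorem minpoly_natDegree_of_isPrimitiveRoot {F E : Type*} [Field F] [Fintype F] [Field E]
    [Fintype E] [Algebra F E] {m : ℕ} (hE : Fintype.card E = Fintype.card F ^ m)
    {β : E} (hβ : IsPrimitiveRoot β (Fintype.card E - 1)) :
    (minpoly F β).natDegree = m := by
  have hpos : 0 < Fintype.card E - 1 := by have := Fintype.one_lt_card (α := E); omega
  have htop : IntermediateField.adjoin F {β} = ⊤ := by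
    rw [eq_top_iff]
    intro x _
    by_cases hx : x = 0
    · rw [hx]; exact zero_mem _
    · have : NeZero (Fintype.card E - 1) := ⟨hpos.ne'⟩
      obtain ⟨i, -, rfl⟩ := hβ.eq_pow_of_pow_eq_one (FiniteField.pow_card_sub_one_eq_one x hx)
      exact pow_mem (IntermediateField.mem_adjoin_simple_self F β) i
  rw [← IntermediateField.adjoin.finrank (Algebra.IsIntegral.isIntegral β), htop,
    IntermediateField.finrank_top']
  have h := Module.card_eq_pow_finrank (K := F) (V := E)
  rw [hE] at h
  exact (Nat.pow_right_injective (Fintype.one_lt_card (α := F)) h).symm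

theorem exists_algebraMap_eq_of_pow_card_sub_one {F E : Type*} [Field F] [Fintype F] [Field E]
    [Algebra F E] {y : E} (hy : y ^ (Fintype.card F - 1) = 1) :
    ∃ a : F, algebraMap F E a = y := by
  classical
  obtain ⟨u, hu⟩ := IsCyclic.exists_ofOrder_eq_natCard (α := Fˣ)
  rw [Nat.card_eq_fintype_card, Fintype.card_units] at hu
  have hprim : IsPrimitiveRoot (algebraMap F E (u : F)) (Fintype.card F - 1) :=
    (IsPrimitiveRoot.coe_units_iff.mpr (hu ▸ IsPrimitiveRoot.orderOf u)).map_of_injective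
      (algebraMap F E).injective
  have : NeZero (Fintype.card F - 1) :=
    ⟨by have := Fintype.one_lt_card (α := F); omega⟩
  obtain ⟨i, -, rfl⟩ := hprim.eq_pow_of_pow_eq_one hy
  exact ⟨(u : F) ^ i, by simp⟩

theorem isMinDist_two {F E : Type*} [Field F] [Fintype F] [Field E] [Algebra F E] {m n : ℕ}
    (hm : 2 ≤ m) (hF : 3 < Fintype.card F) (hn : n = (Fintype.card F ^ m - 1) / 2)
    {β : E} (hβ0 : β ≠ 0) (hβ : β ^ (Fintype.card F ^ m - 1) = 1) :
    IsMinDist (minpoly F β) n 2 := by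
  set q := Fintype.card F with hq
  obtain ⟨k, hk⟩ : q - 1 ∣ q ^ m - 1 := by simpa using Nat.sub_dvd_pow_sub_pow q 1 m
  have hqm : q ^ 2 ≤ q ^ m := Nat.pow_le_pow_right (by omega) hm
  have hq2 : 16 ≤ q ^ 2 := by nlinarith
  have hk0 : 0 < k := by
    rcases Nat.eq_zero_or_pos k with rfl | h
    · omega
    · exact h
  have hkn : k < n := by
    have : 3 * k ≤ (q - 1) * k := Nat.mul_le_mul_right k (by omega)
    omega
  obtain ⟨a, ha⟩ := exists_algebraMap_eq_of_pow_card_sub_one (F := F) (y := β ^ k) (by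
    rw [← pow_mul, mul_comm, ← hq, ← hk, hβ])
  have ha0 : a ≠ 0 := by
    rintro rfl
    exact pow_ne_zero k hβ0 (by simpa using ha.symm)
  have hcard : (C (-a) * X ^ 0 + C 1 * X ^ k : F[X]).support.card = 2 :=
    card_support_binomial hk0.ne (neg_ne_zero.mpr ha0) one_ne_zero
  refine ⟨⟨C (-a) * X ^ 0 + C 1 * X ^ k, ?_, ?_, ?_, hcard⟩, ?_⟩
  · intro h; rw [h] at hcard; simp at hcard
  · exact minpoly.dvd _ _ (by simp [ha])
  · refine lt_of_le_of_lt ?_ hkn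
    compute_degree
  · intro c hc hdvd _
    by_contra! hlt
    exact aeval_ne_zero_of_support_card_le_one hβ0 hc (by omega)
      ((minpoly.dvd_iff).mp hdvd)

theorem isMinDist_three {F E : Type*} [Field F] [Fintype F] [Field E] [Fintype E] [Algebra F E]
    {n : ℕ} (hF : Fintype.card F = 3) (hE : Fintype.card E - 1 = 2 * n) (hn : 2 ≤ n)
    {β : E} (hβ : IsPrimitiveRoot β (2 * n)) :
    IsMinDist (minpoly F β) n 3 := by
  have hβ0 : β ≠ 0 := hβ.ne_zero (by omega)
  have hpow : ∀ j, 0 < j → j < n → (β ^ j) ^ 2 ≠ 1 := by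
    intro j hj hjn h
    rw [← pow_mul] at h
    have := Nat.le_of_dvd (by omega) (hβ.dvd_of_pow_eq_one _ h)
    omega
  have hsq : ∀ a : F, a ≠ 0 → a ^ 2 = 1 := by
    intro a ha
    simpa [hF] using FiniteField.pow_card_sub_one_eq_one a ha
  have h3 : (3 : E) = 0 := by
    have h : ((Fintype.card F : ℕ) : F) = 0 := FiniteField.cast_card_eq_zero F
    rw [hF] at h
    have h := congrArg (algebraMap F E) h
    rwa [map_natCast, map_zero] at h
  have hβsq : β ^ 2 ≠ 1 := by simpa using hpow 1 one_pos (by omega)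
  have hβn : β ^ n = -1 := by
    have h : (β ^ n) ^ 2 = 1 := by rw [← pow_mul, mul_comm]; exact hβ.pow_eq_one
    rcases sq_eq_one_iff.mp h with h | h
    · exact absurd h (hβ.pow_ne_one_of_pos_of_lt (by omega) (by omega))
    · exact h
  refine ⟨?_, ?_⟩
  · have h1β : 1 + β ≠ 0 := fun h => hβsq (by linear_combination (β - 1) * h)
    have : NeZero (2 * n) := ⟨by omega⟩
    obtain ⟨i, hi, hiβ⟩ := hβ.eq_pow_of_pow_eq_one
      (hE ▸ FiniteField.pow_card_sub_one_eq_one (1 + β) h1β)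
    obtain ⟨j, s, hs, hjn, hj⟩ : ∃ (j : ℕ) (s : F), s ^ 2 = 1 ∧ j < n ∧
        1 + β + algebraMap F E s * β ^ j = 0 := by
      by_cases hin : i < n
      · exact ⟨i, -1, by simp, hin, by simp [hiβ]⟩
      · refine ⟨i - n, 1, by simp, by omega, ?_⟩
        have : β ^ i = β ^ n * β ^ (i - n) := by rw [← pow_add]; congr 1; omega
        rw [← hiβ, this, hβn]
        simp
    have hs0 : s ≠ 0 := by rintro rfl; simp at hs
    have hs1 : s = 1 ∨ s = -1 := sq_eq_one_iff.mp hs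
    have hβ1 : β ≠ 1 := by rintro rfl; simp at hβsq
    have hj0 : j ≠ 0 := by
      rintro rfl
      rcases hs1 with rfl | rfl
      · exact hβ1 (by simp at hj; linear_combination hj - h3)
      · exact hβ0 (by simpa using hj)
    have hj1 : j ≠ 1 := by
      rintro rfl
      rcases hs1 with rfl | rfl
      · exact hβ1 (by simp at hj; linear_combination β * h3 - hj)
      · simp at hj
    have hcard : (C 1 * X ^ 0 + C 1 * X ^ 1 + C s * X ^ j : F[X]).support.card = 3 :=
      card_support_trinomial one_pos (by omega) one_ne_zero one_ne_zero hs0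
    refine ⟨C 1 * X ^ 0 + C 1 * X ^ 1 + C s * X ^ j, ?_, ?_, ?_, hcard⟩
    · intro h; rw [h] at hcard; simp at hcard
    · exact minpoly.dvd _ _ (by simpa using hj)
    · refine lt_of_le_of_lt (b := j) ?_ hjn
      compute_degree
      omega
  · intro c hc hdvd hdeg
    have hroot : aeval β c = 0 := minpoly.dvd_iff.mp hdvd
    by_contra! hlt
    have h2 : c.support.card = 2 := by
      by_contra h
      exact aeval_ne_zero_of_support_card_le_one hβ0 hc (by omega) hroot
    obtain ⟨k, l, hkl, x, y, hx, hy, rfl⟩ := card_support_eq_two.mp h2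
    have hln : l < n := by
      refine lt_of_le_of_lt (le_natDegree_of_ne_zero ?_) hdeg
      simp [coeff_X_pow, hkl.ne', hy]
    have hl : β ^ l = β ^ k * β ^ (l - k) := by rw [← pow_add]; congr 1; omega
    have hsum : algebraMap F E x + algebraMap F E y * β ^ (l - k) = 0 := by
      refine (mul_eq_zero.mp ?_).resolve_left (pow_ne_zero k hβ0)
      simp [hl] at hroot
      linear_combination hroot
    have hx2 : algebraMap F E x ^ 2 = 1 := by rw [← map_pow, hsq x hx, map_one]
    have hy2 : algebraMap F E y ^ 2 = 1 := by rw [← map_pow, hsq y hy, map_one]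
    refine hpow (l - k) (by omega) (by omega) ?_
    linear_combination (algebraMap F E y * β ^ (l - k) - algebraMap F E x) * hsum
      + hx2 - (β ^ (l - k)) ^ 2 * hy2

theorem stmt18 (q m : ℕ) (hq : Odd q) (hpp : IsPrimePow q) (hm : 2 ≤ m)
    (n : ℕ) (hn : n = (q ^ m - 1) / 2)
    (F E : Type) [Field F] [Fintype F] [Field E] [Fintype E] [Algebra F E]
    (hF : Fintype.card F = q) (hE : Fintype.card E = q ^ m)
    (β : E) (hβ : IsPrimitiveRoot β (q ^ m - 1))
    (g : Polynomial F) (hg : g = minpoly F β) :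
    g.natDegree = m ∧
    ((q = 3 → IsMinDist g n 3) ∧ (3 < q → IsMinDist g n 2)) := by
  subst hg hF
  have hpos : 9 ≤ Fintype.card F ^ m := by
    have h3 : 3 ≤ Fintype.card F := by
      have := Fintype.one_lt_card (α := F)
      obtain ⟨k, hk⟩ := hq
      omega
    calc 9 = 3 ^ 2 := by norm_num
      _ ≤ 3 ^ m := Nat.pow_le_pow_right (by norm_num) hm
      _ ≤ _ := Nat.pow_le_pow_left h3 m
  have htwo : Fintype.card F ^ m - 1 = 2 * n := by
    obtain ⟨k, hk⟩ := hq.pow (n := m)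
    omega
  refine ⟨minpoly_natDegree_of_isPrimitiveRoot hE (hE ▸ hβ), fun h3 => ?_, fun h3 => ?_⟩
  · exact isMinDist_three h3 (by omega) (by omega) (htwo ▸ hβ)
  · exact isMinDist_two hm h3 hn (hβ.ne_zero (by omega)) hβ.pow_eq_one
end

section
/- Let q ≥ 7 be an odd prime power, m ≥ 2, n = (q^m−1)/2, let β be a primitive (q^m−1)-th root of unity in GF(q^m), and let g(x) = M_β(x)·M_{β^3}(x), the product of the minimal polynomials of β and β^3 over GF(q). Then the negacyclic code of length n over GF(q) with generator polynomial g(x) has dimension n − 2m and minimum distance exactly 3. -/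
open Polynomial

/-- In an extension of degree `m` of the field with `q` elements, a power `β ^ k` of a primitive
element of the multiplicative group with `0 < k < q` still has a minimal polynomial of
degree `m`. -/
theorem natDegree_minpoly_pow_of_isPrimitiveRoot {q m k : ℕ} {F E : Type*} [Field F] [Fintype F]
    [Field E] [Fintype E] [Algebra F E] (hF : Fintype.card F = q) (hE : Fintype.card E = q ^ m)
    {β : E} (hβ : IsPrimitiveRoot β (q ^ m - 1)) (hβ0 : β ≠ 0) (hk : 0 < k) (hkq : k < q) :
    (minpoly F (β ^ k)).natDegree = m := by
  have hq1 : 1 < q := hF ▸ Fintype.one_lt_card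
  have hfin : Module.finrank F E = m := by
    have h := Module.card_eq_pow_finrank (K := F) (V := E)
    rw [hE, hF] at h
    exact (Nat.pow_right_injective hq1 h).symm
  set d := (minpoly F (β ^ k)).natDegree with hd
  have hint : IsIntegral F (β ^ k) := Algebra.IsIntegral.isIntegral _
  have hdpos : 0 < d := minpoly.natDegree_pos hint
  have hdm : d ≤ m := hfin ▸ minpoly.natDegree_le (β ^ k)
  by_contra hne
  have hlt : d + 1 ≤ m := by omega
  have hpow : (β ^ k) ^ q ^ d = β ^ k := by
    let K := IntermediateField.adjoin F {β ^ k}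
    have : Fintype K := Fintype.ofFinite K
    have hcard : Fintype.card K = q ^ d := by
      rw [Module.card_eq_pow_finrank (K := F) (V := K), hF,
        IntermediateField.adjoin.finrank hint]
    have h := FiniteField.pow_card (IntermediateField.AdjoinSimple.gen F (β ^ k) : K)
    rw [hcard] at h
    simpa using congrArg (algebraMap K E) h
  have hone : β ^ (k * (q ^ d - 1)) = 1 := by
    rw [pow_mul]
    apply mul_right_cancel₀ (pow_ne_zero k hβ0)
    rw [← pow_succ, Nat.sub_add_cancel (Nat.one_le_pow _ _ (by omega)), hpow, one_mul]
  have hqd : 1 < q ^ d := Nat.one_lt_pow hdpos.ne' hq1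
  have hle := Nat.le_of_dvd (Nat.mul_pos hk (by omega)) (hβ.dvd_of_pow_eq_one _ hone)
  have h1 : q ^ (d + 1) ≤ q ^ m := Nat.pow_le_pow_right (by omega) hlt
  have h2 : (k + 1) * q ^ d ≤ q ^ (d + 1) := by
    rw [pow_succ, mul_comm]
    exact Nat.mul_le_mul_left _ hkq
  rw [Nat.mul_sub, mul_one] at hle
  rw [add_mul, one_mul] at h2
  omega

/-- A nonzero polynomial of degree less than `n` vanishing at `β` and `β ^ 3`, where the order of
`β` is at least `2 * n`, has at least three nonzero coefficients. -/
theorem three_le_card_support_of_aeval_eq_zero {F E : Type*} [Field F] [Field E] [Algebra F E]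
    {β : E} {n r : ℕ} (hβ : IsPrimitiveRoot β r) (hβ0 : β ≠ 0) (hr : 2 * n ≤ r) {c : F[X]}
    (hc : c ≠ 0) (hdeg : c.natDegree < n) (h1 : aeval β c = 0) (h3 : aeval (β ^ 3) c = 0) :
    3 ≤ c.support.card := by
  by_contra hlt
  have hpos : 0 < c.support.card := by
    simpa [Finset.card_pos] using hc
  have hcases : c.support.card = 1 ∨ c.support.card = 2 := by omega
  rcases hcases with h | h
  · obtain ⟨k, x, hx, rfl⟩ := card_support_eq_one.mp h
    simp [hx, hβ0] at h1
  · obtain ⟨i, j, hij, x, y, hx, hy, rfl⟩ := card_support_eq_two.mp h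
    have hj : j < n := by
      refine lt_of_le_of_lt (le_natDegree_of_ne_zero ?_) hdeg
      simp [coeff_X_pow, hij.ne', hy]
    obtain ⟨k, rfl⟩ := Nat.exists_eq_add_of_lt hij
    have hy' : algebraMap F E y ≠ 0 := by simpa using hy
    simp only [map_add, map_mul, aeval_C, map_pow, aeval_X] at h1 h3
    have h1' : algebraMap F E x + algebraMap F E y * β ^ (k + 1) = 0 := by
      apply mul_right_cancel₀ (pow_ne_zero i hβ0)
      linear_combination h1
    have h3' : algebraMap F E x + algebraMap F E y * (β ^ (k + 1)) ^ 3 = 0 := by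
      apply mul_right_cancel₀ (pow_ne_zero i (pow_ne_zero 3 hβ0))
      linear_combination h3
    have hsq : β ^ ((k + 1) * 2) = 1 := by
      rw [pow_mul]
      apply mul_left_cancel₀ (mul_ne_zero hy' (pow_ne_zero (k + 1) hβ0))
      linear_combination h3' - h1'
    have := Nat.le_of_dvd (by omega) (hβ.dvd_of_pow_eq_one _ hsq)
    omega

/-- If `β ^ N` is the image of `a`, then `(X ^ N - a) (X ^ N - a ^ 3)` is a multiple of the product
of the minimal polynomials of `β` and `β ^ 3`. -/
theorem minpoly_mul_minpoly_dvd {F E : Type*} [Field F] [Field E] [Algebra F E] {β : E} {N : ℕ}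
    {a : F} (ha : algebraMap F E a = β ^ N) :
    minpoly F β * minpoly F (β ^ 3) ∣ (X ^ N - C a) * (X ^ N - C (a ^ 3)) := by
  apply mul_dvd_mul <;> apply minpoly.dvd
  · simp [ha]
  · simp [ha]
    ring

theorem stmt19 (q m : ℕ) (hq : Odd q) (hpp : IsPrimePow q) (hq7 : 7 ≤ q) (hm : 2 ≤ m)
    (n : ℕ) (hn : n = (q ^ m - 1) / 2)
    (F E : Type) [Field F] [Fintype F] [Field E] [Fintype E] [Algebra F E]
    (hF : Fintype.card F = q) (hE : Fintype.card E = q ^ m)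
    (β : E) (hβ : IsPrimitiveRoot β (q ^ m - 1))
    (g : Polynomial F) (hg : g = minpoly F β * minpoly F (β ^ 3)) :
    g.natDegree = 2 * m ∧ IsMinDist g n 3 := by
  have hqm : 1 < q ^ m := Nat.one_lt_pow (by omega) (by omega)
  have hβ0 : β ≠ 0 := hβ.ne_zero (by omega)
  have hint (x : E) : IsIntegral F x := Algebra.IsIntegral.isIntegral x
  refine ⟨?_, ?_, fun c hc hgc hdeg => ?_⟩
  · have h1 := natDegree_minpoly_pow_of_isPrimitiveRoot hF hE hβ hβ0 one_pos (by omega)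
    have h3 := natDegree_minpoly_pow_of_isPrimitiveRoot hF hE hβ hβ0 three_pos (by omega)
    rw [pow_one] at h1
    rw [hg, natDegree_mul (minpoly.ne_zero (hint _)) (minpoly.ne_zero (hint _)), h1, h3, two_mul]
  · obtain ⟨N, hN⟩ : q - 1 ∣ q ^ m - 1 := by simpa using Nat.sub_dvd_pow_sub_pow q 1 m
    have hNpos : 0 < N := by
      rcases Nat.eq_zero_or_pos N with rfl | h
      · omega
      · exact h
    have hNn : 2 * N < n := by
      have : 6 * N ≤ (q - 1) * N := Nat.mul_le_mul_right _ (by omega)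
      omega
    obtain ⟨a, ha⟩ : ∃ a : F, algebraMap F E a = β ^ N := by
      refine ⟨Algebra.norm F β, ?_⟩
      rw [FiniteField.algebraMap_norm_eq_pow, Nat.card_eq_fintype_card, Nat.card_eq_fintype_card,
        hF, hE, hN, Nat.mul_div_cancel_left _ (by omega)]
    have ha0 : a ≠ 0 := by
      rintro rfl
      exact pow_ne_zero N hβ0 (by simpa using ha.symm)
    have hb : -(a + a ^ 3) ≠ 0 := by
      intro h
      have h2 : a ^ 2 = -1 := by
        apply mul_left_cancel₀ ha0
        linear_combination -h
      have h4 : β ^ (N * 4) = 1 := by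
        rw [pow_mul, ← ha, ← map_pow, show a ^ 4 = 1 by linear_combination (a ^ 2 - 1) * h2,
          map_one]
      have := Nat.le_of_dvd (by omega) (hβ.dvd_of_pow_eq_one _ h4)
      omega
    have hc : (X ^ N - C a) * (X ^ N - C (a ^ 3)) =
        C (a ^ 4) * X ^ 0 + C (-(a + a ^ 3)) * X ^ N + C 1 * X ^ (2 * N) := by
      simp only [map_neg, map_add, map_pow, map_one]
      ring
    have hcard : ((X ^ N - C a) * (X ^ N - C (a ^ 3))).support.card = 3 := by
      rw [hc]
      exact card_support_trinomial hNpos (by omega) (pow_ne_zero 4 ha0) hb one_ne_zero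
    refine ⟨(X ^ N - C a) * (X ^ N - C (a ^ 3)), ?_, hg ▸ minpoly_mul_minpoly_dvd ha, ?_, hcard⟩
    · intro h
      rw [h, support_zero, Finset.card_empty] at hcard
      omega
    · rw [natDegree_mul (X_pow_sub_C_ne_zero hNpos _) (X_pow_sub_C_ne_zero hNpos _),
        natDegree_X_pow_sub_C, natDegree_X_pow_sub_C]
      omega
  · rw [hg] at hgc
    exact three_le_card_support_of_aeval_eq_zero hβ hβ0 (by omega) hc hdeg
      ((minpoly.dvd_iff).mp ((dvd_mul_right _ _).trans hgc))
      ((minpoly.dvd_iff).mp ((dvd_mul_left _ _).trans hgc))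
end
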